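/- A simple 3-connected graph has width at most 3 if and only if it has no minor in F_0 = {K_{3,3}, K_5, C, H, O}. -/

import Mathlib

/-!  Common definitions: multigraphs, separations, width, minors,
Kirchhoff/Dodgson polynomials, Feynman 5-splitting, enhanced graphs. -/

noncomputable section

attribute [local instance] Classical.propDecidable

/-- A finite multigraph, given by finite vertex and edge types together with
source and target maps (an arbitrary orientation of each edge). -/
structure Multigraph : Type 1 where
  V : Type
  E : Type
  [fintypeV : Fintype V]
  [fintypeE : Fintype E]
  src : E → V
  tgt : E → V

attribute [instance] Multigraph.fintypeV Multigraph.fintypeE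

namespace Multigraph

variable (G : Multigraph)

/-- The endpoints of an edge as an unordered pair. -/
def ends (e : G.E) : Sym2 G.V := s(G.src e, G.tgt e)

/-- Incidence of a vertex with an edge. -/
def inc (v : G.V) (e : G.E) : Prop := v = G.src e ∨ v = G.tgt e

/-- `V(G_A)`: the vertices of the subgraph induced by an edge set `A`. -/
def edgeVerts (A : Set G.E) : Set G.V := {v | ∃ e ∈ A, G.inc v e}

/-- The order of the separation `(A, Aᶜ)` of the graph `G`,
i.e. `|V(G_A) ∩ V(G_B)|` where `B = Aᶜ`. -/
def sepOrder (A : Set G.E) : ℕ := (G.edgeVerts A ∩ G.edgeVerts Aᶜ).ncard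

/-- One step along an edge belonging to the edge set `A`. -/
def stepOn (A : Set G.E) (a b : G.V) : Prop :=
  ∃ e ∈ A, (G.src e = a ∧ G.tgt e = b) ∨ (G.src e = b ∧ G.tgt e = a)

/-- Reachability using only edges in `A`. -/
def reachOn (A : Set G.E) : G.V → G.V → Prop := Relation.ReflTransGen (G.stepOn A)

/-- Adjacency. -/
def Adj (a b : G.V) : Prop := G.stepOn Set.univ a b

/-- One adjacency step staying inside the vertex set `U`. -/
def stepWithin (U : Set G.V) (a b : G.V) : Prop := a ∈ U ∧ b ∈ U ∧ G.Adj a b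

/-- The subgraph induced by the vertex set `U` is (nonempty and) connected. -/
def ConnectedWithin (U : Set G.V) : Prop :=
  U.Nonempty ∧ ∀ a ∈ U, ∀ b ∈ U, Relation.ReflTransGen (G.stepWithin U) a b

/-- Connectivity of the multigraph. -/
def Connected : Prop := G.ConnectedWithin Set.univ

/-- A multigraph is simple if it has no loops and no parallel edges. -/
def Simple : Prop := (∀ e : G.E, G.src e ≠ G.tgt e) ∧ Function.Injective G.ends

/-- 3-connectivity: at least 4 vertices, and removing fewer than 3 vertices
leaves a connected graph. -/
def ThreeConnected : Prop :=
  4 ≤ Fintype.card G.V ∧ ∀ S : Set G.V, S.ncard < 3 → G.ConnectedWithin Sᶜ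

/-- The spanning subgraph with edge set `T` is connected. -/
def ConnectedOn (T : Set G.E) : Prop := ∀ a b : G.V, G.reachOn T a b

/-- The degree of `v` in the spanning subgraph with edge set `T`
(loops count twice). -/
def degOn (T : Set G.E) (v : G.V) : ℕ :=
  ({e ∈ T | G.src e = v}).ncard + ({e ∈ T | G.tgt e = v}).ncard

/-- The degree of a vertex (loops count twice). -/
def degree (v : G.V) : ℕ := G.degOn Set.univ v

/-- An edge set is a forest (contains no cycle) iff every nonempty subset
has a vertex of degree exactly one. -/
def IsForest (T : Set G.E) : Prop :=
  ∀ T' ⊆ T, T'.Nonempty → ∃ v : G.V, G.degOn T' v = 1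

/-- `T` is the edge set of a spanning tree of `G`. -/
def IsSpanningTree (T : Set G.E) : Prop := G.IsForest T ∧ G.ConnectedOn T

/-- The rank of an edge set in the cycle matroid `M(G)`:
the size of a largest forest contained in it. -/
def rk (A : Set G.E) : ℕ := sSup {n | ∃ T ⊆ A, G.IsForest T ∧ T.ncard = n}

/-- The order of the separation `(A, Aᶜ)` in the cycle matroid `M(G)`,
namely `r(A) + r(Aᶜ) - r(E) + 1`. -/
def msepOrder (A : Set G.E) : ℕ := G.rk A + G.rk Aᶜ + 1 - G.rk Set.univ

/-- The number of connected components of `G_A`, the subgraph induced by the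
edge set `A`. -/
def ncompOn (A : Set G.E) : ℕ :=
  ({C : Set G.V | ∃ v ∈ G.edgeVerts A, C = {w | G.reachOn A v w}}).ncard

/-- `G` has an edge ordering of width at most `k`: every prefix/suffix
separation has order at most `k`. -/
def WidthLE (k : ℕ) : Prop :=
  ∃ f : Fin (Fintype.card G.E) ≃ G.E,
    ∀ ℓ : ℕ,
      G.sepOrder {e | ∃ i : Fin (Fintype.card G.E), f i = e ∧ (i : ℕ) < ℓ} ≤ k

/-- The width of `G`: the minimum width of an edge ordering. -/
def width : ℕ := sInf {k | G.WidthLE k}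

/-- The minor of `G` obtained by deleting the edges in `D` and contracting the
edges in `C`. -/
def minorDC (D C : Set G.E) : Multigraph :=
  let rel : G.V → G.V → Prop := fun a b => ∃ e ∈ C, G.src e = a ∧ G.tgt e = b
  { V := Quot rel
    E := {e : G.E // e ∉ D ∪ C}
    fintypeV := @Fintype.ofFinite _ (Finite.of_surjective (Quot.mk rel) fun q => Quot.exists_rep q)
    fintypeE := Fintype.ofFinite _
    src := fun e => Quot.mk rel (G.src e.1)
    tgt := fun e => Quot.mk rel (G.tgt e.1) }

/-- Deletion of a vertex (together with all incident edges). -/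
def deleteVertex (v : G.V) : Multigraph :=
  { V := {w : G.V // w ≠ v}
    E := {e : G.E // ¬ G.inc v e}
    fintypeV := Fintype.ofFinite _
    fintypeE := Fintype.ofFinite _
    src := fun e => ⟨G.src e.1, fun h => e.2 (Or.inl h.symm)⟩
    tgt := fun e => ⟨G.tgt e.1, fun h => e.2 (Or.inr h.symm)⟩ }

/-- The edges having one endpoint in `X` and the other in `Y`. -/
def crossEdges (X Y : Set G.V) : Set G.E :=
  {e | (G.src e ∈ X ∧ G.tgt e ∈ Y) ∨ (G.src e ∈ Y ∧ G.tgt e ∈ X)}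

/-- `G` has `R` as a minor, via branch sets. -/
def HasMinor (R : Multigraph) : Prop :=
  ∃ X : R.V → Set G.V,
    (∀ v : R.V, G.ConnectedWithin (X v)) ∧
    (Pairwise fun v w => Disjoint (X v) (X w)) ∧
    ∀ v w : R.V, v ≠ w →
      ({f : R.E | R.ends f = s(v, w)}).ncard ≤ (G.crossEdges (X v) (X w)).ncard

/-- `D` is the edge set of a cycle of `G`. -/
def IsCycleSet (D : Set G.E) : Prop :=
  D.Nonempty ∧ (∀ v ∈ G.edgeVerts D, G.degOn D v = 2) ∧
    ∀ a ∈ G.edgeVerts D, ∀ b ∈ G.edgeVerts D, G.reachOn D a b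

/-- The side `A` of a separation on `X` is rich: for every `x ∈ X` there is a
cycle `D` avoiding `x` with at most one edge outside `A`. -/
def Rich (A : Set G.E) (X : Set G.V) : Prop :=
  ∀ x ∈ X, ∃ D : Set G.E, G.IsCycleSet D ∧ x ∉ G.edgeVerts D ∧ (D \ A).ncard ≤ 1

/-- The entry of the (edge × vertex) incidence matrix, as a polynomial. -/
def incCol (e : G.E) (v : G.V) : MvPolynomial G.E ℤ :=
  (if G.src e = v then 1 else 0) - (if G.tgt e = v then 1 else 0)

/-- The expanded Kirchhoff matrix `M_G` (with the column of `v0` deleted). -/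
def bigMatrix (v0 : G.V) :
    Matrix (G.E ⊕ {v : G.V // v ≠ v0}) (G.E ⊕ {v : G.V // v ≠ v0}) (MvPolynomial G.E ℤ) :=
  Matrix.of fun r c =>
    match r, c with
    | Sum.inl e, Sum.inl f => if e = f then MvPolynomial.X e else 0
    | Sum.inl e, Sum.inr v => G.incCol e v.1
    | Sum.inr v, Sum.inl e => - G.incCol e v.1
    | Sum.inr _, Sum.inr _ => 0

/-- The Dodgson polynomial `Ψ^{I,J}_K`: delete the rows indexed by `I` and the
columns indexed by `J` from `M_G`, take the determinant, and set `x_e = 0`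
for `e ∈ K`.  (It is well defined up to an overall sign.) -/
def dodgson (v0 : G.V) (I J K : Set G.E) : MvPolynomial G.E ℤ :=
  if h : Nonempty ({e : G.E // e ∉ I} ≃ {e : G.E // e ∉ J}) then
    MvPolynomial.aeval (fun e => if e ∈ K then (0 : MvPolynomial G.E ℤ) else MvPolynomial.X e)
      (Matrix.det (Matrix.of fun r c =>
        G.bigMatrix v0 (Sum.map Subtype.val id r) (Sum.map (fun x => (h.some x).1) id c)))
  else 0

/-- `(I,J,K)` is one of the 30 Dodgson configurations associated with the
5-configuration `S`. -/
def DodgsonConfig (S I J K : Set G.E) : Prop :=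
  I ∪ J ∪ K = S ∧
    ((I.ncard = 2 ∧ J.ncard = 2 ∧ K.ncard = 1 ∧ I ∩ J = ∅ ∧ I ∩ K = ∅ ∧ J ∩ K = ∅) ∨
      (I.ncard = 3 ∧ J.ncard = 3 ∧ K = ∅ ∧ (I ∩ J).ncard = 1))

/-- The 5-configuration `S` splits: one of its 30 associated Dodgson
polynomials is identically zero. -/
def ConfigSplits (S : Set G.E) : Prop :=
  ∃ I J K : Set G.E, G.DodgsonConfig S I J K ∧ ∀ v0 : G.V, G.dodgson v0 I J K = 0

/-- `G` is Feynman 5-split: every 5-configuration splits. -/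
def FeynmanSplit : Prop := ∀ S : Set G.E, S.ncard = 5 → G.ConfigSplits S

/-- `(U, F)` is a subgraph of `G` (every edge of `F` has both ends in `U`). -/
def IsSubgraphPair (U : Set G.V) (F : Set G.E) : Prop :=
  ∀ e ∈ F, G.src e ∈ U ∧ G.tgt e ∈ U

/-- `G` decomposes into edge-disjoint subgraphs `G₁ ∪ G₂ = G` with
`|V(G₁) ∩ V(G₂)| ≤ 2` and `|E(G₁) ∩ S| = 2`, or with
`|V(G₁) ∩ V(G₂)| = 1` and `|E(G₁) ∩ S| = 1`. -/
def splitWitness (S : Set G.E) : Prop :=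
  ∃ (U1 U2 : Set G.V) (F1 F2 : Set G.E),
    G.IsSubgraphPair U1 F1 ∧ G.IsSubgraphPair U2 F2 ∧
    Disjoint F1 F2 ∧ U1 ∪ U2 = Set.univ ∧ F1 ∪ F2 = Set.univ ∧
    (((U1 ∩ U2).ncard ≤ 2 ∧ (F1 ∩ S).ncard = 2) ∨
      ((U1 ∩ U2).ncard = 1 ∧ (F1 ∩ S).ncard = 1))

/-- A separation of order at most 1 with edges of `S` on both sides, or a
("bad") 2-separation with `min{|A ∩ S|, |B ∩ S|} = 2`. -/
def badSplitSep (S : Set G.E) : Prop :=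
  ∃ A : Set G.E,
    (G.sepOrder A ≤ 1 ∧ (A ∩ S).Nonempty ∧ (Aᶜ ∩ S).Nonempty) ∨
      (G.sepOrder A = 2 ∧ min (A ∩ S).ncard (Aᶜ ∩ S).ncard = 2)

/-- Isomorphism of multigraphs. -/
def IsoTo (G' : Multigraph) : Prop :=
  ∃ (α : G.V ≃ G'.V) (β : G.E ≃ G'.E),
    ∀ e : G.E, G'.ends (β e) = Sym2.map α (G.ends e)

/-- `G` is a tree. -/
def IsTree : Prop := G.Connected ∧ G.IsForest Set.univ

/-- Every vertex has degree 1 or 3. -/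
def IsCubic : Prop := ∀ v : G.V, G.degree v = 1 ∨ G.degree v = 3

/-- A leaf. -/
def IsLeaf (v : G.V) : Prop := G.degree v = 1

/-- A cubic caterpillar: a cubic tree whose non-leaf vertices induce a path. -/
def IsCubicCaterpillar : Prop :=
  G.IsTree ∧ G.IsCubic ∧
    (∀ a ∈ {v : G.V | ¬ G.IsLeaf v}, ∀ b ∈ {v : G.V | ¬ G.IsLeaf v},
      Relation.ReflTransGen (G.stepWithin {v : G.V | ¬ G.IsLeaf v}) a b) ∧
    ∀ v : G.V, ¬ G.IsLeaf v →
      ({e : G.E | G.inc v e ∧ ∃ w : G.V, ¬ G.IsLeaf w ∧ G.inc w e ∧ w ≠ v}).ncard ≤ 2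

/-- The branch decomposition `(T, φ)` of the cycle matroid `M(G)` has width at
most `k`: removing any edge `f` of `T` gives a separation of the ground set
of matroid order at most `k`. -/
def branchWidthLE (T : Multigraph) (φ : G.E → T.V) (k : ℕ) : Prop :=
  ∀ f : T.E,
    G.msepOrder {e : G.E | φ e ∈ {x : T.V | T.reachOn {f}ᶜ (T.src f) x}} ≤ k

/-- `(T, φ)` is a branch decomposition of `M(G)` over a cubic caterpillar. -/
def IsCatDecomp (T : Multigraph) (φ : G.E → T.V) : Prop :=
  T.IsCubicCaterpillar ∧ Function.Injective φ ∧ ∀ e : G.E, T.IsLeaf (φ e)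

/-- The caterpillar width of the cycle matroid `M(G)`. -/
def catWidth : ℕ :=
  sInf {k | ∃ (T : Multigraph) (φ : G.E → T.V), G.IsCatDecomp T φ ∧ G.branchWidthLE T φ k}

end Multigraph

/-! ### Concrete graphs -/

/-- The complete graph `K₅`. -/
def K5m : Multigraph where
  V := Fin 5
  E := {p : Fin 5 × Fin 5 // p.1 < p.2}
  src := fun e => e.1.1
  tgt := fun e => e.1.2

/-- The complete bipartite graph `K₃,₃`. -/
def K33m : Multigraph where
  V := Fin 3 ⊕ Fin 3
  E := Fin 3 × Fin 3
  src := fun e => Sum.inl e.1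
  tgt := fun e => Sum.inr e.2

/-- The cube (3-dimensional hypercube) graph `C`. -/
def cubeM : Multigraph where
  V := Fin 2 × Fin 2 × Fin 2
  E := Fin 3 × Fin 2 × Fin 2
  src := fun e =>
    if e.1 = 0 then (0, e.2.1, e.2.2) else if e.1 = 1 then (e.2.1, 0, e.2.2)
      else (e.2.1, e.2.2, 0)
  tgt := fun e =>
    if e.1 = 0 then (1, e.2.1, e.2.2) else if e.1 = 1 then (e.2.1, 1, e.2.2)
      else (e.2.1, e.2.2, 1)

/-- The octahedron graph `O = K₂,₂,₂`. -/
def octaM : Multigraph where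
  V := Fin 3 × Fin 2
  E := {p : (Fin 3 × Fin 2) × (Fin 3 × Fin 2) // p.1.1 < p.2.1}
  src := fun e => e.1.1
  tgt := fun e => e.1.2

/-- The edges of the graph `H` (the cube after a Y–Δ transformation at one
vertex): vertices `0,1,2` form the new triangle, `6` is the antipodal vertex. -/
def hEdgeList : List (Fin 7 × Fin 7) :=
  [(0,1), (0,2), (1,2), (0,3), (0,4), (1,3), (1,5), (2,4), (2,5), (3,6), (4,6), (5,6)]

/-- The graph `H`, one Δ–Y away from each of the cube and the octahedron. -/
def Hm : Multigraph where
  V := Fin 7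
  E := {p : Fin 7 × Fin 7 // p ∈ hEdgeList}
  src := fun e => e.1.1
  tgt := fun e => e.1.2

/-- The complete graph `K₄`. -/
def K4m : Multigraph where
  V := Fin 4
  E := {p : Fin 4 × Fin 4 // p.1 < p.2}
  src := fun e => e.1.1
  tgt := fun e => e.1.2

/-- `K₅⁻`, the complete graph on 5 vertices minus the edge `{3,4}`. -/
def K5minusM : Multigraph where
  V := Fin 5
  E := {p : Fin 5 × Fin 5 // p.1 < p.2 ∧ ¬(p.1 = 3 ∧ p.2 = 4)}
  src := fun e => e.1.1
  tgt := fun e => e.1.2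

/-- The wheel `W_k`: centre `none`; rim edges `Sum.inl i` join `some i` to
`some (i+1)`, spoke edges `Sum.inr i` join the centre to `some i`. -/
def wheelM (k : ℕ) : Multigraph where
  V := Option (Fin k)
  E := Fin k ⊕ Fin k
  src := Sum.elim (fun i => some i) (fun _ => none)
  tgt := Sum.elim (fun i => some (finRotate k i)) (fun i => some i)

/-! ### Enhanced graphs -/

/-- An enhanced graph: a graph together with sets of contract-proof and
delete-proof edges. -/
structure EGraph : Type 1 where
  G : Multigraph
  Cp : Set G.E
  Dp : Set G.E

namespace EGraph

/-- The 5-configuration `S` of an enhanced graph splits. -/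
def Splits (H : EGraph) (S : Set H.G.E) : Prop :=
  H.G.badSplitSep S ∨
    (∃ f ∈ S \ H.Dp, (H.G.minorDC {f} ∅).badSplitSep {e | e.1 ∈ S}) ∨
    (∃ f ∈ S \ H.Cp, (H.G.minorDC ∅ {f}).badSplitSep {e | e.1 ∈ S})

/-- An enhanced graph is non-split if it has a non-split 5-configuration. -/
def NonSplit (H : EGraph) : Prop := ∃ S : Set H.G.E, S.ncard = 5 ∧ ¬ H.Splits S

/-- Deletion of an edge. -/
def delE (H : EGraph) (f : H.G.E) : EGraph :=
  ⟨H.G.minorDC {f} ∅, {e | e.1 ∈ H.Cp}, {e | e.1 ∈ H.Dp}⟩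

/-- Contraction of an edge. -/
def conE (H : EGraph) (f : H.G.E) : EGraph :=
  ⟨H.G.minorDC ∅ {f}, {e | e.1 ∈ H.Cp}, {e | e.1 ∈ H.Dp}⟩

/-- Deletion of a vertex. -/
def delV (H : EGraph) (v : H.G.V) : EGraph :=
  ⟨H.G.deleteVertex v, {e | e.1 ∈ H.Cp}, {e | e.1 ∈ H.Dp}⟩

/-- Remove an edge from the contract-proof set. -/
def unprotC (H : EGraph) (f : H.G.E) : EGraph := ⟨H.G, H.Cp \ {f}, H.Dp⟩

/-- Remove an edge from the delete-proof set. -/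
def unprotD (H : EGraph) (f : H.G.E) : EGraph := ⟨H.G, H.Cp, H.Dp \ {f}⟩

/-- Delete `f'` of a parallel pair `f, f'` and make `f` delete-proof. -/
def parallelReduce (H : EGraph) (f f' : H.G.E) : EGraph :=
  ⟨H.G.minorDC {f'} ∅, {e | e.1 ∈ H.Cp}, {e | e.1 ∈ H.Dp ∨ e.1 = f}⟩

/-- Contract `f'` of the two edges `f, f'` at a degree-two vertex and make
`f` contract-proof. -/
def seriesReduce (H : EGraph) (f f' : H.G.E) : EGraph :=
  ⟨H.G.minorDC ∅ {f'}, {e | e.1 ∈ H.Cp ∨ e.1 = f}, {e | e.1 ∈ H.Dp}⟩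

/-- One step of the enhanced-graph minor relation. -/
inductive MinorStep : EGraph → EGraph → Prop
  | delV (H : EGraph) (v : H.G.V) : MinorStep H (H.delV v)
  | delE (H : EGraph) (f : H.G.E) : MinorStep H (H.delE f)
  | conE (H : EGraph) (f : H.G.E) : MinorStep H (H.conE f)
  | unprotC (H : EGraph) (f : H.G.E) (hf : f ∈ H.Cp) : MinorStep H (H.unprotC f)
  | unprotD (H : EGraph) (f : H.G.E) (hf : f ∈ H.Dp) : MinorStep H (H.unprotD f)
  | parallel (H : EGraph) (f f' : H.G.E) (hne : f ≠ f')
      (hpar : H.G.ends f = H.G.ends f') : MinorStep H (H.parallelReduce f f')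
  | series (H : EGraph) (f f' : H.G.E) (v : H.G.V) (hne : f ≠ f')
      (hf : H.G.inc v f) (hf' : H.G.inc v f')
      (hdeg : ∀ e : H.G.E, H.G.inc v e → e = f ∨ e = f') :
      MinorStep H (H.seriesReduce f f')

/-- Minor-minimal non-split enhanced graph: non-split, but every proper
enhanced minor is split. -/
def MinorMinimalNonSplit (H : EGraph) : Prop :=
  H.NonSplit ∧ ∀ H' : EGraph, Relation.TransGen MinorStep H H' → ¬ H'.NonSplit

/-- Isomorphism of enhanced graphs. -/
def IsoTo (H H' : EGraph) : Prop :=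
  ∃ (α : H.G.V ≃ H'.G.V) (β : H.G.E ≃ H'.G.E),
    (∀ e : H.G.E, H'.G.ends (β e) = Sym2.map α (H.G.ends e)) ∧
    (∀ e : H.G.E, β e ∈ H'.Cp ↔ e ∈ H.Cp) ∧
    (∀ e : H.G.E, β e ∈ H'.Dp ↔ e ∈ H.Dp)

end EGraph

/-- The edge `01` of `K₄`. -/
def e01K4 : K4m.E := ⟨(0, 1), by decide⟩

/-- The enhanced graph `K₄(1)`: all edges of `K₄` except one are both
contract-proof and delete-proof. -/
def K4one : EGraph := ⟨K4m, {e | e ≠ e01K4}, {e | e ≠ e01K4}⟩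

end

namespace WidthThree
open Finset
open scoped Classical

variable {V : Type*} {G : SimpleGraph V}

/-- Some edge joins the two vertex sets. -/
def Touch (G : SimpleGraph V) (A B : Finset V) : Prop := ∃ a ∈ A, ∃ b ∈ B, G.Adj a b

/-- A nonempty vertex set inducing a connected subgraph, phrased through cuts. -/
def Conn (G : SimpleGraph V) (B : Finset V) : Prop :=
  B.Nonempty ∧ ∀ A ⊆ B, A.Nonempty → A ≠ B → Touch G A (B \ A)

theorem Touch.symm {A B : Finset V} (h : Touch G A B) : Touch G B A := by
  obtain ⟨a, ha, b, hb, hab⟩ := h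
  exact ⟨b, hb, a, ha, hab.symm⟩

theorem Touch.mono {A B A' B' : Finset V} (h : Touch G A B) (hA : A ⊆ A') (hB : B ⊆ B') :
    Touch G A' B' := by
  obtain ⟨a, ha, b, hb, hab⟩ := h
  exact ⟨a, hA ha, b, hB hb, hab⟩

theorem conn_singleton (a : V) : Conn G {a} := by
  refine ⟨⟨a, by simp⟩, fun A hA hne h => ?_⟩
  rcases Finset.subset_singleton_iff.1 hA with h1 | h1
  · simp [h1] at hne
  · exact absurd h1 h

theorem Conn.touch_compl {B Z : Finset V} (h : Conn G B) {a b : V} (ha : a ∈ B) (haZ : a ∈ Z)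
    (hb : b ∈ B) (hbZ : b ∉ Z) : ∃ x ∈ B, x ∈ Z ∧ ∃ y ∈ B, y ∉ Z ∧ G.Adj x y := by
  obtain ⟨x, hx, y, hy, hxy⟩ := h.2 (B ∩ Z) inter_subset_left ⟨a, by grind⟩ (by grind)
  exact ⟨x, by grind, by grind, y, by grind, by grind, hxy⟩

theorem conn_of_cut {B : Finset V} (hne : B.Nonempty)
    (h : ∀ Z : Finset V, ∀ a ∈ B, a ∈ Z → ∀ b ∈ B, b ∉ Z →
      ∃ x ∈ B, ∃ y ∈ B, (x ∈ Z ↔ y ∉ Z) ∧ G.Adj x y) : Conn G B := by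
  refine ⟨hne, fun A hA hAne hAB => ?_⟩
  obtain ⟨a, ha⟩ := hAne
  have : ∃ b ∈ B, b ∉ A := by
    by_contra hcon
    exact hAB (by grind)
  obtain ⟨b, hb, hbA⟩ := this
  obtain ⟨x, hx, y, hy, hxy, hadj⟩ := h A a (hA ha) ha b hb hbA
  by_cases hxA : x ∈ A
  · exact ⟨x, hxA, y, by grind, hadj⟩
  · exact ⟨y, by grind, x, by grind, hadj.symm⟩

theorem Conn.union {A B : Finset V} (hA : Conn G A) (hB : Conn G B) (h : Touch G A B) :
    Conn G (A ∪ B) := by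
  obtain ⟨s, hs, t, ht, hst⟩ := h
  refine conn_of_cut ⟨s, by grind⟩ fun Z a ha haZ b hb hbZ => ?_
  by_cases hA1 : ∃ x ∈ A, x ∈ Z
  · by_cases hA2 : ∃ x ∈ A, x ∉ Z
    · obtain ⟨x, hx, hxZ⟩ := hA1
      obtain ⟨y, hy, hyZ⟩ := hA2
      obtain ⟨x', h1, h2, y', h3, h4, h5⟩ := hA.touch_compl hx hxZ hy hyZ
      exact ⟨x', by grind, y', by grind, by grind, h5⟩
    · by_cases hB2 : ∃ x ∈ B, x ∈ Z
      · obtain ⟨x, hx, hxZ⟩ := hB2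
        obtain ⟨x', h1, h2, y', h3, h4, h5⟩ := hB.touch_compl hx hxZ (b := b) (by grind) hbZ
        exact ⟨x', by grind, y', by grind, by grind, h5⟩
      · exact ⟨s, by grind, t, by grind, by grind, hst⟩
  · by_cases hB2 : ∃ x ∈ B, x ∉ Z
    · obtain ⟨y, hy, hyZ⟩ := hB2
      obtain ⟨x', h1, h2, y', h3, h4, h5⟩ := hB.touch_compl (a := a) (by grind) haZ hy hyZ
      exact ⟨x', by grind, y', by grind, by grind, h5⟩
    · exact ⟨s, by grind, t, by grind, by grind, hst⟩

theorem Conn.insert {A : Finset V} (hA : Conn G A) {v a : V} (ha : a ∈ A) (h : G.Adj v a) :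
    Conn G (insert v A) := by
  have := (conn_singleton (G := G) v).union hA ⟨v, by simp, a, ha, h⟩
  rwa [Finset.singleton_union] at this

theorem exists_component {Y : Finset V} {t : V} (ht : t ∈ Y) :
    ∃ C ⊆ Y, t ∈ C ∧ Conn G C ∧ ∀ x ∈ C, ∀ y ∈ Y, G.Adj x y → y ∈ C := by
  let F := Y.powerset.filter fun C => t ∈ C ∧ ∀ x ∈ C, ∀ y ∈ Y, G.Adj x y → y ∈ C
  have hF : F.Nonempty := ⟨Y, by simp [F, ht]; grind⟩
  obtain ⟨C, hC, hmin⟩ := F.exists_min_image Finset.card hF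
  simp only [F, mem_filter, mem_powerset] at hC hmin
  obtain ⟨hCY, htC, hcl⟩ := hC
  refine ⟨C, hCY, htC, ⟨⟨t, htC⟩, fun A hA hne hAC => ?_⟩, hcl⟩
  by_contra hno
  have hno' : ∀ a ∈ A, ∀ b ∈ C, G.Adj a b → b ∈ A := by
    intro a ha b hb hab
    by_contra hbA
    exact hno ⟨a, ha, b, by grind, hab⟩
  have hss : A ⊂ C := Finset.ssubset_iff_subset_ne.2 ⟨hA, hAC⟩
  by_cases htA : t ∈ A
  · have := hmin A ⟨hA.trans hCY, htA, fun x hx y hy hxy =>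
      hno' x hx y (hcl x (hA hx) y hy hxy) hxy⟩
    exact absurd (Finset.card_lt_card hss) (by omega)
  · have h2 := hmin (C \ A) ⟨by grind, by grind, fun x hx y hy hxy => by
      have hyC := hcl x (by grind) y hy hxy
      have : y ∉ A := fun hyA => by
        have := hno' y hyA x (by grind) hxy.symm
        grind
      grind⟩
    have h3 := Finset.card_sdiff_add_card_eq_card hA
    have := hne.card_pos
    omega

theorem Conn.exists_split {S : Finset V} (hS : Conn G S) {s t : V} (hs : s ∈ S) (ht : t ∈ S)
    (hst : s ≠ t) : ∃ A B, A ∪ B = S ∧ Disjoint A B ∧ Conn G A ∧ Conn G B ∧ s ∈ A ∧ t ∈ B := by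
  obtain ⟨C, hCS, htC, hC, hcl⟩ := exists_component (G := G) (Y := S.erase s) (t := t) (by grind)
  refine ⟨S \ C, C, by grind, by grind [Finset.disjoint_left], ?_, hC, by grind, htC⟩
  have key : ∀ Z : Finset V, ∀ a ∈ S \ C, a ∈ Z → s ∉ Z →
      ∃ x ∈ S \ C, ∃ y ∈ S \ C, x ∈ Z ∧ y ∉ Z ∧ G.Adj x y := by
    intro Z a ha haZ hsZ
    obtain ⟨x, hx, hxZ, y, hy, hyZ, hxy⟩ := hS.touch_compl (Z := Z \ C) (a := a) (b := s)
      (by grind) (by grind) hs (by grind)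
    refine ⟨x, by grind, y, ?_, by grind, ?_, hxy⟩
    · have : y ∉ C := fun hyC => by
        have := hcl y hyC x (by grind) hxy.symm
        grind
      grind
    · have : y ∉ C := fun hyC => by
        have := hcl y hyC x (by grind) hxy.symm
        grind
      grind
  refine conn_of_cut ⟨s, by grind⟩ fun Z a ha haZ b hb hbZ => ?_
  by_cases hsZ : s ∈ Z
  · obtain ⟨x, hx, y, hy, h1, h2, h3⟩ := key (S \ Z) b hb (by grind) (by grind)
    exact ⟨x, hx, y, hy, by grind, h3⟩
  · obtain ⟨x, hx, y, hy, h1, h2, h3⟩ := key Z a ha haZ hsZ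
    exact ⟨x, hx, y, hy, by grind, h3⟩

/-- Neighbours inside `S` of the vertex set `M`. -/
noncomputable def nbr (G : SimpleGraph V) (S M : Finset V) : Finset V :=
  S.filter fun x => x ∉ M ∧ ∃ m ∈ M, G.Adj m x

theorem mem_nbr {S M : Finset V} {x : V} :
    x ∈ nbr G S M ↔ x ∈ S ∧ x ∉ M ∧ ∃ m ∈ M, G.Adj m x := by
  simp [nbr]

/-- The subgraph induced by `S` is 3-connected. -/
def TC (G : SimpleGraph V) (S : Finset V) : Prop :=
  4 ≤ #S ∧ ∀ M ⊆ S, M.Nonempty → (∃ x ∈ S, x ∉ M ∧ x ∉ nbr G S M) → 3 ≤ #(nbr G S M)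

/-- `E` is the edge list of a graph that is a minor of the subgraph induced by `S`. -/
def IsMinor {n : ℕ} (G : SimpleGraph V) (S : Finset V) (E : List (Fin n × Fin n)) : Prop :=
  ∃ B : Fin n → Finset V, (∀ i, Conn G (B i)) ∧ (∀ i, B i ⊆ S) ∧
    (∀ i j, i < j → Disjoint (B i) (B j)) ∧ ∀ e ∈ E, Touch G (B e.1) (B e.2)

/-- Contraction of the edge `cp`: the vertex `c` is merged into `p`, to be used away from `c`. -/
def con (G : SimpleGraph V) (c p : V) : SimpleGraph V where
  Adj x y := x ≠ y ∧ (G.Adj x y ∨ (x = p ∧ G.Adj c y) ∨ (y = p ∧ G.Adj c x))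
  symm := ⟨fun x y h => ⟨h.1.symm, by
    rcases h.2 with h | h | h
    · exact Or.inl h.symm
    · exact Or.inr (Or.inr h)
    · exact Or.inr (Or.inl h)⟩⟩
  loopless := ⟨fun _ h => h.1 rfl⟩

theorem con_adj {c p x y : V} :
    (con G c p).Adj x y ↔ x ≠ y ∧ (G.Adj x y ∨ (x = p ∧ G.Adj c y) ∨ (y = p ∧ G.Adj c x)) :=
  Iff.rfl

end WidthThree

namespace WidthThree
open Finset
open scoped Classical
variable {V : Type*} {G : SimpleGraph V}

/-- Vertex sets of the contraction lifted to the original graph. -/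
noncomputable def lift (c p : V) (B : Finset V) : Finset V := if p ∈ B then insert c B else B

theorem subset_lift {c p : V} {B : Finset V} : B ⊆ lift c p B := by
  unfold lift; split_ifs <;> grind

theorem mem_lift {c p x : V} {B : Finset V} : x ∈ lift c p B ↔ x ∈ B ∨ (x = c ∧ p ∈ B) := by
  unfold lift; split_ifs <;> grind

theorem Touch.lift {c p : V} {A B : Finset V} (h : Touch (con G c p) A B) :
    Touch G (lift c p A) (lift c p B) := by
  obtain ⟨a, ha, b, hb, hne, h | ⟨rfl, h⟩ | ⟨rfl, h⟩⟩ := h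
  · exact ⟨a, subset_lift ha, b, subset_lift hb, h⟩
  · exact ⟨c, mem_lift.2 (Or.inr ⟨rfl, ha⟩), b, subset_lift hb, h⟩
  · exact ⟨a, subset_lift ha, c, mem_lift.2 (Or.inr ⟨rfl, hb⟩), h.symm⟩

theorem Conn.lift {c p : V} {B : Finset V} (hcp : G.Adj c p) (h : Conn (con G c p) B) :
    Conn G (lift c p B) := by
  refine conn_of_cut (h.1.mono subset_lift) fun Z a ha haZ b hb hbZ => ?_
  by_cases hsplit : p ∈ B ∧ ¬ (c ∈ Z ↔ p ∈ Z)
  · exact ⟨c, by grind [mem_lift], p, by grind [mem_lift], by grind, hcp⟩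
  · have h1 : ∃ a' ∈ B, a' ∈ Z := by
      rcases mem_lift.1 ha with h | h
      · exact ⟨a, h, haZ⟩
      · exact ⟨p, by grind⟩
    have h2 : ∃ a' ∈ B, a' ∉ Z := by
      rcases mem_lift.1 hb with h | h
      · exact ⟨b, h, hbZ⟩
      · exact ⟨p, by grind⟩
    obtain ⟨a', ha', haZ'⟩ := h1
    obtain ⟨b', hb', hbZ'⟩ := h2
    obtain ⟨x, hx, hxZ, y, hy, hyZ, hne, hadj | ⟨rfl, hadj⟩ | ⟨rfl, hadj⟩⟩ :=
      h.touch_compl ha' haZ' hb' hbZ'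
    · exact ⟨x, subset_lift hx, y, subset_lift hy, by grind, hadj⟩
    · exact ⟨c, by grind [mem_lift], y, subset_lift hy, by grind, hadj⟩
    · exact ⟨x, subset_lift hx, c, by grind [mem_lift], by grind, hadj.symm⟩

theorem IsMinor.of_con {n : ℕ} {c p : V} {S : Finset V} {E : List (Fin n × Fin n)} (hc : c ∈ S)
    (hcp : G.Adj c p) (h : IsMinor (con G c p) (S.erase c) E) : IsMinor G S E := by
  obtain ⟨B, hconn, hsub, hdisj, hE⟩ := h
  refine ⟨fun i => lift c p (B i), fun i => (hconn i).lift hcp, fun i x hx => ?_,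
    fun i j hij => ?_, fun e he => (hE e he).lift⟩
  · have := hsub i
    grind [mem_lift]
  · have := hdisj i j hij
    have h1 := hsub i
    have h2 := hsub j
    rw [Finset.disjoint_left] at this ⊢
    intro x hx hx'
    rw [mem_lift] at hx hx'
    grind

theorem TC.false_of_sep {S M T : Finset V} (h : TC G S) (hM : M ⊆ S) (hne : M.Nonempty)
    (hT : #T ≤ 2) (hN : ∀ m ∈ M, ∀ y ∈ S, G.Adj m y → y ∈ M ∨ y ∈ T) {x : V} (hx : x ∈ S)
    (hxM : x ∉ M) (hxT : x ∉ T) : False := by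
  have hsub : nbr G S M ⊆ T := fun y hy => by
    obtain ⟨h1, h2, m, hm, hmy⟩ := mem_nbr.1 hy
    exact (hN m hm y h1 hmy).resolve_left h2
  have := h.2 M hM hne ⟨x, hx, hxM, fun h => hxT (hsub h)⟩
  have := card_le_card hsub
  omega

theorem TC.three_le_nbr {S M : Finset V} (h : TC G S) (hM : M ⊆ S) (hne : M.Nonempty)
    (hc : #M + 3 ≤ #S) : 3 ≤ #(nbr G S M) := by
  by_cases hx : ∃ x ∈ S, x ∉ M ∧ x ∉ nbr G S M
  · exact h.2 M hM hne hx
  · have : S \ M ⊆ nbr G S M := by grind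
    have h1 := card_le_card this
    have := card_sdiff_add_card_eq_card hM
    omega

theorem TC.three_le_degree {S : Finset V} (h : TC G S) {v : V} (hv : v ∈ S) :
    3 ≤ #(S.filter fun x => G.Adj v x) := by
  have h1 := h.three_le_nbr (M := {v}) (by simpa) (by simp) (by have := h.1; simp; omega)
  refine h1.trans (card_le_card fun x hx => ?_)
  obtain ⟨hxS, h2, m, hm, hmy⟩ := mem_nbr.1 hx
  rw [mem_singleton] at hm
  subst hm
  simp [hxS, hmy]

theorem TC.exists_nbr {S T : Finset V} (h : TC G S) {v : V} (hv : v ∈ S) (hT : #T ≤ 2) :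
    ∃ x ∈ S, x ∉ T ∧ G.Adj v x := by
  by_contra hcon
  push Not at hcon
  have : (S.filter fun x => G.Adj v x) ⊆ T := by
    intro x hx
    simp at hx
    by_contra hxT
    exact hcon x hx.1 hxT hx.2
  have h1 := card_le_card this
  have h2 := h.three_le_degree hv
  omega

theorem exists_bad_of_not_tc_con {S : Finset V} {c p : V} (h : TC G S) (h5 : 5 ≤ #S) (hc : c ∈ S)
    (hp : p ∈ S) (hcp : G.Adj c p) (hbad : ¬ TC (con G c p) (S.erase c)) :
    ∃ M ⊆ S, M.Nonempty ∧ c ∈ nbr G S M ∧ p ∈ nbr G S M ∧ #(nbr G S M) = 3 ∧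
      ∃ x ∈ S, x ∉ M ∧ x ∉ nbr G S M := by
  have hne : c ≠ p := hcp.ne
  unfold TC at hbad
  rw [card_erase_of_mem hc] at hbad
  push Not at hbad
  obtain ⟨M, hM, hMne, ⟨x, hx, hxM, hxN⟩, hlt⟩ := hbad (by omega)
  by_cases hpM : p ∈ M
  · exfalso
    refine h.false_of_sep (M := insert c M) (T := nbr (con G c p) (S.erase c) M) (by grind)
      (by simp) (by omega) ?_ (x := x) (by grind) (by grind) hxN
    intro m hm y hy hmy
    by_cases hyM : y ∈ insert c M
    · exact Or.inl hyM
    · refine Or.inr (mem_nbr.2 ⟨by grind, by grind, ?_⟩)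
      rcases mem_insert.1 hm with rfl | hm
      · exact ⟨p, hpM, by grind [con_adj]⟩
      · exact ⟨m, hm, by grind [con_adj, hmy.ne]⟩
  · have hsub : nbr G S M ⊆ insert c (nbr (con G c p) (S.erase c) M) := by
      intro y hy
      obtain ⟨h1, h2, m, hm, hmy⟩ := mem_nbr.1 hy
      by_cases hyc : y = c
      · simp [hyc]
      · refine mem_insert_of_mem (mem_nbr.2 ⟨by grind, h2, m, hm, by grind [con_adj, hmy.ne]⟩)
    have h3 := h.2 M (by grind) hMne ⟨x, by grind, hxM, by grind⟩
    have h4 := card_le_card hsub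
    have h5 := card_insert_le c (nbr (con G c p) (S.erase c) M)
    have heq : nbr G S M = insert c (nbr (con G c p) (S.erase c) M) :=
      eq_of_subset_of_card_le hsub (by omega)
    have hcN : c ∈ nbr G S M := by rw [heq]; simp
    refine ⟨M, by grind, hMne, hcN, ?_, by omega, x, by grind, hxM, by grind⟩
    rw [heq]
    obtain ⟨h1, h2, m, hm, hmy⟩ := mem_nbr.1 hcN
    refine mem_insert_of_mem (mem_nbr.2 ⟨by grind, hpM, m, hm, ?_⟩)
    refine ⟨by grind, Or.inr (Or.inr ⟨rfl, hmy.symm⟩)⟩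

/-- A separator of order three containing an edge, with `M` on one side. -/
def BadSide (G : SimpleGraph V) (S M : Finset V) : Prop :=
  M ⊆ S ∧ M.Nonempty ∧ #(nbr G S M) = 3 ∧ (∃ x ∈ S, x ∉ M ∧ x ∉ nbr G S M) ∧
    ∃ u ∈ nbr G S M, ∃ v ∈ nbr G S M, G.Adj u v

theorem BadSide.exists_smaller {S M E T : Finset V} (h : TC G S) (hM : BadSide G S M)
    {u v w s : V} (hN : nbr G S M = {u, v, w}) (huv : u ≠ v) (hws : G.Adj w s) (hs : s ∈ M)
    (hE : E ⊆ S) (hu : u ∉ E) (hv : v ∉ E) (hwT : w ∈ T) (hsT : s ∈ T) (hT : #T = 3)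
    (hsE : ∃ e ∈ E, G.Adj s e) (hET : Disjoint E T)
    (hcl : ∀ m ∈ E, ∀ y ∈ S, G.Adj m y → y ∈ E ∨ y ∈ T) : ∃ M', BadSide G S M' ∧ #M' < #M := by
  obtain ⟨hMS, hMne, hM3, -, -⟩ := hM
  have hclM : ∀ m ∈ M, ∀ y ∈ S, G.Adj m y → y ∈ M ∨ y ∈ ({u, v, w} : Finset V) := by
    intro m hm y hy hmy
    rw [← hN, mem_nbr]
    grind
  obtain ⟨e, heE, hse⟩ := hsE
  rw [Finset.disjoint_left] at hET
  have heM : e ∈ M := by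
    have := hclM s hs e (hE heE) hse
    grind
  have hsub : nbr G S (E ∩ M) ⊆ T := by
    intro y hy
    obtain ⟨hyS, h2, m, hm, hmy⟩ := mem_nbr.1 hy
    have h3 := hclM m (by grind) y hyS hmy
    have h4 := hcl m (by grind) y hyS hmy
    grind
  have hmemN : ∀ y ∈ ({u, v, w} : Finset V), y ∈ S ∧ y ∉ M := by
    intro y hy
    rw [← hN, mem_nbr] at hy
    exact ⟨hy.1, hy.2.1⟩
  have hout : ∃ x ∈ S, x ∉ E ∩ M ∧ x ∉ T := by
    by_contra hcon
    push Not at hcon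
    have h1 := hcon u (hmemN u (by simp)).1 (by grind)
    have h2 := hcon v (hmemN v (by simp)).1 (by grind)
    have h3 : ({u, v, w, s} : Finset V) ⊆ T := by grind
    have h4 : #({u, v, w, s} : Finset V) = 4 := by
      have hc : #({u, v, w} : Finset V) = 3 := by rw [← hN, hM3]
      have : s ∉ ({u, v, w} : Finset V) := fun hs' => (hmemN s hs').2 hs
      have h5 : ({u, v, w, s} : Finset V) = insert s {u, v, w} := by grind
      rw [h5, card_insert_of_notMem this, hc]
    have := card_le_card h3
    omega
  obtain ⟨x, hxS, hxE, hxT⟩ := hout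
  have hge := h.2 (E ∩ M) (by grind) ⟨e, by grind⟩ ⟨x, hxS, hxE, fun h => hxT (hsub h)⟩
  have heq : nbr G S (E ∩ M) = T := eq_of_subset_of_card_le hsub (by omega)
  refine ⟨E ∩ M, ⟨by grind, ⟨e, by grind⟩, heq ▸ hT, ⟨x, hxS, hxE, by grind⟩, w, by grind, s,
    by grind, hws⟩, ?_⟩
  refine card_lt_card (Finset.ssubset_iff_subset_ne.2 ⟨inter_subset_right, fun hh => ?_⟩)
  have : s ∈ E ∩ M := by rw [hh]; exact hs
  exact hET (by grind) hsT

theorem TC.exists_contractible {S : Finset V} (h : TC G S) (h5 : 5 ≤ #S) :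
    ∃ c ∈ S, ∃ p ∈ S, G.Adj c p ∧ TC (con G c p) (S.erase c) := by
  by_contra hcon
  push Not at hcon
  have hbad : ∀ c ∈ S, ∀ p ∈ S, G.Adj c p → ∃ M, BadSide G S M ∧ c ∈ nbr G S M ∧
      p ∈ nbr G S M := by
    intro c hc p hp hcp
    obtain ⟨M, h1, h2, h3, h4, h6, h7⟩ :=
      exists_bad_of_not_tc_con h h5 hc hp hcp (hcon c hc p hp hcp)
    exact ⟨M, ⟨h1, h2, h6, h7, c, h3, p, h4, hcp⟩, h3, h4⟩
  have hex : ∃ M, BadSide G S M := by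
    obtain ⟨v, hv⟩ : S.Nonempty := card_pos.1 (by omega)
    obtain ⟨x, hx, -, hvx⟩ := h.exists_nbr (T := ∅) hv (by simp)
    obtain ⟨M, hM, -⟩ := hbad v hv x hx hvx
    exact ⟨M, hM⟩
  obtain ⟨M, hM, hmin⟩ : ∃ M, BadSide G S M ∧ ∀ M', BadSide G S M' → #M ≤ #M' := by
    obtain ⟨M0, hM0⟩ := hex
    have hF : (S.powerset.filter fun M => BadSide G S M).Nonempty :=
      ⟨M0, by simp [hM0, hM0.1]⟩
    obtain ⟨M, hM, hmin⟩ := exists_min_image _ Finset.card hF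
    simp only [mem_filter, mem_powerset] at hM hmin
    exact ⟨M, hM.2, fun M' h' => hmin M' ⟨h'.1, h'⟩⟩
  have hM' := hM
  obtain ⟨hMS, hMne, hM3, -, u, hu, v, hv, huv⟩ := hM
  obtain ⟨w, hw⟩ : ∃ w, nbr G S M = {u, v, w} := by
    have h2 : #((nbr G S M).erase u |>.erase v) = 1 := by
      rw [card_erase_of_mem (by grind [huv.ne]), card_erase_of_mem hu, hM3]
    obtain ⟨w, hw⟩ := card_eq_one.1 h2
    refine ⟨w, ?_⟩
    ext y
    have : y ∈ ((nbr G S M).erase u |>.erase v) ↔ y ∈ ({w} : Finset V) := by rw [hw]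
    grind
  have hwN : w ∈ nbr G S M := by rw [hw]; simp
  obtain ⟨hwS, -, s, hs, hsw⟩ := mem_nbr.1 hwN
  obtain ⟨M2, hM2, hw2, hs2⟩ := hbad w hwS s (hMS hs) hsw.symm
  obtain ⟨h1, h2, h3, ⟨x, hx, hxM, hxN⟩, -⟩ := hM2
  have huvS : u ∈ S ∧ v ∈ S := ⟨(mem_nbr.1 hu).1, (mem_nbr.1 hv).1⟩
  have key : ∃ M', BadSide G S M' ∧ #M' < #M := by
    have hclM2 : ∀ m ∈ M2, ∀ y ∈ S, G.Adj m y → y ∈ M2 ∨ y ∈ nbr G S M2 := by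
      intro m hm y hy hmy
      rw [mem_nbr]
      grind
    by_cases hcase : u ∈ M2 ∨ v ∈ M2
    · have hclO : ∀ m ∈ S \ (M2 ∪ nbr G S M2), ∀ y ∈ S, G.Adj m y →
          y ∈ S \ (M2 ∪ nbr G S M2) ∨ y ∈ nbr G S M2 := by
        intro m hm y hy hmy
        by_cases hyM : y ∈ M2
        · have := hclM2 y hyM m (by grind) hmy.symm
          grind
        · grind
      refine hM'.exists_smaller h hw huv.ne hsw.symm hs (E := S \ (M2 ∪ nbr G S M2))
        (T := nbr G S M2) sdiff_subset ?_ ?_ hw2 hs2 h3 ?_ ?_ hclO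
      · rcases hcase with hh | hh
        · grind
        · have := hclM2 v hh u huvS.1 huv.symm
          grind
      · rcases hcase with hh | hh
        · have := hclM2 u hh v huvS.2 huv
          grind
        · grind
      · by_contra hno
        push Not at hno
        have : #((nbr G S M2).erase s) ≤ 2 := by rw [card_erase_of_mem hs2]; omega
        obtain ⟨m, hm⟩ := h2
        refine h.false_of_sep (M := S \ (M2 ∪ nbr G S M2)) (T := (nbr G S M2).erase s)
          sdiff_subset ⟨x, by grind⟩ this ?_ (x := m) (by grind) (by grind) ?_
        · intro a ha y hy hay
          rcases hclO a ha y hy hay with hh | hh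
          · exact Or.inl hh
          · refine Or.inr (mem_erase.2 ⟨?_, hh⟩)
            rintro rfl
            exact hno a ha hay.symm
        · intro hmN
          have := (mem_nbr.1 (mem_of_mem_erase hmN)).2.1
          exact this hm
      · rw [Finset.disjoint_left]
        grind
    · obtain ⟨-, -, e, he, hes⟩ := mem_nbr.1 hs2
      refine hM'.exists_smaller h hw huv.ne hsw.symm hs (E := M2)
        (T := nbr G S M2) h1 (by tauto) (by tauto) hw2 hs2 h3 ⟨e, he, hes.symm⟩ ?_ hclM2
      rw [Finset.disjoint_left]
      intro a ha ha'
      exact (mem_nbr.1 ha').2.1 ha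
  obtain ⟨M', hb, hlt⟩ := key
  have := hmin M' hb
  omega

end WidthThree

namespace WidthThree
open Finset
open scoped Classical
variable {V : Type*} {G : SimpleGraph V}

/-- A sweep: `X` is the current front and `W` is still ahead; in one step a front vertex with a
single neighbour ahead is replaced by that neighbour. -/
inductive Sw (G : SimpleGraph V) : Finset V → Finset V → Prop
  | nil (X : Finset V) : Sw G X ∅
  | step (X W : Finset V) (x w : V) (hx : x ∈ X) (hw : w ∈ W) (hxw : G.Adj x w)
      (huniq : ∀ y ∈ W, G.Adj x y → y = w) (h : Sw G (insert w (X.erase x)) (W.erase w)) :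
      Sw G X W

/-- The subgraph induced by `S` can be swept by a front of three vertices. -/
def Sweepable (G : SimpleGraph V) (S : Finset V) : Prop := ∃ X ⊆ S, #X = 3 ∧ Sw G X (S \ X)

/-- A path from `y` through all of `U` to `z` along which every vertex has exactly one
neighbour ahead. -/
inductive Fan (G : SimpleGraph V) (z : V) : V → Finset V → Prop
  | nil (y : V) (h : G.Adj y z) : Fan G z y ∅
  | cons (y u : V) (U : Finset V) (hu : u ∈ U) (hyu : G.Adj y u) (huniq : ∀ x ∈ U, G.Adj y x → x = u)
      (hyz : ¬ G.Adj y z) (h : Fan G z u (U.erase u)) : Fan G z y U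

theorem Fan.sw {y z : V} {U Q R : Finset V} (h : Fan G z y U) (hyQ : y ∉ Q) (hUQ : Disjoint U Q)
    (hzU : z ∉ U) (hzR : z ∉ R) (hUR : Disjoint U R)
    (hno : ∀ x ∈ insert y U, ∀ r ∈ R, ¬ G.Adj x r) (hs : Sw G (insert z Q) R) :
    Sw G (insert y Q) (U ∪ insert z R) := by
  induction h with
  | nil y hyz =>
    refine Sw.step _ _ y z (by simp) (by simp) hyz (by grind) ?_
    rw [erase_insert hyQ, empty_union, erase_insert hzR]
    exact hs
  | cons y u U hu hyu huniq hyz h ih =>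
    rw [Finset.disjoint_left] at hUQ hUR
    refine Sw.step _ _ y u (by simp) (by grind) hyu (by grind) ?_
    have h1 : (U ∪ insert z R).erase u = U.erase u ∪ insert z R := by grind
    rw [erase_insert hyQ, h1]
    refine ih (by grind) ?_ (by grind) ?_ (by grind)
    · rw [Finset.disjoint_left]; grind
    · rw [Finset.disjoint_left]; grind

/-- Rooted minor obstructing a fan: a connected set inside `U` touching connected sets grown from
the three roots, the first two of which touch each other. -/
def Obs (G : SimpleGraph V) (U : Finset V) (y z z' : V) : Prop :=
  ∃ a Y Z Z' : Finset V, Conn G a ∧ Conn G Y ∧ Conn G Z ∧ Conn G Z' ∧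
    a ⊆ U ∧ Y ⊆ insert y U ∧ Z ⊆ insert z U ∧ Z' ⊆ insert z' U ∧ y ∈ Y ∧ z ∈ Z ∧ z' ∈ Z' ∧
    Disjoint a Y ∧ Disjoint a Z ∧ Disjoint a Z' ∧ Disjoint Y Z ∧ Disjoint Y Z' ∧ Disjoint Z Z' ∧
    Touch G a Y ∧ Touch G a Z ∧ Touch G a Z' ∧ Touch G Y Z

theorem mem_of_nbr_subset {S M : Finset V} {y z z' : V} (h3 : 3 ≤ #(nbr G S M))
    (hsub : nbr G S M ⊆ {y, z, z'}) :
    (∃ m ∈ M, G.Adj m y) ∧ (∃ m ∈ M, G.Adj m z) ∧ ∃ m ∈ M, G.Adj m z' := by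
  have heq : nbr G S M = {y, z, z'} := eq_of_subset_of_card_le hsub (by
    have := card_le_three (a := y) (b := z) (c := z')
    omega)
  have hy : y ∈ nbr G S M := by rw [heq]; simp
  have hz : z ∈ nbr G S M := by rw [heq]; simp
  have hz' : z' ∈ nbr G S M := by rw [heq]; simp
  exact ⟨(mem_nbr.1 hy).2.2, (mem_nbr.1 hz).2.2, (mem_nbr.1 hz').2.2⟩

/-- The four vertices or roots that a fan argument works with. -/
structure FanData (G : SimpleGraph V) (U : Finset V) (y z z' : V) : Prop where
  hy : y ∉ U
  hz : z ∉ U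
  hz' : z' ∉ U
  hyz : y ≠ z
  hyz' : y ≠ z'
  hzz' : z ≠ z'
  hN : ∀ M ⊆ U, M.Nonempty → 3 ≤ #(nbr G (U ∪ {y, z, z'}) M)
  hobs : ¬ Obs G U y z z'

theorem FanData.conn {U : Finset V} {y z z' : V} (h : FanData G U y z z') (hU : U.Nonempty) :
    Conn G U := by
  obtain ⟨t, ht⟩ := hU
  obtain ⟨C, hCU, htC, hC, hCcl⟩ := exists_component (G := G) ht
  by_cases hCeq : C = U
  · exact hCeq ▸ hC
  exfalso
  obtain ⟨t2, ht2, ht2C⟩ : ∃ t2 ∈ U, t2 ∉ C := by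
    by_contra hcon
    exact hCeq (by grind)
  obtain ⟨D, hDU, htD, hD, hDcl⟩ := exists_component (G := G) (Y := U \ C) (t := t2) (by grind)
  have hCn := mem_of_nbr_subset (y := y) (z := z) (z' := z') (h.hN C hCU ⟨t, htC⟩) (by
    intro x hx
    obtain ⟨h1, h2, m, hm, hmx⟩ := mem_nbr.1 hx
    have := hCcl m hm x
    grind)
  have hDn := mem_of_nbr_subset (y := y) (z := z) (z' := z') (h.hN D (by grind) ⟨t2, htD⟩) (by
    intro x hx
    obtain ⟨h1, h2, m, hm, hmx⟩ := mem_nbr.1 hx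
    have h3 := hDcl m hm x
    have h4 := hCcl x
    have h5 := hmx.symm
    grind)
  obtain ⟨⟨c1, hc1, hc1y⟩, ⟨c2, hc2, hc2z⟩, ⟨c3, hc3, hc3z⟩⟩ := hCn
  obtain ⟨⟨d1, hd1, hd1y⟩, ⟨d2, hd2, hd2z⟩, -⟩ := hDn
  have := h.hy; have := h.hz; have := h.hz'; have := h.hyz; have := h.hyz'; have := h.hzz'
  refine h.hobs ⟨C, insert y D, {z}, {z'}, hC, hD.insert hd1 hd1y.symm, conn_singleton _,
    conn_singleton _, hCU, by grind, by grind, by grind, by grind, by grind, by grind, ?_, ?_, ?_,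
    ?_, ?_, ?_, ⟨c1, hc1, y, by simp, hc1y⟩, ⟨c2, hc2, z, by simp, hc2z⟩,
    ⟨c3, hc3, z', by simp, hc3z⟩, ⟨d2, by grind, z, by simp, hd2z⟩⟩
  all_goals rw [Finset.disjoint_left]; grind

theorem FanData.touch {U : Finset V} {y z z' : V} (h : FanData G U y z z') (hU : U.Nonempty) :
    (∃ m ∈ U, G.Adj m y) ∧ (∃ m ∈ U, G.Adj m z) ∧ ∃ m ∈ U, G.Adj m z' :=
  mem_of_nbr_subset (h.hN U Subset.rfl hU) (by
    intro x hx
    obtain ⟨h1, h2, -⟩ := mem_nbr.1 hx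
    grind)

theorem FanData.not_adj {U : Finset V} {y z z' : V} (h : FanData G U y z z') (hU : U.Nonempty) :
    ¬ G.Adj y z := by
  intro hyz
  obtain ⟨⟨c1, hc1, hc1y⟩, ⟨c2, hc2, hc2z⟩, ⟨c3, hc3, hc3z⟩⟩ := h.touch hU
  have := h.hy; have := h.hz; have := h.hz'; have := h.hyz; have := h.hyz'; have := h.hzz'
  refine h.hobs ⟨U, {y}, {z}, {z'}, h.conn hU, conn_singleton _, conn_singleton _,
    conn_singleton _, Subset.rfl, by grind, by grind, by grind, by grind, by grind, by grind,
    ?_, ?_, ?_, ?_, ?_, ?_, ⟨c1, hc1, y, by simp, hc1y⟩, ⟨c2, hc2, z, by simp, hc2z⟩,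
    ⟨c3, hc3, z', by simp, hc3z⟩, ⟨y, by simp, z, by simp, hyz⟩⟩
  all_goals rw [Finset.disjoint_left]; grind

theorem FanData.obs_of_split {U T S1 S2 : Finset V} {y z z' s1 s2 : V} (h : FanData G U y z z')
    (hT : T ⊆ U) (hS1 : S1 ⊆ U) (hS2 : S2 ⊆ U) (hTS1 : Disjoint T S1) (hTS2 : Disjoint T S2)
    (hS12 : Disjoint S1 S2) (hyT : Conn G (insert y T)) (hc1 : Conn G S1) (hc2 : Conn G S2)
    (h12 : Touch G S1 S2) (hs1 : s1 ∈ S1) (hs2 : s2 ∈ S2) (ha1 : ∃ t ∈ insert y T, G.Adj t s1)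
    (ha2 : ∃ t ∈ insert y T, G.Adj t s2) (hz : ∃ m ∈ S1, G.Adj m z) (hz' : ∃ m ∈ S2, G.Adj m z') :
    False := by
  obtain ⟨m, hm, hmz⟩ := hz
  obtain ⟨m', hm', hmz'⟩ := hz'
  obtain ⟨t1, ht1, hts1⟩ := ha1
  obtain ⟨t2, ht2, hts2⟩ := ha2
  have := h.hy; have := h.hz; have := h.hz'; have := h.hyz; have := h.hyz'; have := h.hzz'
  rw [Finset.disjoint_left] at hTS1 hTS2 hS12
  refine h.hobs ⟨S2, insert y T, insert z S1, {z'}, hc2, hyT, hc1.insert hm hmz.symm,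
    conn_singleton _, hS2, by grind, by grind, by grind, by grind, by grind, by grind,
    ?_, ?_, ?_, ?_, ?_, ?_, ⟨s2, hs2, t2, ht2, hts2.symm⟩, h12.symm.mono Subset.rfl (by grind),
    ⟨m', hm', z', by simp, hmz'⟩, ⟨t1, ht1, s1, by grind, hts1⟩⟩
  all_goals rw [Finset.disjoint_left]; grind

theorem FanData.no_two {U : Finset V} {y z z' : V} (h : FanData G U y z z') (n : ℕ) :
    ∀ T S : Finset V, #S = n → T ∪ S = U → Disjoint T S → Conn G (insert y T) → Conn G S →
      (∀ t ∈ T, ¬ G.Adj t z ∧ ¬ G.Adj t z') → ∀ s1 ∈ S, ∀ s2 ∈ S, s1 ≠ s2 →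
      (∃ t ∈ insert y T, G.Adj t s1) → (∃ t ∈ insert y T, G.Adj t s2) → False := by
  induction n using Nat.strong_induction_on with
  | _ n ih =>
    intro T S hn hTS hdis hyT hS hTz s1 hs1 s2 hs2 hne ha1 ha2
    obtain ⟨S1, S2, hSS, hd, hc1, hc2, h1, h2⟩ := hS.exists_split hs1 hs2 hne
    have hU : U.Nonempty := ⟨s1, by clear ih; grind⟩
    obtain ⟨-, ⟨m, hm, hmz⟩, ⟨m', hm', hmz'⟩⟩ := h.touch hU
    have hd' := Finset.disjoint_left.1 hd
    have hdis' := Finset.disjoint_left.1 hdis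
    have hd1 : Disjoint T S1 := by rw [Finset.disjoint_left]; clear ih; grind
    have hd2 : Disjoint T S2 := by rw [Finset.disjoint_left]; clear ih; grind
    have h12 : Touch G S1 S2 := by
      have := hS.2 S1 (by clear ih; grind) ⟨s1, h1⟩ (by clear ih; grind)
      exact this.mono Subset.rfl (by clear ih; grind)
    have hmS : m ∈ S1 ∨ m ∈ S2 := by clear ih; grind
    have hmS' : m' ∈ S1 ∨ m' ∈ S2 := by clear ih; grind
    -- absorbing a part that touches no remaining root
    have absorb : ∀ A B : Finset V, ∀ b ∈ B, A ∪ B = S → Disjoint A B → Conn G A → Conn G B →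
        (∃ t ∈ insert y T, G.Adj t b) → (∀ t ∈ B, ¬ G.Adj t z ∧ ¬ G.Adj t z') → False := by
      intro A B b hb hAB hdAB hA hB hab hBz
      have hdAB' := Finset.disjoint_left.1 hdAB
      have h3 := h.hN (T ∪ B) (by clear ih; grind) ⟨b, by clear ih; grind⟩
      have hsub : nbr G (U ∪ {y, z, z'}) (T ∪ B) ⊆
          insert y (A.filter fun x => ∃ t ∈ insert y (T ∪ B), G.Adj t x) := by
        clear ih
        intro x hx
        obtain ⟨g1, g2, t, ht, htx⟩ := mem_nbr.1 hx
        have := hTz t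
        have := hBz t
        by_cases hxy : x = y
        · simp [hxy]
        · refine mem_insert_of_mem (mem_filter.2 ⟨by grind, t, by grind, htx⟩)
      have h4 := card_le_card hsub
      have h5 := card_insert_le y (A.filter fun x => ∃ t ∈ insert y (T ∪ B), G.Adj t x)
      obtain ⟨p, hp, q, hq, hpq⟩ := one_lt_card.1
        (show 1 < #(A.filter fun x => ∃ t ∈ insert y (T ∪ B), G.Adj t x) by omega)
      rw [mem_filter] at hp hq
      refine ih #A ?_ (T ∪ B) A rfl (by clear ih; grind) ?_ ?_ hA (by clear ih; grind) p hp.1 q hq.1 hpq hp.2 hq.2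
      · rw [← hn]
        exact card_lt_card (Finset.ssubset_iff_subset_ne.2 ⟨by clear ih; grind, by clear ih; grind⟩)
      · rw [Finset.disjoint_left]; clear ih; grind
      · rw [← insert_union]
        obtain ⟨t, ht, htb⟩ := hab
        exact hyT.union hB ⟨t, ht, b, hb, htb⟩
    by_cases e1 : ∃ m ∈ S1, G.Adj m z
    · by_cases e2 : ∃ m ∈ S2, G.Adj m z'
      · exact h.obs_of_split (by clear ih; grind) (by clear ih; grind) (by clear ih; grind) hd1 hd2 hd hyT hc1 hc2 h12 h1 h2
          ha1 ha2 e1 e2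
      · by_cases e3 : ∃ m ∈ S2, G.Adj m z
        · exact h.obs_of_split (by clear ih; grind) (by clear ih; grind) (by clear ih; grind) hd2 hd1 hd.symm hyT hc2 hc1
            h12.symm h2 h1 ha2 ha1 e3 ⟨m', by clear ih; grind, hmz'⟩
        · push Not at e2 e3
          exact absorb S1 S2 s2 h2 hSS hd hc1 hc2 ha2 fun t ht => ⟨e3 t ht, e2 t ht⟩
    · have hm2 : ∃ m ∈ S2, G.Adj m z := ⟨m, by clear ih; grind, hmz⟩
      by_cases e2 : ∃ m ∈ S1, G.Adj m z'
      · exact h.obs_of_split (by clear ih; grind) (by clear ih; grind) (by clear ih; grind) hd2 hd1 hd.symm hyT hc2 hc1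
            h12.symm h2 h1 ha2 ha1 hm2 e2
      · push Not at e1 e2
        exact absorb S2 S1 s1 h1 (by clear ih; grind) hd.symm hc2 hc1 ha1 fun t ht => ⟨e1 t ht, e2 t ht⟩

theorem FanData.fan {z z' : V} (n : ℕ) : ∀ (U : Finset V) (y : V), #U = n →
    FanData G U y z z' → (U = ∅ → G.Adj y z) → Fan G z y U := by
  induction n with
  | zero =>
    intro U y hn h hyz
    obtain rfl := card_eq_zero.1 hn
    exact Fan.nil y (hyz rfl)
  | succ n ih =>
    intro U y hn h _
    have hU : U.Nonempty := card_pos.1 (by omega)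
    obtain ⟨⟨u, hu, huy⟩, -, -⟩ := h.touch hU
    have huniq : ∀ x ∈ U, G.Adj y x → x = u := by
      intro x hx hyx
      by_contra hne
      refine h.no_two #U ∅ U rfl (by simp) (by simp) (conn_singleton y) (h.conn hU) (by simp)
        x hx u hu hne ⟨y, by simp, hyx⟩ ⟨y, by simp, huy.symm⟩
    have := h.hy; have := h.hz; have := h.hz'; have := h.hyz; have := h.hyz'; have := h.hzz'
    refine Fan.cons y u U hu huy.symm huniq (h.not_adj hU) (ih (U.erase u) u ?_ ?_ ?_)
    · rw [card_erase_of_mem hu]; omega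
    · refine ⟨by grind, by grind, by grind, by grind, by grind, by grind, ?_, ?_⟩
      · intro M hM hMne
        refine (h.hN M (by grind) hMne).trans (card_le_card fun x hx => ?_)
        obtain ⟨g1, g2, t, ht, htx⟩ := mem_nbr.1 hx
        refine mem_nbr.2 ⟨?_, g2, t, ht, htx⟩
        have h1 := huniq t (by grind)
        have h2 := htx.symm
        grind
      · rintro ⟨a, Y, Z, Z', h1, h2, h3, h4, h5, h6, h7, h8, h9, h10, h11, d1, d2, d3, d4, d5, d6,
          t1, t2, t3, t4⟩
        rw [Finset.disjoint_left] at d1 d2 d3 d4 d5 d6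
        refine h.hobs ⟨a, insert y Y, Z, Z', h1, h2.insert h9 huy.symm, h3, h4, by grind, by grind,
          by grind, by grind, by grind, by grind, by grind, ?_, ?_, ?_, ?_, ?_, ?_,
          t1.mono Subset.rfl (by grind), t2, t3, t4.mono (by grind) Subset.rfl⟩
        all_goals rw [Finset.disjoint_left]; grind
    · intro he
      obtain ⟨-, ⟨m, hm, hmz⟩, -⟩ := h.touch hU
      have : m = u := by
        by_contra hne
        have : m ∈ U.erase u := mem_erase.2 ⟨hne, hm⟩
        simp [he] at this
      exact this ▸ hmz

end WidthThree

namespace WidthThree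
open Finset
open scoped Classical
variable {V : Type*} {G : SimpleGraph V}

/-- Edges of `K₃,₃`, with sides `0,1,2` and `3,4,5`. -/
def eK33 : List (Fin 6 × Fin 6) :=
  [(0,3), (0,4), (0,5), (1,3), (1,4), (1,5), (2,3), (2,4), (2,5)]

/-- Edges of `K₅`. -/
def eK5 : List (Fin 5 × Fin 5) :=
  [(0,1), (0,2), (0,3), (0,4), (1,2), (1,3), (1,4), (2,3), (2,4), (3,4)]

/-- Edges of the cube, with sides `0,1,2,3` and `4,5,6,7`, where `i` misses its antipode `4 + i`. -/
def eC : List (Fin 8 × Fin 8) :=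
  [(0,5), (0,6), (0,7), (1,4), (1,6), (1,7), (2,4), (2,5), (2,7), (3,4), (3,5), (3,6)]

/-- Edges of `H`: a triangle `0,1,2`, vertices `3,4,5` over its edges, and a centre `6`. -/
def eH : List (Fin 7 × Fin 7) :=
  [(0,1), (0,2), (1,2), (0,3), (0,4), (1,3), (1,5), (2,4), (2,5), (3,6), (4,6), (5,6)]

/-- Edges of the octahedron: a cycle `0,1,2,3` and poles `4,5`. -/
def eO : List (Fin 6 × Fin 6) :=
  [(0,1), (1,2), (2,3), (0,3), (0,4), (1,4), (2,4), (3,4), (0,5), (1,5), (2,5), (3,5)]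

/-- One of the five excluded minors occurs. -/
def Minors (G : SimpleGraph V) (S : Finset V) : Prop :=
  IsMinor G S eK33 ∨ IsMinor G S eK5 ∨ IsMinor G S eC ∨ IsMinor G S eH ∨ IsMinor G S eO

theorem Minors.of_con {c p : V} {S : Finset V} (hc : c ∈ S)
    (hcp : G.Adj c p) (h : Minors (con G c p) (S.erase c)) : Minors G S := by
  rcases h with h | h | h | h | h
  · exact Or.inl (h.of_con hc hcp)
  · exact Or.inr (Or.inl (h.of_con hc hcp))
  · exact Or.inr (Or.inr (Or.inl (h.of_con hc hcp)))
  · exact Or.inr (Or.inr (Or.inr (Or.inl (h.of_con hc hcp))))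
  · exact Or.inr (Or.inr (Or.inr (Or.inr (h.of_con hc hcp))))

theorem isMinor_of_list {n : ℕ} {S : Finset V} {E : List (Fin n × Fin n)} (L : List (Finset V))
    (hn : L.length = n) (hL : ∀ A ∈ L, Conn G A ∧ A ⊆ S) (hd : L.Pairwise Disjoint)
    (hE : ∀ e ∈ E, Touch G (L.get (e.1.cast hn.symm)) (L.get (e.2.cast hn.symm))) :
    IsMinor G S E := by
  subst hn
  refine ⟨L.get, fun i => (hL _ (L.get_mem i)).1, fun i => (hL _ (L.get_mem i)).2,
    fun i j hij => List.pairwise_iff_get.1 hd i j hij, hE⟩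

theorem minors_K33 {S A0 A1 A2 B0 B1 B2 : Finset V}
    (hL : ∀ A ∈ [A0, A1, A2, B0, B1, B2], Conn G A ∧ A ⊆ S)
    (hd : [A0, A1, A2, B0, B1, B2].Pairwise Disjoint)
    (h00 : Touch G A0 B0) (h01 : Touch G A0 B1) (h02 : Touch G A0 B2)
    (h10 : Touch G A1 B0) (h11 : Touch G A1 B1) (h12 : Touch G A1 B2)
    (h20 : Touch G A2 B0) (h21 : Touch G A2 B1) (h22 : Touch G A2 B2) : Minors G S := by
  refine Or.inl (isMinor_of_list _ rfl hL hd ?_)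
  simp only [eK33, List.forall_mem_cons]
  exact ⟨h00, h01, h02, h10, h11, h12, h20, h21, h22, fun _ h => by simp at h⟩

theorem minors_K5 {S A0 A1 A2 A3 A4 : Finset V}
    (hL : ∀ A ∈ [A0, A1, A2, A3, A4], Conn G A ∧ A ⊆ S)
    (hd : [A0, A1, A2, A3, A4].Pairwise Disjoint)
    (h01 : Touch G A0 A1) (h02 : Touch G A0 A2) (h03 : Touch G A0 A3) (h04 : Touch G A0 A4)
    (h12 : Touch G A1 A2) (h13 : Touch G A1 A3) (h14 : Touch G A1 A4)
    (h23 : Touch G A2 A3) (h24 : Touch G A2 A4) (h34 : Touch G A3 A4) : Minors G S := by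
  refine Or.inr (Or.inl (isMinor_of_list _ rfl hL hd ?_))
  simp only [eK5, List.forall_mem_cons]
  exact ⟨h01, h02, h03, h04, h12, h13, h14, h23, h24, h34, fun _ h => by simp at h⟩

theorem minors_C {S A0 A1 A2 A3 B0 B1 B2 B3 : Finset V}
    (hL : ∀ A ∈ [A0, A1, A2, A3, B0, B1, B2, B3], Conn G A ∧ A ⊆ S)
    (hd : [A0, A1, A2, A3, B0, B1, B2, B3].Pairwise Disjoint)
    (h01 : Touch G A0 B1) (h02 : Touch G A0 B2) (h03 : Touch G A0 B3)
    (h10 : Touch G A1 B0) (h12 : Touch G A1 B2) (h13 : Touch G A1 B3)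
    (h20 : Touch G A2 B0) (h21 : Touch G A2 B1) (h23 : Touch G A2 B3)
    (h30 : Touch G A3 B0) (h31 : Touch G A3 B1) (h32 : Touch G A3 B2) : Minors G S := by
  refine Or.inr (Or.inr (Or.inl (isMinor_of_list _ rfl hL hd ?_)))
  simp only [eC, List.forall_mem_cons]
  exact ⟨h01, h02, h03, h10, h12, h13, h20, h21, h23, h30, h31, h32, fun _ h => by simp at h⟩

theorem minors_H {S T0 T1 T2 P01 P02 P12 Q : Finset V}
    (hL : ∀ A ∈ [T0, T1, T2, P01, P02, P12, Q], Conn G A ∧ A ⊆ S)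
    (hd : [T0, T1, T2, P01, P02, P12, Q].Pairwise Disjoint)
    (h01 : Touch G T0 T1) (h02 : Touch G T0 T2) (h12 : Touch G T1 T2)
    (a0 : Touch G T0 P01) (a1 : Touch G T1 P01) (b0 : Touch G T0 P02) (b2 : Touch G T2 P02)
    (c1 : Touch G T1 P12) (c2 : Touch G T2 P12)
    (q1 : Touch G P01 Q) (q2 : Touch G P02 Q) (q3 : Touch G P12 Q) : Minors G S := by
  refine Or.inr (Or.inr (Or.inr (Or.inl (isMinor_of_list _ rfl hL hd ?_))))
  simp only [eH, List.forall_mem_cons]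
  exact ⟨h01, h02, h12, a0, b0, a1, c1, b2, c2, q1, q2, q3, fun _ h => by simp at h⟩

theorem minors_O {S A0 A1 A2 A3 P Q : Finset V}
    (hL : ∀ A ∈ [A0, A1, A2, A3, P, Q], Conn G A ∧ A ⊆ S)
    (hd : [A0, A1, A2, A3, P, Q].Pairwise Disjoint)
    (h01 : Touch G A0 A1) (h12 : Touch G A1 A2) (h23 : Touch G A2 A3) (h03 : Touch G A0 A3)
    (p0 : Touch G A0 P) (p1 : Touch G A1 P) (p2 : Touch G A2 P) (p3 : Touch G A3 P)
    (q0 : Touch G A0 Q) (q1 : Touch G A1 Q) (q2 : Touch G A2 Q) (q3 : Touch G A3 Q) :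
    Minors G S := by
  refine Or.inr (Or.inr (Or.inr (Or.inr (isMinor_of_list _ rfl hL hd ?_))))
  simp only [eO, List.forall_mem_cons]
  exact ⟨h01, h12, h23, h03, p0, p1, p2, p3, q0, q1, q2, q3, fun _ h => by simp at h⟩

/-- `G'` arises from `G` by deleting the degree-3 vertex `c` and making its neighbourhood `N` a
triangle. -/
structure TriData (G G' : SimpleGraph V) (S N : Finset V) (c : V) : Prop where
  tc : TC G S
  hc : c ∈ S
  hN : N ⊆ S.erase c
  hN3 : #N = 3
  hcN : ∀ x ∈ S, G.Adj c x ↔ x ∈ N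
  hG' : ∀ x ∈ S.erase c, ∀ y ∈ S.erase c, G'.Adj x y ↔ x ≠ y ∧ (G.Adj x y ∨ (x ∈ N ∧ y ∈ N))

theorem TriData.transfer {G' : SimpleGraph V} {S N : Finset V} {c : V} (h : TriData G G' S N c)
    {X W : Finset V} (hs : Sw G' X W) (hX : X ⊆ S.erase c) (hW : W ⊆ S.erase c)
    (hNW : ∀ x ∈ N, x ∉ W) : Sw G X W := by
  induction hs with
  | nil X => exact Sw.nil X
  | step X W x w hx hw hxw huniq _ ih =>
    have h1 := (h.hG' x (hX hx) w (hW hw)).1 hxw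
    refine Sw.step X W x w hx hw (by grind) ?_ (ih (by grind) (by grind) (by grind))
    intro y hy hxy
    exact huniq y hy ((h.hG' x (hX hx) y (hW hy)).2 ⟨hxy.ne, Or.inl hxy⟩)

end WidthThree

namespace WidthThree
open Finset
open scoped Classical
variable {V : Type*} {G : SimpleGraph V}

theorem TC.touch_three {S M : Finset V} (h : TC G S) {x1 x2 x3 o : V} (hM : M ⊆ S)
    (hne : M.Nonempty) (ho : o ∈ S) (hoM : o ∉ M) (ho1 : o ∉ ({x1, x2, x3} : Finset V))
    (hN : ∀ m ∈ M, ∀ y ∈ S, G.Adj m y → y ∈ M ∨ y ∈ ({x1, x2, x3} : Finset V)) :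
    (∃ m ∈ M, G.Adj m x1) ∧ (∃ m ∈ M, G.Adj m x2) ∧ ∃ m ∈ M, G.Adj m x3 := by
  have hsub : nbr G S M ⊆ {x1, x2, x3} := fun y hy => by
    obtain ⟨h1, h2, m, hm, hmy⟩ := mem_nbr.1 hy
    exact (hN m hm y h1 hmy).resolve_left h2
  exact mem_of_nbr_subset (h.2 M hM hne ⟨o, ho, hoM, fun hh => ho1 (hsub hh)⟩) hsub

/-- The state of a sweep of `G'` that has not yet passed the triangle `N`. -/
structure TriState (G : SimpleGraph V) (S N : Finset V) (c : V) (X W : Finset V) : Prop where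
  hX : X ⊆ S.erase c
  hW : W ⊆ S.erase c
  hdis : ∀ x ∈ X, x ∉ W
  h3 : #X = 3
  hNXW : ∀ x ∈ N, x ∈ X ∨ x ∈ W
  hUW : ∀ u ∈ S.erase c, u ∉ X → u ∉ W → ∀ w ∈ W, ¬ G.Adj u w

theorem TriData.minors_of_both_sides {G' : SimpleGraph V} {S N X W : Finset V} {c u w : V}
    (h : TriData G G' S N c) (hs : TriState G S N c X W) (hNW : ∀ x ∈ N, x ∉ W)
    (hu : u ∈ S.erase c) (huX : u ∉ X) (huW : u ∉ W) (hw : w ∈ W) : Minors G S := by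
  obtain ⟨hX, hW, hdis, h3, hNXW, hUW⟩ := hs
  have hNX : N = X := eq_of_subset_of_card_le (by grind) (by rw [h3, h.hN3])
  obtain ⟨x1, x2, x3, h12, h13, h23, rfl⟩ := card_eq_three.1 h3
  have hc := h.hc
  have hcN := h.hcN
  obtain ⟨C, hCsub, huC, hC, hCcl⟩ :=
    exists_component (G := G) (Y := (S.erase c) \ ({x1, x2, x3} ∪ W)) (t := u) (by grind)
  obtain ⟨D, hDsub, hwD, hD, hDcl⟩ := exists_component (G := G) hw
  have hC3 := h.tc.touch_three (M := C) (x1 := x1) (x2 := x2) (x3 := x3) (o := c) (by grind)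
    ⟨u, huC⟩ hc (by grind) (by grind) (by
      intro m hm y hy hmy
      by_cases hyc : y = c
      · subst hyc
        have := (hcN m (by grind)).1 hmy.symm
        grind
      · have h1 := hCcl m hm y
        have h2 := hUW m (by grind) (by grind) (by grind) y
        grind)
  have hD3 := h.tc.touch_three (M := D) (x1 := x1) (x2 := x2) (x3 := x3) (o := c) (by grind)
    ⟨w, hwD⟩ hc (by grind) (by grind) (by
      intro m hm y hy hmy
      by_cases hyc : y = c
      · subst hyc
        have := (hcN m (by grind)).1 hmy.symm
        grind
      · have h1 := hDcl m hm y
        have h2 := hUW y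
        have h3 := hmy.symm
        grind)
  have hcx : ∀ x ∈ ({x1, x2, x3} : Finset V), Touch G {x} {c} := by
    intro x hx
    exact ⟨x, by simp, c, by simp, ((hcN x (by grind)).2 (by grind)).symm⟩
  obtain ⟨⟨a1, ha1, e1⟩, ⟨a2, ha2, e2⟩, ⟨a3, ha3, e3⟩⟩ := hC3
  obtain ⟨⟨b1, hb1, f1⟩, ⟨b2, hb2, f2⟩, ⟨b3, hb3, f3⟩⟩ := hD3
  refine minors_K33 (A0 := {x1}) (A1 := {x2}) (A2 := {x3}) (B0 := C) (B1 := D) (B2 := {c}) ?_ ?_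
    ⟨x1, by simp, a1, ha1, e1.symm⟩ ⟨x1, by simp, b1, hb1, f1.symm⟩ (hcx _ (by simp))
    ⟨x2, by simp, a2, ha2, e2.symm⟩ ⟨x2, by simp, b2, hb2, f2.symm⟩ (hcx _ (by simp))
    ⟨x3, by simp, a3, ha3, e3.symm⟩ ⟨x3, by simp, b3, hb3, f3.symm⟩ (hcx _ (by simp))
  · simp only [List.forall_mem_cons, conn_singleton, hC, hD, true_and]
    refine ⟨by grind, by grind, by grind, by grind, by grind, by grind, by simp⟩
  · have hCd : ∀ x ∈ C, x ∉ D ∧ x ∉ ({x1, x2, x3} : Finset V) ∧ x ≠ c := by grind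
    have hDd : ∀ x ∈ D, x ∉ ({x1, x2, x3} : Finset V) ∧ x ≠ c := by grind
    clear hCsub hDsub hCcl hDcl hUW hNXW hNW hNX hdis hcN hcx
    simp only [List.pairwise_cons, List.forall_mem_cons, Finset.disjoint_left, List.Pairwise.nil,
      List.not_mem_nil, IsEmpty.forall_iff, implies_true, and_true]
    and_intros <;> grind

/-- The sweep of `G'` has just moved the front vertex `y` to `w`, both in the triangle
`N = {y, w, z'}`, the front being `{y, z', z}` before. -/
structure TriCross (G : SimpleGraph V) (S : Finset V) (c y w z z' : V) (W : Finset V) : Prop where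
  hst : TriState G S {y, w, z'} c {y, z', z} (insert w W)
  hwW : w ∉ W
  hNW : z' ∉ W
  hyW : ∀ x ∈ W, ¬ G.Adj y x
  hyz : y ≠ z
  hyz' : y ≠ z'
  hzz' : z ≠ z'
  hyw : G.Adj y w

theorem TriCross.fanData_back {G' : SimpleGraph V} {S W : Finset V} {c y w z z' : V}
    (h : TriData G G' S {y, w, z'} c) (hs : TriCross G S c y w z z' W)
    (hobs : ¬ Obs G ((S.erase c) \ ({y, z', z} ∪ insert w W)) y z z') :
    FanData G ((S.erase c) \ ({y, z', z} ∪ insert w W)) y z z' := by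
  obtain ⟨⟨hX, hW, hdis, h3, hNXW, hUW⟩, hwW, hNW, hyW, hyz, hyz', hzz', hyw⟩ := hs
  have hc := h.hc
  have hcN := h.hcN
  refine ⟨by grind, by grind, by grind, hyz, hyz', hzz', ?_, hobs⟩
  intro M hM hMne
  have hsub : nbr G S M ⊆ nbr G ((S.erase c) \ ({y, z', z} ∪ insert w W) ∪ {y, z, z'}) M := by
    intro x hx
    obtain ⟨h1, h2, m, hm, hmx⟩ := mem_nbr.1 hx
    refine mem_nbr.2 ⟨?_, h2, m, hm, hmx⟩
    have hmU := hM hm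
    have hxc : x ≠ c := by
      rintro rfl
      have := (hcN m (by grind)).1 hmx.symm
      grind
    have := hUW m (by grind) (by grind) (by grind) x
    grind
  refine (h.tc.2 M (by grind) hMne ⟨c, hc, by grind, fun hcM => ?_⟩).trans (card_le_card hsub)
  have := (mem_nbr.1 (hsub hcM)).1
  grind

theorem TriCross.fanData_front {G' : SimpleGraph V} {S W : Finset V} {c y w z z' : V}
    (h : TriData G G' S {y, w, z'} c) (hs : TriCross G S c y w z z' W)
    (hobs : ¬ Obs G W z w z') : FanData G W z w z' := by
  obtain ⟨⟨hX, hW, hdis, h3, hNXW, hUW⟩, hwW, hNW, hyW, hyz, hyz', hzz', hyw⟩ := hs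
  have hc := h.hc
  have hcN := h.hcN
  have hwz' : w ≠ z' := by grind
  refine ⟨by grind, by grind, by grind, by grind, hzz', hwz', ?_, hobs⟩
  intro M hM hMne
  have hsub : nbr G S M ⊆ nbr G (W ∪ {z, w, z'}) M := by
    intro x hx
    obtain ⟨h1, h2, m, hm, hmx⟩ := mem_nbr.1 hx
    refine mem_nbr.2 ⟨?_, h2, m, hm, hmx⟩
    have hmU := hM hm
    have hxc : x ≠ c := by
      rintro rfl
      have := (hcN m (by grind)).1 hmx.symm
      grind
    have h4 := hUW x (by grind)
    have h5 := hyW m (by grind)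
    have h6 := hmx.symm
    grind
  refine (h.tc.2 M (by grind) hMne ⟨c, hc, by grind, fun hcM => ?_⟩).trans (card_le_card hsub)
  have := (mem_nbr.1 (hsub hcM)).1
  grind

theorem TriCross.sweep_of_back {G' : SimpleGraph V} {S W : Finset V} {c y w z z' : V}
    (h : TriData G G' S {y, w, z'} c) (hs : TriCross G S c y w z z' W)
    (hobs : ¬ Obs G ((S.erase c) \ ({y, z', z} ∪ insert w W)) y z z')
    (hsw : Sw G {z, w, z'} W) : Sweepable G S := by
  have hfd := hs.fanData_back h hobs
  obtain ⟨⟨hX, hW, hdis, h3, hNXW, hUW⟩, hwW, hNW, hyW, hyz, hyz', hzz', hyw⟩ := hs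
  have hc := h.hc
  have hcN := h.hcN
  set U := (S.erase c) \ ({y, z', z} ∪ insert w W) with hU
  have hfan := FanData.fan #U U y rfl hfd (fun hU0 => by
    by_contra hno
    refine h.tc.false_of_sep (M := {y, c}) (T := {w, z'}) (by grind) (by simp) card_le_two ?_
      (x := z) (by grind) (by grind) (by grind)
    intro m hm x hx hmx
    have h4 := hcN x hx
    have h5 : x ∉ U := by simp [hU0]
    have h6 := hyW x
    have h7 := hmx.ne
    grind)
  refine ⟨{c, y, z'}, by grind, ?_, ?_⟩
  · rw [card_eq_three]
    exact ⟨c, y, z', by grind, by grind, by grind, rfl⟩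
  have hwz' : w ≠ z' := by grind
  have e0 : S \ {c, y, z'} = insert w (U ∪ insert z W) := by grind
  rw [e0]
  refine Sw.step _ _ c w (by simp) (by simp) ((hcN w (by grind)).2 (by simp)) ?_ ?_
  · intro x hx hcx
    have := (hcN x (by grind)).1 hcx
    grind
  have e1 : (insert w (U ∪ insert z W)).erase w = U ∪ insert z W := by grind
  have e2 : insert w (({c, y, z'} : Finset V).erase c) = insert y {w, z'} := by grind
  rw [e1, e2]
  refine hfan.sw (by grind) ?_ (by grind) (by grind) ?_ ?_ hsw
  · rw [Finset.disjoint_left]; grind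
  · rw [Finset.disjoint_left]; grind
  · intro x hx r hr hxr
    have h4 := hUW x
    have h5 := hyW r
    grind

theorem TriCross.sweep_of_front {G' : SimpleGraph V} {S W : Finset V} {c y w z z' : V}
    (h : TriData G G' S {y, w, z'} c) (hs : TriCross G S c y w z z' W)
    (hobs : ¬ Obs G W z w z') : Sw G {y, z', z} (insert c (insert w W)) := by
  have hfd := hs.fanData_front h hobs
  obtain ⟨⟨hX, hW, hdis, h3, hNXW, hUW⟩, hwW, hNW, hyW, hyz, hyz', hzz', hyw⟩ := hs
  have hc := h.hc
  have hcN := h.hcN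
  have hwz' : w ≠ z' := by grind
  have hfan := FanData.fan #W W z rfl hfd (fun hU0 => by
    by_contra hno
    refine h.tc.false_of_sep (M := {w, c}) (T := {y, z'}) (by grind) (by simp) card_le_two ?_
      (x := z) (by grind) (by grind) (by grind)
    intro m hm x hx hmx
    have h4 := hcN x hx
    have h5 : x ∉ W := by simp [hU0]
    have h6 := hUW x
    have h7 := hmx.symm
    grind)
  have e0 : insert c (insert w W) = W ∪ insert w {c} := by grind
  have e1 : ({y, z', z} : Finset V) = insert z {y, z'} := by grind
  rw [e0, e1]
  refine hfan.sw (by grind) ?_ (by grind) (by grind) ?_ ?_ ?_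
  · rw [Finset.disjoint_left]; grind
  · rw [Finset.disjoint_left]; grind
  · intro x hx r hr hxr
    have h4 := hcN x (by grind)
    have h5 := hxr.symm
    grind
  · refine Sw.step _ _ y c (by simp) (by simp) ((hcN y (by grind)).2 (by simp)).symm (by grind) ?_
    rw [erase_singleton]
    exact Sw.nil _

end WidthThree

namespace WidthThree
open Finset
open scoped Classical
variable {V : Type*} {G : SimpleGraph V}

theorem Conn.union_of_mem {A B : Finset V} (hA : Conn G A) (hB : Conn G B) {z : V} (hz : z ∈ A)
    (hz' : z ∈ B) : Conn G (A ∪ B) := by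
  refine conn_of_cut ⟨z, by grind⟩ fun Q p hp hpQ q hq hqQ => ?_
  rcases Classical.em (z ∈ Q) with hzQ | hzQ
  · rcases mem_union.1 hq with hq | hq
    · obtain ⟨x, g1, g2, x', g3, g4, g5⟩ := hA.touch_compl hz hzQ hq hqQ
      exact ⟨x, by grind, x', by grind, by grind, g5⟩
    · obtain ⟨x, g1, g2, x', g3, g4, g5⟩ := hB.touch_compl hz' hzQ hq hqQ
      exact ⟨x, by grind, x', by grind, by grind, g5⟩
  · rcases mem_union.1 hp with hp | hp
    · obtain ⟨x, g1, g2, x', g3, g4, g5⟩ := hA.touch_compl hp hpQ hz hzQ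
      exact ⟨x, by grind, x', by grind, by grind, g5⟩
    · obtain ⟨x, g1, g2, x', g3, g4, g5⟩ := hB.touch_compl hp hpQ hz' hzQ
      exact ⟨x, by grind, x', by grind, by grind, g5⟩

theorem TriCross.minors {G' : SimpleGraph V} {S W : Finset V} {c y w z z' : V}
    (h : TriData G G' S {y, w, z'} c) (hs : TriCross G S c y w z z' W)
    (h1 : Obs G ((S.erase c) \ ({y, z', z} ∪ insert w W)) y z z') (h2 : Obs G W z w z') :
    Minors G S := by
  obtain ⟨⟨hX, hW, hdis, h3, hNXW, hUW⟩, hwW, hNW, hyW, hyz, hyz', hzz', hyw⟩ := hs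
  have hc := h.hc
  have hcN := h.hcN
  have hwz' : w ≠ z' := by grind
  clear hUW hyW h hNXW
  have hy0 : y ∉ insert w W ∧ z' ∉ insert w W ∧ z ∉ insert w W := by grind
  simp only [insert_subset_iff, singleton_subset_iff, subset_erase] at hX hW
  have hw0 : w ∈ S ∧ y ∈ S ∧ z ∈ S ∧ z' ∈ S ∧ W ⊆ S := by grind
  have hc0 : c ∉ W ∧ c ≠ w ∧ c ≠ y ∧ c ≠ z ∧ c ≠ z' := by grind
  obtain ⟨a, Y, Z, Z', c1, c2, c3, c4, s1, s2, s3, s4, m1, m2, m3, d1, d2, d3, d4, d5, d6,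
    t1, t2, t3, t4⟩ := h1
  obtain ⟨a', Y', W', Z'', c1', c2', c3', c4', s1', s2', s3', s4', m1', m2', m3', d1', d2', d3',
    d4', d5', d6', t1', t2', t3', t4'⟩ := h2
  rw [Finset.disjoint_left] at d1 d2 d3 d4 d5 d6 d1' d2' d3' d4' d5' d6'
  have ha0 : ∀ x ∈ a, x ∈ S ∧ x ≠ c ∧ x ∉ W ∧ x ≠ y ∧ x ≠ z ∧ x ≠ z' ∧ x ≠ w := by grind
  have hY0 : ∀ x ∈ Y, x ∈ S ∧ x ≠ c ∧ x ∉ W ∧ x ≠ z ∧ x ≠ z' ∧ x ≠ w := by grind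
  have hZ0 : ∀ x ∈ Z, x ∈ S ∧ x ≠ c ∧ x ∉ W ∧ x ≠ y ∧ x ≠ z' ∧ x ≠ w := by grind
  have hZ0' : ∀ x ∈ Z', x ∈ S ∧ x ≠ c ∧ x ∉ W ∧ x ≠ y ∧ x ≠ z ∧ x ≠ w := by grind
  have hcy := (hcN y hw0.2.1).2 (by simp)
  have hcw := (hcN w hw0.1).2 (by simp)
  have hcz' := (hcN z' hw0.2.2.2.1).2 (by simp)
  clear s1 s2 s3 s4 hX hW hdis hcN
  refine minors_H (T0 := Y) (T1 := W') (T2 := Z ∪ Y') (P01 := {c}) (P02 := a) (P12 := a')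
    (Q := Z' ∪ Z'') ?_ ?_ ⟨y, m1, w, m2', hyw⟩ (t4.mono Subset.rfl subset_union_left)
    (t4'.symm.mono Subset.rfl subset_union_right) ⟨y, m1, c, by simp, hcy.symm⟩
    ⟨w, m2', c, by simp, hcw.symm⟩ t1.symm (t2.symm.mono subset_union_left Subset.rfl) t2'.symm
    (t1'.symm.mono subset_union_right Subset.rfl) ⟨c, by simp, z', by simp [m3], hcz'⟩
    (t3.mono Subset.rfl subset_union_left) (t3'.mono Subset.rfl subset_union_right)
  · simp only [List.forall_mem_cons, conn_singleton, c1, c2, c1', c3', c3.union_of_mem c2' m2 m1',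
      c4.union_of_mem c4' m3 m3', true_and, List.not_mem_nil, IsEmpty.forall_iff, implies_true,
      and_true]
    and_intros <;> grind
  · simp only [List.pairwise_cons, List.forall_mem_cons, Finset.disjoint_left, List.Pairwise.nil,
      List.not_mem_nil, IsEmpty.forall_iff, implies_true, and_true]
    and_intros <;> grind

/-- A sweep of `G'` can be turned into a sweep of `G`, or `G` has a forbidden minor. -/
theorem TriData.sweep {G' : SimpleGraph V} {S N X W : Finset V} {c : V} (h : TriData G G' S N c)
    (hsw : Sw G' X W) (hs : TriState G S N c X W)
    (hR : Sw G X (insert c W) → Sweepable G S) : Sweepable G S ∨ Minors G S := by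
  have hc := h.hc
  have hcN := h.hcN
  have hN := h.hN
  have hN3 := h.hN3
  induction hsw with
  | nil X =>
    left
    obtain ⟨hX, hW, hdis, h3, hNXW, hUW⟩ := hs
    obtain ⟨y, hy⟩ : N.Nonempty := card_pos.1 (by omega)
    refine hR (Sw.step _ _ y c (by grind) (by simp) ((hcN y (by grind)).2 hy).symm (by grind) ?_)
    rw [insert_empty_eq, erase_singleton]
    exact Sw.nil _
  | step X W x w hx hw hxw huniq h' ih =>
    have hst := hs
    obtain ⟨hX, hW, hdis, h3, hNXW, hUW⟩ := hs
    have hG' := h.hG'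
    have hxw' := (hG' x (hX hx) w (hW hw)).1 hxw
    by_cases hxN : x ∈ N
    swap
    · have hxwG : G.Adj x w := by grind
      have hcx : ¬ G.Adj x c := fun hh => hxN ((hcN x (by clear ih; grind)).1 hh.symm)
      refine ih ⟨by clear ih; grind, by clear ih; grind, by clear ih; grind, ?_,
        by clear ih; grind, ?_⟩ ?_
      · rw [card_insert_of_notMem (by clear ih; grind), card_erase_of_mem hx, h3]
      · intro u hu huX huW v hv huv
        by_cases hux : u = x
        · subst hux
          have := huniq v (by clear ih; grind) ((hG' u hu v (by clear ih; grind)).2 ⟨huv.ne, Or.inl huv⟩)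
          clear ih; grind
        · exact hUW u hu (by clear ih; grind) (by clear ih; grind) v (by clear ih; grind) huv
      · intro hrest
        refine hR (Sw.step _ _ x w hx (by simp [hw]) hxwG ?_ ?_)
        · intro y hy hxy
          rcases mem_insert.1 hy with rfl | hy
          · exact absurd hxy hcx
          · exact huniq y hy ((hG' x (hX hx) y (hW hy)).2 ⟨hxy.ne, Or.inl hxy⟩)
        · have : (insert c W).erase w = insert c (W.erase w) := by clear ih; grind
          rw [this]
          exact hrest
    clear ih
    by_cases hNW : ∀ y ∈ N, y ∉ W
    · have hNX : N = X := eq_of_subset_of_card_le (by grind) (by omega)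
      by_cases hU : ∃ u ∈ S.erase c, u ∉ X ∧ u ∉ W
      · obtain ⟨u, hu, huX, huW⟩ := hU
        exact Or.inr (h.minors_of_both_sides hst hNW hu huX huW hw)
      left
      refine ⟨insert c (X.erase x), by grind, ?_, ?_⟩
      · rw [card_insert_of_notMem (by grind), card_erase_of_mem hx, h3]
      · have hall := h.transfer (Sw.step X W x w hx hw hxw huniq h') hX hW hNW
        have e0 : S \ insert c (X.erase x) = insert x W := by grind
        rw [e0]
        refine Sw.step _ _ c x (by simp) (by simp) ((hcN x (by grind)).2 hxN) ?_ ?_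
        · intro y hy hcy
          have := (hcN y (by grind)).1 hcy
          grind
        · have e1 : insert x ((insert c (X.erase x)).erase c) = X := by grind
          have e2 : (insert x W).erase x = W := by grind
          rw [e1, e2]
          exact hall
    · have hwN : w ∈ N := by
        push Not at hNW
        obtain ⟨y, hy, hyW⟩ := hNW
        have := huniq y hyW ((hG' x (hX hx) y (hW hyW)).2 (by grind))
        grind
      have hNw : ∀ y ∈ N, y ∈ W → y = w := fun y hy hyW =>
        huniq y hyW ((hG' x (hX hx) y (hW hyW)).2 (by grind))
      have hrest : Sw G (insert w (X.erase x)) (W.erase w) :=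
        h.transfer h' (by grind) (by grind) (by grind)
      by_cases hxwG : G.Adj x w
      swap
      · left
        refine hR (Sw.step _ _ x c hx (by simp) ((hcN x (by grind)).2 hxN).symm ?_ ?_)
        · intro y hy hxy
          rcases mem_insert.1 hy with rfl | hy
          · rfl
          · have := huniq y hy ((hG' x (hX hx) y (hW hy)).2 ⟨hxy.ne, Or.inl hxy⟩)
            grind
        · have e1 : (insert c W).erase c = W := by grind
          rw [e1]
          refine Sw.step _ _ c w (by simp) hw ((hcN w (by grind)).2 hwN) ?_ ?_
          · intro y hy hcy
            exact hNw y ((hcN y (by grind)).1 hcy) hy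
          · have e2 : insert w ((insert c (X.erase x)).erase c) = insert w (X.erase x) := by grind
            rw [e2]
            exact hrest
      have hxw1 : x ≠ w := hxwG.ne
      obtain ⟨z', hz'⟩ : ∃ z', (N.erase x).erase w = {z'} := by
        rw [← card_eq_one, card_erase_of_mem (by grind), card_erase_of_mem hxN, hN3]
      have hNe : N = {x, w, z'} := by
        ext t
        have : t ∈ (N.erase x).erase w ↔ t = z' := by rw [hz']; simp
        grind
      subst hNe
      have hz'1 : z' ≠ x ∧ z' ≠ w := by
        have : z' ∈ ((({x, w, z'} : Finset V).erase x).erase w) := by rw [hz']; simp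
        grind
      have hz'X : z' ∈ X := by grind
      obtain ⟨z, hz⟩ : ∃ z, (X.erase x).erase z' = {z} := by
        rw [← card_eq_one, card_erase_of_mem (by grind), card_erase_of_mem hx, h3]
      have hXe : X = {x, z', z} := by
        ext t
        have : t ∈ (X.erase x).erase z' ↔ t = z := by rw [hz]; simp
        grind
      subst hXe
      have hz1 : z ≠ x ∧ z ≠ z' := by
        have : z ∈ ((({x, z', z} : Finset V).erase x).erase z') := by rw [hz]; simp
        grind
      have hWe : insert w (W.erase w) = W := insert_erase hw
      have hcross : TriCross G S c x w z z' (W.erase w) := by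
        refine ⟨by rw [hWe]; exact hst, by grind, by grind, ?_, hz1.1.symm, hz'1.1.symm, hz1.2, hxwG⟩
        intro y hy hxy
        have := huniq y (by grind) ((hG' x (hX hx) y (hW (by grind))).2 ⟨hxy.ne, Or.inl hxy⟩)
        grind
      by_cases hb : Obs G ((S.erase c) \ ({x, z', z} ∪ insert w (W.erase w))) x z z'
      · by_cases hf : Obs G (W.erase w) z w z'
        · exact Or.inr (hcross.minors h hb hf)
        · left
          have := hcross.sweep_of_front h hf
          rw [hWe] at this
          exact hR this
      · left
        refine hcross.sweep_of_back h hb ?_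
        have e3 : insert w (({x, z', z} : Finset V).erase x) = {z, w, z'} := by grind
        rwa [e3] at hrest
end WidthThree

namespace WidthThree
open Finset
open scoped Classical
variable {V : Type*} {G : SimpleGraph V}

theorem TC.con_of_triangle {S : Finset V} {c p y1 y2 : V} (h : TC G S) (h5 : 5 ≤ #S) (hc : c ∈ S)
    (hp : p ∈ S) (hy1 : y1 ∈ S) (hy2 : y2 ∈ S) (hcN : ∀ x ∈ S, G.Adj c x ↔ x ∈ ({p, y1, y2} : Finset V))
    (h12 : G.Adj y1 y2) : TC (con G c p) (S.erase c) := by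
  by_contra hbad
  have hcp : G.Adj c p := (hcN p hp).2 (by simp)
  have hc1 : G.Adj c y1 := (hcN y1 hy1).2 (by simp)
  have hc2 : G.Adj c y2 := (hcN y2 hy2).2 (by simp)
  obtain ⟨M, hM, hMne, hcM, hpM, h3, x, hx, hxM, hxN⟩ := exists_bad_of_not_tc_con h h5 hc hp hcp hbad
  have hcp' := hcp.ne
  obtain ⟨w, hw⟩ : ∃ w, ((nbr G S M).erase c).erase p = {w} := by
    rw [← card_eq_one, card_erase_of_mem (by grind), card_erase_of_mem hcM, h3]
  have hNe : ∀ t, t ∈ nbr G S M → t = c ∨ t = p ∨ t = w := by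
    intro t ht
    have : t ∈ ((nbr G S M).erase c).erase p ↔ t = w := by rw [hw]; simp
    grind
  have hwN : w ∈ nbr G S M := by
    have : w ∈ ((nbr G S M).erase c).erase p := by rw [hw]; simp
    grind
  have hy : ∀ y ∈ S, ∀ y' ∈ M, G.Adj y' y → y ∈ M ∨ y = c ∨ y = p ∨ y = w := by
    intro y hy y' hy' hyy
    by_cases hyM : y ∈ M
    · exact Or.inl hyM
    · exact Or.inr (hNe y (mem_nbr.2 ⟨hy, hyM, y', hy', hyy⟩))
  obtain ⟨-, hcM', m, hm, hmc⟩ := mem_nbr.1 hcM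
  obtain ⟨-, hpM', -⟩ := mem_nbr.1 hpM
  have hm' := (hcN m (hM hm)).1 hmc.symm
  refine h.false_of_sep (M := insert c M) (T := {p, w}) (by grind) (by simp) card_le_two ?_
      (x := x) hx (by grind) (by grind)
  intro a ha y hyS hay
  rcases mem_insert.1 ha with rfl | ha
  · have h1 := (hcN y hyS).1 hay
    have h2 := hy y2 hy2 y1
    have h3 := hy y1 hy1 y2
    have h4 := h12.symm
    have h5 := hc1.ne
    have h6 := hc2.ne
    grind
  · have := hy y hyS a ha hay
    grind

theorem TC.sweep_of_triangle {S : Finset V} {c p y1 y2 : V} (h : TC G S) (hc : c ∈ S)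
    (hp : p ∈ S) (hy1 : y1 ∈ S) (hy2 : y2 ∈ S) (hpy1 : p ≠ y1) (hpy2 : p ≠ y2)
    (hcN : ∀ x ∈ S, G.Adj c x ↔ x ∈ ({p, y1, y2} : Finset V)) (h12 : G.Adj y1 y2)
    (hs : Sweepable (con G c p) (S.erase c)) : Sweepable G S ∨ Minors G S := by
  have hcp : G.Adj c p := (hcN p hp).2 (by simp)
  have hc1 : G.Adj c y1 := (hcN y1 hy1).2 (by simp)
  have hc2 : G.Adj c y2 := (hcN y2 hy2).2 (by simp)
  have := h12.ne
  have := hcp.ne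
  have := hc1.ne
  have := hc2.ne
  have htd : TriData G (con G c p) S {p, y1, y2} c := by
    refine ⟨h, hc, by grind, card_eq_three.2 ⟨p, y1, y2, hpy1, hpy2, h12.ne, rfl⟩, hcN, ?_⟩
    intro x hx y hy
    rw [con_adj]
    have h1 := hcN x (by grind)
    have h2 := hcN y (by grind)
    have h3 := h12.symm
    grind
  obtain ⟨X, hX, hX3, hsw⟩ := hs
  refine htd.sweep hsw ⟨hX, sdiff_subset, by grind, hX3, by grind, by grind⟩ fun hh => ?_
  refine ⟨X, by grind, hX3, ?_⟩
  have : S \ X = insert c (S.erase c \ X) := by grind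
  rwa [this]

end WidthThree

namespace WidthThree
open Finset
open scoped Classical
variable {V : Type*} {G : SimpleGraph V}

/-- No vertex of degree three lies in a triangle. -/
def NT (G : SimpleGraph V) (S : Finset V) : Prop :=
  ∀ c ∈ S, ∀ y1 ∈ S, ∀ y2 ∈ S, G.Adj c y1 → G.Adj c y2 → G.Adj y1 y2 → ∀ p,
    ∃ x ∈ S, x ≠ p ∧ x ≠ y1 ∧ x ≠ y2 ∧ G.Adj c x

/-- The vertices other than the ends `u`, `v` of an edge form two disjoint connected tracks `A`
and `B` that are joined at their ends by the vertices `c` and `c'`. -/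
structure Strip (G : SimpleGraph V) (S A B : Finset V) (u v c c' a b a' b' : V) : Prop where
  tc : TC G S
  nt : NT G S
  huv : G.Adj u v
  mem : ∀ x, x ∈ S ↔ x = u ∨ x = v ∨ x = c ∨ x = c' ∨ x ∈ A ∨ x ∈ B
  hA : ∀ x ∈ A, x ∉ B ∧ x ≠ u ∧ x ≠ v ∧ x ≠ c ∧ x ≠ c'
  hB : ∀ x ∈ B, x ≠ u ∧ x ≠ v ∧ x ≠ c ∧ x ≠ c'
  ne : u ≠ c ∧ u ≠ c' ∧ v ≠ c ∧ v ≠ c' ∧ c ≠ c'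
  connA : Conn G A
  connB : Conn G B
  ha : a ∈ A
  hb : b ∈ B
  ha' : a' ∈ A
  hb' : b' ∈ B
  hca : G.Adj c a
  hcb : G.Adj c b
  hca' : G.Adj c' a'
  hcb' : G.Adj c' b'
  hc : ∀ x ∈ S, G.Adj c x → x = a ∨ x = b ∨ x = u ∨ x = v
  hc' : ∀ x ∈ S, G.Adj c' x → x = a' ∨ x = b' ∨ x = u ∨ x = v

/-- The track `A` can be shortened at its end `m` next to `c`, where `n` is the successor of `m`
and `o` is the end of the other track. -/
structure Mover (G : SimpleGraph V) (S A : Finset V) (u v c m o n f : V) : Prop where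
  hn : n ∈ A
  hnm : n ≠ m
  hfm : f ≠ m
  conn : Conn G (A.erase m)
  adj : G.Adj m n
  hN : ∀ x ∈ S, G.Adj m x → x = c ∨ x = u ∨ x = v ∨ x = o ∨ x = n

section
variable {S A B : Finset V} {u v c c' a b a' b' : V}

theorem Strip.swap_uv (h : Strip G S A B u v c c' a b a' b') : Strip G S A B v u c c' a b a' b' := by
  obtain ⟨tc, nt, huv, mem, hA, hB, ne, h1, h2, h3, h4, h5, h6, h7, h8, h9, h10, h11, h12⟩ := h
  exact ⟨tc, nt, huv.symm, by grind, by grind, by grind, by grind, h1, h2, h3, h4, h5, h6, h7, h8,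
    h9, h10, by grind, by grind⟩

theorem Strip.swap_tracks (h : Strip G S A B u v c c' a b a' b') :
    Strip G S B A u v c c' b a b' a' := by
  obtain ⟨tc, nt, huv, mem, hA, hB, ne, h1, h2, h3, h4, h5, h6, h7, h8, h9, h10, h11, h12⟩ := h
  exact ⟨tc, nt, huv, by grind, by grind, by grind, by grind, h2, h1, h4, h3, h6, h5, h8, h7,
    h10, h9, by grind, by grind⟩

theorem Strip.swap_ends (h : Strip G S A B u v c c' a b a' b') :
    Strip G S A B u v c' c a' b' a b := by
  obtain ⟨tc, nt, huv, mem, hA, hB, ne, h1, h2, h3, h4, h5, h6, h7, h8, h9, h10, h11, h12⟩ := h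
  exact ⟨tc, nt, huv, by grind, by grind, by grind, by grind, h1, h2, h5, h6, h3, h4, h9, h10,
    h7, h8, by grind, by grind⟩

theorem Mover.swap_uv {m o n f : V} (h : Mover G S A u v c m o n f) : Mover G S A v u c m o n f := by
  obtain ⟨h1, h2, h3, h4, h5, h6⟩ := h
  exact ⟨h1, h2, h3, h4, h5, by grind⟩

/-- Possible adjacencies of `c` and the mover `m` with `u` and `v`. -/
def Cross (G : SimpleGraph V) (u v c m o : V) : Prop :=
  G.Adj c u ∧ ¬ G.Adj c v ∧ G.Adj m v ∧ ¬ G.Adj m u ∧ ¬ G.Adj m o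

theorem Strip.end_type {n : V} (h : Strip G S A B u v c c' a b a' b')
    (hm : Mover G S A u v c a b n a') :
    Minors G S ∨ (G.Adj a b ∧ G.Adj c u ∧ G.Adj c v) ∨ Cross G u v c a b ∨ Cross G v u c a b := by
  obtain ⟨tc, nt, huv, mem, hA, hB, ne, connA, connB, ha, hb, ha', hb', hca, hcb, hca', hcb', hc, hc'⟩
    := h
  obtain ⟨hn, hnm, hfm, hconn, hadj, hN⟩ := hm
  have hcS : c ∈ S := by grind
  have haS : a ∈ S := by grind
  have hbS : b ∈ S := by grind
  have huS : u ∈ S := by grind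
  have hvS : v ∈ S := by grind
  have hnS : n ∈ S := by grind
  have huv' := huv.ne
  obtain ⟨x, hxS, hxT, hcx⟩ := tc.exists_nbr hcS (T := {a, b}) card_le_two
  have hx := hc x hxS hcx
  by_cases hab : G.Adj a b
  · refine Or.inr (Or.inl ⟨hab, ?_, ?_⟩)
    · obtain ⟨y, hy, h1, h2, h3, h4⟩ := nt c hcS a haS b hbS hca hcb hab v
      have := hc y hy h4
      grind
    · obtain ⟨y, hy, h1, h2, h3, h4⟩ := nt c hcS a haS b hbS hca hcb hab u
      have := hc y hy h4
      grind
  obtain ⟨y, hyS, hyT, hay⟩ := tc.exists_nbr haS (T := {c, n}) card_le_two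
  have hy := hN y hyS hay
  by_cases hcu : G.Adj c u
  · by_cases hcv : G.Adj c v
    · left
      have hau : G.Adj a u := by
        by_contra hau
        obtain ⟨z, hz, h1, h2, h3, h4⟩ := nt a haS c hcS v hvS hca.symm (by grind) hcv n
        have := hN z hz h4
        grind
      have hav : G.Adj a v := by
        by_contra hav
        obtain ⟨z, hz, h1, h2, h3, h4⟩ := nt a haS c hcS u huS hca.symm (by grind) hcu n
        have := hN z hz h4
        grind
      have hconn2 : Conn G (insert c' (A.erase a ∪ B)) := by
        have h1 := hconn.insert (v := c') (a := a') (by grind) hca'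
        have h2 := connB.insert (v := c') (a := b') (by grind) hcb'
        have h3 := h1.union_of_mem h2 (z := c') (by simp) (by simp)
        have e : insert c' (A.erase a) ∪ insert c' B = insert c' (A.erase a ∪ B) := by grind
        rwa [e] at h3
      obtain ⟨p, hpS, p1, p2, p3, p4⟩ := nt u huS v hvS c hcS huv hcu.symm hcv.symm a
      obtain ⟨q, hqS, q1, q2, q3, q4⟩ := nt v hvS u huS c hcS huv.symm hcv.symm hcu.symm a
      have hp := p4.ne
      have hq := q4.ne
      refine minors_K5 (A0 := {u}) (A1 := {v}) (A2 := {c}) (A3 := {a})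
        (A4 := insert c' (A.erase a ∪ B)) ?_ ?_ ⟨u, by simp, v, by simp, huv⟩
        ⟨u, by simp, c, by simp, hcu.symm⟩ ⟨u, by simp, a, by simp, hau.symm⟩
        ⟨u, by simp, p, by grind, p4⟩ ⟨v, by simp, c, by simp, hcv.symm⟩
        ⟨v, by simp, a, by simp, hav.symm⟩ ⟨v, by simp, q, by grind, q4⟩
        ⟨c, by simp, a, by simp, hca⟩ ⟨c, by simp, b, by grind, hcb⟩ ⟨a, by simp, n, by grind, hadj⟩
      · simp only [List.forall_mem_cons, conn_singleton, hconn2, true_and, List.not_mem_nil,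
          IsEmpty.forall_iff, implies_true, and_true]
        and_intros <;> grind
      · simp only [List.pairwise_cons, List.forall_mem_cons, Finset.disjoint_left,
          List.Pairwise.nil, List.not_mem_nil, IsEmpty.forall_iff, implies_true, and_true]
        and_intros <;> grind
    · have hau : ¬ G.Adj a u := by
        intro hau
        obtain ⟨z, hz, h1, h2, h3, h4⟩ := nt c hcS a haS u huS hca hcu hau b
        have := hc z hz h4
        grind
      exact Or.inr (Or.inr (Or.inl ⟨hcu, hcv, by grind, hau, hab⟩))
  · have hcv : G.Adj c v := by grind
    have hav : ¬ G.Adj a v := by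
      intro hav
      obtain ⟨z, hz, h1, h2, h3, h4⟩ := nt c hcS a haS v hvS hca hcv hav b
      have := hc z hz h4
      grind
    exact Or.inr (Or.inr (Or.inr ⟨hcv, hcu, by grind, hav, hab⟩))

theorem Strip.minors_of_rungs_of_touch (h : Strip G S A B u v c c' a b a' b') (hab : G.Adj a b)
    (hcu : G.Adj c u) (hcv : G.Adj c v) (hcu' : G.Adj c' u) (hcv' : G.Adj c' v)
    (hu : ∃ x ∈ A, G.Adj u x) (hv : ∃ x ∈ B, G.Adj v x) : Minors G S := by
  obtain ⟨tc, nt, huv, mem, hA, hB, ne, connA, connB, ha, hb, ha', hb', hca, hcb, hca', hcb', hc, hc'⟩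
    := h
  obtain ⟨x, hx, hux⟩ := hu
  obtain ⟨y, hy, hvy⟩ := hv
  have huv' := huv.ne
  refine minors_O (A0 := {u}) (A1 := {v}) (A2 := B) (A3 := A) (P := {c}) (Q := {c'}) ?_ ?_
    ⟨u, by simp, v, by simp, huv⟩ ⟨v, by simp, y, hy, hvy⟩ ⟨b, hb, a, ha, hab.symm⟩
    ⟨u, by simp, x, hx, hux⟩ ⟨u, by simp, c, by simp, hcu.symm⟩ ⟨v, by simp, c, by simp, hcv.symm⟩
    ⟨b, hb, c, by simp, hcb.symm⟩ ⟨a, ha, c, by simp, hca.symm⟩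
    ⟨u, by simp, c', by simp, hcu'.symm⟩ ⟨v, by simp, c', by simp, hcv'.symm⟩
    ⟨b', hb', c', by simp, hcb'.symm⟩ ⟨a', ha', c', by simp, hca'.symm⟩
  · simp only [List.forall_mem_cons, conn_singleton, connA, connB, true_and, List.not_mem_nil,
      IsEmpty.forall_iff, implies_true, and_true]
    and_intros <;> grind
  · simp only [List.pairwise_cons, List.forall_mem_cons, Finset.disjoint_left,
      List.Pairwise.nil, List.not_mem_nil, IsEmpty.forall_iff, implies_true, and_true]
    and_intros <;> grind

theorem Strip.minors_of_rungs_of_track (h : Strip G S A B u v c c' a b a' b') (hab : G.Adj a b)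
    (hcu : G.Adj c u) (hcv : G.Adj c v) (hcu' : G.Adj c' u) (hcv' : G.Adj c' v)
    (hu : ∃ x ∈ A, G.Adj u x) (hv : ∃ x ∈ A, G.Adj v x) : Minors G S := by
  obtain ⟨tc, nt, huv, mem, hA, hB, ne, connA, connB, ha, hb, ha', hb', hca, hcb, hca', hcb', hc, hc'⟩
    := h
  obtain ⟨x, hx, hux⟩ := hu
  obtain ⟨y, hy, hvy⟩ := hv
  have huv' := huv.ne
  refine minors_K5 (A0 := {u}) (A1 := {v}) (A2 := {c}) (A3 := A) (A4 := insert c' B) ?_ ?_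
    ⟨u, by simp, v, by simp, huv⟩ ⟨u, by simp, c, by simp, hcu.symm⟩ ⟨u, by simp, x, hx, hux⟩
    ⟨u, by simp, c', by simp, hcu'.symm⟩ ⟨v, by simp, c, by simp, hcv.symm⟩
    ⟨v, by simp, y, hy, hvy⟩ ⟨v, by simp, c', by simp, hcv'.symm⟩ ⟨c, by simp, a, ha, hca⟩
    ⟨c, by simp, b, by simp [hb], hcb⟩ ⟨a, ha, b, by simp [hb], hab⟩
  · simp only [List.forall_mem_cons, conn_singleton, connA, connB.insert hb' hcb', true_and,
      List.not_mem_nil, IsEmpty.forall_iff, implies_true, and_true]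
    and_intros <;> grind
  · simp only [List.pairwise_cons, List.forall_mem_cons, Finset.disjoint_left,
      List.Pairwise.nil, List.not_mem_nil, IsEmpty.forall_iff, implies_true, and_true]
    and_intros <;> grind

theorem Strip.minors_of_rungs (h : Strip G S A B u v c c' a b a' b') (hab : G.Adj a b)
    (hcu : G.Adj c u) (hcv : G.Adj c v) (hcu' : G.Adj c' u) (hcv' : G.Adj c' v) : Minors G S := by
  have huS : u ∈ S := (h.mem u).2 (by simp)
  have hvS : v ∈ S := (h.mem v).2 (by simp)
  have hcS : c ∈ S := (h.mem c).2 (by simp)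
  obtain ⟨p, hpS, p1, p2, p3, p4⟩ := h.nt u huS v hvS c hcS h.huv hcu.symm hcv.symm c'
  obtain ⟨q, hqS, q1, q2, q3, q4⟩ := h.nt v hvS u huS c hcS h.huv.symm hcv.symm hcu.symm c'
  have hp : p ∈ A ∨ p ∈ B := by have := (h.mem p).1 hpS; have := p4.ne; grind
  have hq : q ∈ A ∨ q ∈ B := by have := (h.mem q).1 hqS; have := q4.ne; grind
  rcases hp with hp | hp <;> rcases hq with hq | hq
  · exact h.minors_of_rungs_of_track hab hcu hcv hcu' hcv' ⟨p, hp, p4⟩ ⟨q, hq, q4⟩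
  · exact h.minors_of_rungs_of_touch hab hcu hcv hcu' hcv' ⟨p, hp, p4⟩ ⟨q, hq, q4⟩
  · exact h.swap_tracks.minors_of_rungs_of_touch hab.symm hcu hcv hcu' hcv' ⟨p, hp, p4⟩ ⟨q, hq, q4⟩
  · exact h.swap_tracks.minors_of_rungs_of_track hab.symm hcu hcv hcu' hcv' ⟨p, hp, p4⟩ ⟨q, hq, q4⟩

/-- The sets `u`, `A`, `B` against `v`, `c`, `c'`. -/
theorem Strip.minors_of_tracks (h : Strip G S A B u v c c' a b a' b')
    (hcu : G.Adj c u) (hcu' : G.Adj c' u) (hu : ∃ x ∈ A, G.Adj v x) (hv : ∃ x ∈ B, G.Adj v x) :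
    Minors G S := by
  obtain ⟨tc, nt, huv, mem, hA, hB, ne, connA, connB, ha, hb, ha', hb', hca, hcb, hca', hcb', hc, hc'⟩
    := h
  obtain ⟨x, hx, hvx⟩ := hu
  obtain ⟨y, hy, hvy⟩ := hv
  have huv' := huv.ne
  refine minors_K33 (A0 := {u}) (A1 := A) (A2 := B) (B0 := {v}) (B1 := {c}) (B2 := {c'}) ?_ ?_
    ⟨u, by simp, v, by simp, huv⟩ ⟨u, by simp, c, by simp, hcu.symm⟩
    ⟨u, by simp, c', by simp, hcu'.symm⟩ ⟨x, hx, v, by simp, hvx.symm⟩ ⟨a, ha, c, by simp, hca.symm⟩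
    ⟨a', ha', c', by simp, hca'.symm⟩ ⟨y, hy, v, by simp, hvy.symm⟩ ⟨b, hb, c, by simp, hcb.symm⟩
    ⟨b', hb', c', by simp, hcb'.symm⟩
  · simp only [List.forall_mem_cons, conn_singleton, connA, connB, true_and, List.not_mem_nil,
      IsEmpty.forall_iff, implies_true, and_true]
    and_intros <;> grind
  · simp only [List.pairwise_cons, List.forall_mem_cons, Finset.disjoint_left,
      List.Pairwise.nil, List.not_mem_nil, IsEmpty.forall_iff, implies_true, and_true]
    and_intros <;> grind

theorem Strip.minors_of_rung_of_cross {n : V} (h : Strip G S A B u v c c' a b a' b')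
    (hab : G.Adj a b) (hcu : G.Adj c u) (hcv : G.Adj c v) (hm : Mover G S B u v c' b' a' n b)
    (hx : Cross G u v c' b' a') : Minors G S := by
  obtain ⟨x1, x2, x3, x4, x5⟩ := hx
  by_cases hvA : ∃ x ∈ A, G.Adj v x
  · exact h.minors_of_tracks hcu x1 hvA ⟨b', h.hb', x3.symm⟩
  obtain ⟨tc, nt, huv, mem, hA, hB, ne, connA, connB, ha, hb, ha', hb', hca, hcb, hca', hcb', hc, hc'⟩
    := h
  obtain ⟨hn, hnm, hfm, hconn, hadj, hN⟩ := hm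
  have huS : u ∈ S := (mem u).2 (by simp)
  have hvS : v ∈ S := (mem v).2 (by simp)
  have hcS : c ∈ S := (mem c).2 (by simp)
  obtain ⟨q, hqS, q1, q2, q3, q4⟩ := nt v hvS u huS c hcS huv.symm hcv.symm hcu.symm b'
  have hq : q ∈ B.erase b' := by
    have := (mem q).1 hqS; have := q4.ne; have := q4.symm; grind
  have huv' := huv.ne
  clear hvA
  refine minors_H (T0 := {v}) (T1 := {c}) (T2 := B.erase b') (P01 := {u}) (P02 := {b'}) (P12 := A)
    (Q := {c'}) ?_ ?_ ⟨v, by simp, c, by simp, hcv.symm⟩ ⟨v, by simp, q, hq, q4⟩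
    ⟨c, by simp, b, by grind, hcb⟩ ⟨v, by simp, u, by simp, huv.symm⟩ ⟨c, by simp, u, by simp, hcu⟩
    ⟨v, by simp, b', by simp, x3.symm⟩ ⟨n, by grind, b', by simp, hadj.symm⟩
    ⟨c, by simp, a, ha, hca⟩ ⟨b, by grind, a, ha, hab.symm⟩ ⟨u, by simp, c', by simp, x1.symm⟩
    ⟨b', by simp, c', by simp, hcb'.symm⟩ ⟨a', ha', c', by simp, hca'.symm⟩
  · simp only [List.forall_mem_cons, conn_singleton, connA, hconn, true_and, List.not_mem_nil,
      IsEmpty.forall_iff, implies_true, and_true]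
    and_intros <;> grind
  · simp only [List.pairwise_cons, List.forall_mem_cons, Finset.disjoint_left,
      List.Pairwise.nil, List.not_mem_nil, IsEmpty.forall_iff, implies_true, and_true]
    and_intros <;> grind

end
end WidthThree

namespace WidthThree
open Finset
open scoped Classical
variable {V : Type*} {G : SimpleGraph V}
variable {S A B : Finset V} {u v c c' a b a' b' : V}

theorem Strip.minors_of_opposite {n : V} (h : Strip G S A B u v c c' a b a' b')
    (hm : Mover G S A u v c a b n a') (hcu : G.Adj c u) (hav : G.Adj a v) (hcv' : G.Adj c' v)
    (hu : ∃ x ∈ A.erase a, G.Adj u x) : Minors G S := by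
  obtain ⟨tc, nt, huv, mem, hA, hB, ne, connA, connB, ha, hb, ha', hb', hca, hcb, hca', hcb', hc, hc'⟩
    := h
  obtain ⟨hn, hnm, hfm, hconn, hadj, hN⟩ := hm
  obtain ⟨x, hx, hux⟩ := hu
  have huv' := huv.ne
  refine minors_K33 (A0 := {u}) (A1 := {a}) (A2 := {c'}) (B0 := {v}) (B1 := insert c B)
    (B2 := A.erase a) ?_ ?_ ⟨u, by simp, v, by simp, huv⟩ ⟨u, by simp, c, by simp, hcu.symm⟩
    ⟨u, by simp, x, hx, hux⟩ ⟨a, by simp, v, by simp, hav⟩ ⟨a, by simp, c, by simp, hca.symm⟩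
    ⟨a, by simp, n, by grind, hadj⟩ ⟨c', by simp, v, by simp, hcv'⟩
    ⟨c', by simp, b', by simp [hb'], hcb'⟩ ⟨c', by simp, a', by grind, hca'⟩
  · simp only [List.forall_mem_cons, conn_singleton, connB.insert hb hcb, hconn, true_and,
      List.not_mem_nil, IsEmpty.forall_iff, implies_true, and_true]
    and_intros <;> grind
  · simp only [List.pairwise_cons, List.forall_mem_cons, Finset.disjoint_left,
      List.Pairwise.nil, List.not_mem_nil, IsEmpty.forall_iff, implies_true, and_true]
    and_intros <;> grind

theorem Strip.minors_of_same_track {n e s : V} (h : Strip G S A B u v c c' a b a' b')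
    (hm : Mover G S A u v c a b n a') (hm' : Mover G S A u v c' a' b' e a)
    (hx : Cross G u v c a b) (hx' : Cross G u v c' a' b')
    (hconn2 : n ≠ a' → Conn G ((A.erase a).erase a'))
    (hs : ∀ x ∈ A, G.Adj n x → x = a ∨ x = s) : Minors G S := by
  obtain ⟨tc, nt, huv, mem, hA, hB, ne, connA, connB, ha, hb, ha', hb', hca, hcb, hca', hcb', hc, hc'⟩
    := h
  obtain ⟨hn, hnm, hfm, hconn, hadj, hN⟩ := hm
  obtain ⟨hn', hnm', hfm', hconn', hadj', hN'⟩ := hm'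
  obtain ⟨x1, x2, x3, x4, x5⟩ := hx
  obtain ⟨y1, y2, y3, y4, y5⟩ := hx'
  have huS : u ∈ S := (mem u).2 (by simp)
  have hvS : v ∈ S := (mem v).2 (by simp)
  have hcS : c ∈ S := (mem c).2 (by simp)
  have haS : a ∈ S := by grind
  have hnS : n ∈ S := by grind
  have hnv : ¬ G.Adj n v := by
    intro hnv
    obtain ⟨z, hz, h1, h2, h3, h4⟩ := nt a haS n hnS v hvS hadj x3 hnv c
    have := hN z hz h4
    grind
  have hna' : n ≠ a' := by rintro rfl; exact hnv y3
  have hea : e ≠ a := by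
    rintro rfl
    have := hN a' (by grind) hadj'.symm
    grind
  have hconn3 := hconn2 hna'
  have huv' := huv.ne
  have hnA : n ∈ (A.erase a).erase a' := by grind
  have heA : e ∈ (A.erase a).erase a' := by grind
  have hAA : ∀ x, x ∈ (A.erase a).erase a' ↔ x ∈ A ∧ x ≠ a ∧ x ≠ a' := by grind
  set A1 := (A.erase a).erase a' with hA1
  clear_value A1
  by_cases hAB : ∃ x ∈ A1, ∃ y ∈ B, G.Adj x y
  · obtain ⟨x, hx, y, hy, hxy⟩ := hAB
    have huS : u ∈ S ∧ v ∈ S ∧ c ∈ S ∧ c' ∈ S ∧ A ⊆ S ∧ B ⊆ S := by grind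
    clear nt tc hs mem hc hc' hN hN'
    refine minors_C (A0 := {c}) (A1 := {c'}) (A2 := {v}) (A3 := A1) (B0 := {a'}) (B1 := {a})
      (B2 := B) (B3 := {u}) ?_ ?_ ⟨c, by simp, a, by simp, hca⟩ ⟨c, by simp, b, hb, hcb⟩
      ⟨c, by simp, u, by simp, x1⟩ ⟨c', by simp, a', by simp, hca'⟩ ⟨c', by simp, b', hb', hcb'⟩
      ⟨c', by simp, u, by simp, y1⟩ ⟨v, by simp, a', by simp, y3.symm⟩
      ⟨v, by simp, a, by simp, x3.symm⟩ ⟨v, by simp, u, by simp, huv.symm⟩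
      ⟨e, heA, a', by simp, hadj'.symm⟩ ⟨n, hnA, a, by simp, hadj.symm⟩ ⟨x, hx, y, hy, hxy⟩
    · simp only [List.forall_mem_cons, conn_singleton, hconn3, connB, true_and, List.not_mem_nil,
        IsEmpty.forall_iff, implies_true, and_true]
      and_intros <;> grind
    · simp only [List.pairwise_cons, List.forall_mem_cons, Finset.disjoint_left,
        List.Pairwise.nil, List.not_mem_nil, IsEmpty.forall_iff, implies_true, and_true]
      and_intros <;> grind
  by_cases hu : ∃ x ∈ A1, G.Adj u x
  · obtain ⟨x, hx, hux⟩ := hu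
    have hc2 := (conn_singleton (G := G) a').insert (v := c') (by simp) hca'
    refine minors_K33 (A0 := {u}) (A1 := {a}) (A2 := insert c' {a'}) (B0 := {v}) (B1 := insert c B)
      (B2 := A1) ?_ ?_ ⟨u, by simp, v, by simp, huv⟩ ⟨u, by simp, c, by simp, x1.symm⟩
      ⟨u, by simp, x, hx, hux⟩ ⟨a, by simp, v, by simp, x3⟩ ⟨a, by simp, c, by simp, hca.symm⟩
      ⟨a, by simp, n, hnA, hadj⟩ ⟨a', by simp, v, by simp, y3⟩
      ⟨c', by simp, b', by simp [hb'], hcb'⟩ ⟨a', by simp, e, heA, hadj'⟩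
    · simp only [List.forall_mem_cons, conn_singleton, connB.insert hb hcb, hconn3, hc2, true_and,
        List.not_mem_nil, IsEmpty.forall_iff, implies_true, and_true]
      and_intros <;> grind
    · simp only [List.pairwise_cons, List.forall_mem_cons, Finset.disjoint_left,
        List.Pairwise.nil, List.not_mem_nil, IsEmpty.forall_iff, implies_true, and_true]
      and_intros <;> grind
  exfalso
  obtain ⟨x, hxS, hxT, hnx⟩ := tc.exists_nbr hnS (T := {a, s}) card_le_two
  push Not at hAB hu
  have k1 := hAB n hnA x
  have k2 := hu n hnA
  have k3 := hs x
  have k4 := hnx.symm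
  have k5 := (mem x).1 hxS
  have k6 := hc n hnS
  have k7 := hc' n hnS
  grind

theorem Strip.minors_of_diagonal {n e s : V} (h : Strip G S A B u v c c' a b a' b')
    (hm : Mover G S A u v c a b n a') (hm' : Mover G S B u v c' b' a' e b)
    (hx : Cross G u v c a b) (hx' : Cross G v u c' b' a')
    (hs : ∀ x ∈ A, G.Adj n x → x = a ∨ x = s) (hns : n = a' → s = a) : Minors G S := by
  by_cases hu : ∃ x ∈ A.erase a, G.Adj u x
  · exact h.minors_of_opposite hm hx.1 hx.2.2.1 hx'.1 hu
  obtain ⟨tc, nt, huv, mem, hA, hB, ne, connA, connB, ha, hb, ha', hb', hca, hcb, hca', hcb', hc, hc'⟩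
    := h
  obtain ⟨hn, hnm, hfm, hconn, hadj, hN⟩ := hm
  obtain ⟨hn', hnm', hfm', hconn', hadj', hN'⟩ := hm'
  obtain ⟨x1, x2, x3, x4, x5⟩ := hx
  obtain ⟨y1, y2, y3, y4, y5⟩ := hx'
  have huS : u ∈ S := (mem u).2 (by simp)
  have hvS : v ∈ S := (mem v).2 (by simp)
  have hcS : c ∈ S := (mem c).2 (by simp)
  have haS : a ∈ S := by grind
  have hnS : n ∈ S := by grind
  have hnv : ¬ G.Adj n v := by
    intro hnv
    obtain ⟨z, hz, h1, h2, h3, h4⟩ := nt a haS n hnS v hvS hadj x3 hnv c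
    have := hN z hz h4
    grind
  have huv' := huv.ne
  by_cases hAB : ∃ x ∈ A.erase a, ∃ y ∈ B.erase b', G.Adj x y
  · obtain ⟨x, hx, y, hy, hxy⟩ := hAB
    have huS : u ∈ S ∧ v ∈ S ∧ c ∈ S ∧ c' ∈ S ∧ A ⊆ S ∧ B ⊆ S := by grind
    clear nt tc hs mem hc hc' hN hN' hu
    refine minors_C (A0 := {c}) (A1 := A.erase a) (A2 := {b'}) (A3 := {v}) (B0 := {c'}) (B1 := {u})
      (B2 := {a}) (B3 := B.erase b') ?_ ?_ ⟨c, by simp, u, by simp, x1⟩ ⟨c, by simp, a, by simp, hca⟩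
      ⟨c, by simp, b, by grind, hcb⟩ ⟨a', by grind, c', by simp, hca'.symm⟩
      ⟨n, by grind, a, by simp, hadj.symm⟩ ⟨x, hx, y, hy, hxy⟩ ⟨b', by simp, c', by simp, hcb'.symm⟩
      ⟨b', by simp, u, by simp, y3⟩ ⟨b', by simp, e, by grind, hadj'⟩
      ⟨v, by simp, c', by simp, y1.symm⟩ ⟨v, by simp, u, by simp, huv.symm⟩
      ⟨v, by simp, a, by simp, x3.symm⟩
    · simp only [List.forall_mem_cons, conn_singleton, hconn, hconn', true_and, List.not_mem_nil,
        IsEmpty.forall_iff, implies_true, and_true]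
      and_intros <;> grind
    · simp only [List.pairwise_cons, List.forall_mem_cons, Finset.disjoint_left,
        List.Pairwise.nil, List.not_mem_nil, IsEmpty.forall_iff, implies_true, and_true]
      and_intros <;> grind
  exfalso
  push Not at hAB hu
  have k1 := hAB n (by grind)
  have k2 := hu n (by grind)
  have k6 := hc n hnS
  have k7 := hc' n hnS
  have k8 := hN' n hnS
  obtain ⟨x, hxS, hxT, hnx⟩ : ∃ x ∈ S, x ∉ ({a, if n = a' then c' else s} : Finset V) ∧ G.Adj n x :=
    tc.exists_nbr hnS card_le_two
  have k3 := hs x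
  have k4 := hnx.symm
  have k5 := (mem x).1 hxS
  have k9 := k1 x
  clear nt tc hs mem hc hc' hN hN' hu hAB k1
  grind

theorem Strip.minors {n s : V} (h : Strip G S A B u v c c' a b a' b')
    (hm : Mover G S A u v c a b n a')
    (hs : ∀ x ∈ A, G.Adj n x → x = a ∨ x = s) (hns : n = a' → s = a)
    (hm' : (∃ e, Mover G S A u v c' a' b' e a ∧ (n ≠ a' → Conn G ((A.erase a).erase a'))) ∨
      ∃ e, Mover G S B u v c' b' a' e b) : Minors G S := by
  have h1 := h.end_type hm
  rcases hm' with ⟨e, hm', hconn2⟩ | ⟨e, hm'⟩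
  · have h2 := h.swap_ends.end_type hm'
    rcases h1 with h1 | ⟨r1, r2, r3⟩ | h1 | h1
    · exact h1
    · rcases h2 with h2 | ⟨q1, q2, q3⟩ | h2 | h2
      · exact h2
      · exact h.minors_of_rungs r1 r2 r3 q2 q3
      · exact h.swap_tracks.minors_of_rung_of_cross r1.symm r2 r3 hm' h2
      · exact h.swap_uv.swap_tracks.minors_of_rung_of_cross r1.symm r3 r2 hm'.swap_uv h2
    · rcases h2 with h2 | ⟨q1, q2, q3⟩ | h2 | h2
      · exact h2
      · exact h.swap_ends.swap_tracks.minors_of_rung_of_cross q1.symm q2 q3 hm h1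
      · exact h.minors_of_same_track hm hm' h1 h2 hconn2 hs
      · exact h.minors_of_opposite hm h1.1 h1.2.2.1 h2.1
          ⟨a', by have := h.ha'; have := hm.hfm; grind, h2.2.2.1.symm⟩
    · rcases h2 with h2 | ⟨q1, q2, q3⟩ | h2 | h2
      · exact h2
      · exact h.swap_uv.swap_ends.swap_tracks.minors_of_rung_of_cross q1.symm q3 q2 hm.swap_uv h1
      · exact h.swap_uv.minors_of_opposite hm.swap_uv h1.1 h1.2.2.1 h2.1
          ⟨a', by have := h.ha'; have := hm.hfm; grind, h2.2.2.1.symm⟩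
      · exact h.swap_uv.minors_of_same_track hm.swap_uv hm'.swap_uv h1 h2 hconn2 hs
  · have h2 := h.swap_ends.swap_tracks.end_type hm'
    rcases h1 with h1 | ⟨r1, r2, r3⟩ | h1 | h1
    · exact h1
    · rcases h2 with h2 | ⟨q1, q2, q3⟩ | h2 | h2
      · exact h2
      · exact h.minors_of_rungs r1 r2 r3 q2 q3
      · exact h.minors_of_rung_of_cross r1 r2 r3 hm' h2
      · exact h.swap_uv.minors_of_rung_of_cross r1 r3 r2 hm'.swap_uv h2
    · rcases h2 with h2 | ⟨q1, q2, q3⟩ | h2 | h2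
      · exact h2
      · exact h.swap_ends.swap_tracks.minors_of_rung_of_cross q1 q2 q3 hm h1
      · exact h.minors_of_tracks h1.1 h2.1 ⟨a, h.ha, h1.2.2.1.symm⟩ ⟨b', h.hb', h2.2.2.1.symm⟩
      · exact h.minors_of_diagonal hm hm' h1 h2 hs hns
    · rcases h2 with h2 | ⟨q1, q2, q3⟩ | h2 | h2
      · exact h2
      · exact h.swap_uv.swap_ends.swap_tracks.minors_of_rung_of_cross q1 q3 q2 hm.swap_uv h1
      · exact h.swap_uv.minors_of_diagonal hm.swap_uv hm'.swap_uv h1 h2 hs hns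
      · exact h.swap_uv.minors_of_tracks h1.1 h2.1 ⟨a, h.ha, h1.2.2.1.symm⟩
          ⟨b', h.hb', h2.2.2.1.symm⟩

end WidthThree

namespace WidthThree
open Finset
open scoped Classical
variable {V : Type*} {G : SimpleGraph V}

/-- The front `X` separates the part `W` still to be swept from the rest of `S`. -/
structure Front (G : SimpleGraph V) (S X W : Finset V) : Prop where
  hX : X ⊆ S
  hW : W ⊆ S
  hdis : ∀ x ∈ X, x ∉ W
  h3 : #X = 3
  hUW : ∀ r ∈ S, r ∉ X → r ∉ W → ∀ w ∈ W, ¬ G.Adj r w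

theorem Front.step {S X W : Finset V} {x w : V} (h : Front G S X W) (hx : x ∈ X) (hw : w ∈ W)
    (huniq : ∀ y ∈ W, G.Adj x y → y = w) :
    Front G S (insert w (X.erase x)) (W.erase w) := by
  obtain ⟨hX, hW, hdis, h3, hUW⟩ := h
  refine ⟨by grind, by grind, by grind, ?_, ?_⟩
  · rw [card_insert_of_notMem (by grind), card_erase_of_mem hx, h3]
  · intro r hr hrX hrW y hy hry
    by_cases hrx : r = x
    · subst hrx
      have := huniq y (by grind) hry
      grind
    · exact hUW r hr (by grind) (by grind) y (by grind) hry

theorem exists_pair_of_erase {X : Finset V} {x : V} (h3 : #X = 3) (hx : x ∈ X) :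
    ∃ y z, y ≠ z ∧ y ≠ x ∧ z ≠ x ∧ X = {x, y, z} := by
  obtain ⟨y, z, hyz, he⟩ := card_eq_two.1 (by rw [card_erase_of_mem hx, h3] : #(X.erase x) = 2)
  have h1 : ∀ t, t ∈ X.erase x ↔ t = y ∨ t = z := by intro t; rw [he]; simp
  have hy := (h1 y).2 (by simp)
  have hz := (h1 z).2 (by simp)
  refine ⟨y, z, hyz, by grind, by grind, ?_⟩
  ext t
  have := h1 t
  grind

/-- The data of a contracted edge `uv` in a graph without degree-3 vertices in triangles. -/
structure Contr (G : SimpleGraph V) (S : Finset V) (u v : V) : Prop where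
  tc : TC G S
  nt : NT G S
  hu : u ∈ S
  hv : v ∈ S
  huv : G.Adj u v

section
variable {S : Finset V} {u v : V}

theorem Contr.adj_of_ne {x y : V} (hx : x ≠ u) (hy : y ≠ u) :
    (con G v u).Adj x y ↔ G.Adj x y := by
  rw [con_adj]
  refine ⟨fun h => by grind, fun h => ⟨h.ne, Or.inl h⟩⟩

theorem Contr.adj_left {x y : V} (h : G.Adj x y) : (con G v u).Adj x y := ⟨h.ne, Or.inl h⟩

theorem Contr.adj_v {y : V} (hy : y ≠ u) (h : G.Adj v y) : (con G v u).Adj u y :=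
  ⟨hy.symm, Or.inr (Or.inl ⟨rfl, h⟩)⟩

theorem Contr.false_of_triangle (h : Contr G S u v) {c t : V} (hc : c ∈ S)
    (ht : ∀ x ∈ S, G.Adj c x → x = t ∨ x = u ∨ x = v) : False := by
  have h1 : G.Adj c u := by
    obtain ⟨r, hr, hrT, hcr⟩ := h.tc.exists_nbr hc (T := {t, v}) card_le_two
    have := ht r hr hcr
    grind
  have h2 : G.Adj c v := by
    obtain ⟨r, hr, hrT, hcr⟩ := h.tc.exists_nbr hc (T := {t, u}) card_le_two
    have := ht r hr hcr
    grind
  obtain ⟨p, hp, p1, p2, p3, p4⟩ := h.nt c hc u h.hu v h.hv h1 h2 h.huv t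
  have := ht p hp p4
  grind

/-- Two adjacent vertices `s` and `t` whose other neighbours lie in a small set cannot exist. -/
theorem Contr.false_of_pair (h : Contr G S u v) {s t x y z : V} (hs : s ∈ S) (ht : t ∈ S)
    (hyS : y ∈ S) (hzS : z ∈ S)
    (hNs : ∀ r ∈ S, G.Adj s r → r = t ∨ r = y ∨ r = z)
    (hNt : ∀ r ∈ S, G.Adj t r → r = s ∨ r = x ∨ r = y ∨ r = z ∨ (r = v ∧ x = u)) : False := by
  have nt := h.nt
  have tc := h.tc
  have hst : G.Adj s t := by
    obtain ⟨r, hr, hrT, hsr⟩ := tc.exists_nbr hs (T := {y, z}) card_le_two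
    have := hNs r hr hsr
    grind
  have hsy : G.Adj s y := by
    obtain ⟨r, hr, hrT, hsr⟩ := tc.exists_nbr hs (T := {t, z}) card_le_two
    have := hNs r hr hsr
    grind
  have hsz : G.Adj s z := by
    obtain ⟨r, hr, hrT, hsr⟩ := tc.exists_nbr hs (T := {t, y}) card_le_two
    have := hNs r hr hsr
    grind
  have hty : ¬ G.Adj t y := by
    intro hty
    obtain ⟨r, hr, h1, h2, h3, h4⟩ := nt s hs t ht y hyS hst hsy hty z
    have := hNs r hr h4
    grind
  have htz : ¬ G.Adj t z := by
    intro htz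
    obtain ⟨r, hr, h1, h2, h3, h4⟩ := nt s hs t ht z hzS hst hsz htz y
    have := hNs r hr h4
    grind
  obtain ⟨r, hr, hrT, htr⟩ := tc.exists_nbr ht (T := {s, x}) card_le_two
  have h1 := hNt r hr htr
  have hrv : r = v ∧ x = u := by grind
  obtain ⟨rfl, rfl⟩ := hrv
  have htu : G.Adj t x := by
    obtain ⟨p, hp, hpT, htp⟩ := tc.exists_nbr ht (T := {s, r}) card_le_two
    have := hNt p hp htp
    grind
  obtain ⟨p, hp, p1, p2, p3, p4⟩ := nt t ht x h.hu r hr htu htr h.huv s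
  have := hNt p hp p4
  grind

theorem Contr.false_of_two (h : Contr G S u v) {X W : Finset V} {x w : V}
    (hf : Front (con G v u) (S.erase v) X W) (hx : x ∈ X) (hw : w ∈ W)
    (huniq : ∀ y ∈ W, (con G v u).Adj x y → y = w) (hW2 : #W = 2) (huW : u ∉ W)
    (huX : u ∈ X → x = u) : False := by
  obtain ⟨hX, hW, hdis, h3, hUW⟩ := hf
  obtain ⟨y, z, hyz, hyx, hzx, rfl⟩ := exists_pair_of_erase h3 hx
  obtain ⟨w2, hw2⟩ : ∃ w2, W.erase w = {w2} := by
    rw [← card_eq_one, card_erase_of_mem hw, hW2]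
  have hWe : ∀ t, t ∈ W ↔ t = w ∨ t = w2 := by
    intro t
    have : t ∈ W.erase w ↔ t = w2 := by rw [hw2]; simp
    grind
  have hww2 : w2 ≠ w := by
    have : w2 ∈ W.erase w := by rw [hw2]; simp
    grind
  have huv' := h.huv.ne
  have hu := h.hu
  refine h.false_of_pair (s := w2) (t := w) (x := x) (y := y) (z := z)
    (mem_of_mem_erase (hW ((hWe w2).2 (by simp)))) (mem_of_mem_erase (hW hw))
    (mem_of_mem_erase (hX (by simp))) (mem_of_mem_erase (hX (by simp))) ?_ ?_
  · intro r hr hwr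
    have hr1 := hwr.ne
    by_cases hrv : r = v
    · subst hrv
      have h4 := Contr.adj_v (u := u) (by grind) hwr.symm
      have h5 := hUW u (by grind)
      grind
    · have h4 := Contr.adj_left (u := u) (v := v) hwr.symm
      have h5 := hUW r (by grind)
      grind
  · intro r hr hwr
    have hr1 := hwr.ne
    by_cases hrv : r = v
    · subst hrv
      have h4 := Contr.adj_v (u := u) (by grind) hwr.symm
      have h5 := hUW u (by grind)
      grind
    · have h4 := Contr.adj_left (u := u) (v := v) hwr.symm
      have h5 := hUW r (by grind)
      grind

theorem Contr.false_of_passed (h : Contr G S u v) {X W : Finset V} (hsw : Sw (con G v u) X W)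
    (hf : Front (con G v u) (S.erase v) X W) (hW2 : 2 ≤ #W) (huX : u ∉ X) (huW : u ∉ W) : False := by
  induction hsw with
  | nil X => simp at hW2
  | step X W x w hx hw hxw huniq h' ih =>
    by_cases hc : #W = 2
    · exact h.false_of_two hf hx hw huniq hc huW (by grind)
    · refine ih (hf.step hx hw huniq) (by rw [card_erase_of_mem hw]; omega) ?_ ?_
      all_goals clear ih; grind

theorem Contr.ne_of_slide (h : Contr G S u v) {X W : Finset V} {x w : V}
    (hf : Front (con G v u) (S.erase v) X W) (hx : x ∈ X) (hw : w ∈ W)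
    (huniq : ∀ y ∈ W, (con G v u).Adj x y → y = w)
    (hsw : Sw (con G v u) (insert w (X.erase x)) (W.erase w)) (hW2 : 2 ≤ #W) : x ≠ u := by
  rintro rfl
  have huW := hf.hdis x hx
  by_cases hc : #W = 2
  · exact h.false_of_two hf hx hw huniq hc huW (by grind)
  · exact h.false_of_passed hsw (hf.step hx hw huniq) (by rw [card_erase_of_mem hw]; omega)
      (by grind) (by grind)

/-- Both tracks of the strip that a sweep has passed so far. -/
structure Partial (G : SimpleGraph V) (S A B W : Finset V) (u v c a0 b0 a b n s : V) : Prop where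
  mem : ∀ x, x ∈ S ↔ x = u ∨ x = v ∨ x = c ∨ x ∈ A ∨ x ∈ B ∨ x ∈ W
  hA : ∀ x ∈ A, x ∉ B ∧ x ∉ W ∧ x ≠ u ∧ x ≠ v ∧ x ≠ c
  hB : ∀ x ∈ B, x ∉ W ∧ x ≠ u ∧ x ≠ v ∧ x ≠ c
  hW : ∀ x ∈ W, x ≠ u ∧ x ≠ v ∧ x ≠ c
  ne : u ≠ c ∧ v ≠ c
  connA : Conn G A
  connB : Conn G B
  ha0 : a0 ∈ A
  hb0 : b0 ∈ B
  ha : a ∈ A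
  hb : b ∈ B
  hca : G.Adj c a0
  hcb : G.Adj c b0
  hc : ∀ x ∈ S, G.Adj c x → x = a0 ∨ x = b0 ∨ x = u ∨ x = v
  hAW : ∀ x ∈ A, x ≠ a → ∀ w ∈ W, ¬ G.Adj x w
  hBW : ∀ x ∈ B, x ≠ b → ∀ w ∈ W, ¬ G.Adj x w
  mover : Mover G S A u v c a0 b0 n a
  hs : ∀ x ∈ A, G.Adj n x → x = a0 ∨ x = s
  hns : n = a → s = a0
  last : (∃ e ∈ A, e ≠ a ∧ Conn G (A.erase a) ∧ G.Adj a e ∧ (∀ x ∈ A, G.Adj a x → x = e) ∧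
      (∀ x ∈ B, G.Adj a x → x = b) ∧ (n ≠ a → Conn G ((A.erase a0).erase a))) ∨
    ∃ e ∈ B, e ≠ b ∧ b0 ≠ b ∧ Conn G (B.erase b) ∧ G.Adj b e ∧ (∀ x ∈ B, G.Adj b x → x = e) ∧
      ∀ x ∈ A, G.Adj b x → x = a

theorem Partial.step_left {A B W : Finset V} {c a0 b0 a b n s w : V}
    (h : Partial G S A B W u v c a0 b0 a b n s) (hw : w ∈ W) (haw : G.Adj a w)
    (huniq : ∀ y ∈ W, G.Adj a y → y = w) :
    Partial G S (insert w A) B (W.erase w) u v c a0 b0 w b n (if n = a then w else s) := by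
  obtain ⟨mem, hA, hB, hW, ne, connA, connB, ha0, hb0, ha, hb, hca, hcb, hc, hAW, hBW, hm, hs, hns, hl⟩
    := h
  obtain ⟨hn, hnm, hfm, hconn, hadj, hN⟩ := hm
  have e1 : (insert w A).erase w = A := by grind
  have e2 : ((insert w A).erase a0).erase w = A.erase a0 := by grind
  have e3 : (insert w A).erase a0 = insert w (A.erase a0) := by grind
  clear hl
  refine ⟨by grind, by grind, by grind, by grind, ne, connA.insert ha haw.symm, connB, by grind, hb0,
    by grind, hb, hca, hcb, hc, by grind, by grind, ⟨by grind, hnm, by grind, ?_, hadj, hN⟩, ?_,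
    by grind, Or.inl ⟨a, by grind, by grind, ?_, haw.symm, ?_, ?_, ?_⟩⟩
  · rw [e3]
    exact hconn.insert (a := a) (by grind) haw.symm
  · intro x hx hnx
    have h1 := hAW n hn
    have h2 := hs x
    grind
  · rw [e1]; exact connA
  · intro x hx hwx
    have h1 := hAW x
    have h2 := hwx.symm
    have h3 := hwx.ne
    grind
  · intro x hx hwx
    have h1 := hBW x hx
    have h2 := hwx.symm
    grind
  · rw [e2]; exact fun _ => hconn

theorem Partial.step_right {A B W : Finset V} {c a0 b0 a b n s w : V}
    (h : Partial G S A B W u v c a0 b0 a b n s) (hw : w ∈ W) (hbw : G.Adj b w)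
    (huniq : ∀ y ∈ W, G.Adj b y → y = w) :
    Partial G S A (insert w B) (W.erase w) u v c a0 b0 a w n s := by
  obtain ⟨mem, hA, hB, hW, ne, connA, connB, ha0, hb0, ha, hb, hca, hcb, hc, hAW, hBW, hm, hs, hns, hl⟩
    := h
  have e1 : (insert w B).erase w = B := by grind
  clear hl
  refine ⟨by grind, by grind, by grind, by grind, ne, connA, connB.insert hb hbw.symm, ha0, by grind,
    ha, by grind, hca, hcb, hc, by grind, by grind, hm, hs, hns,
    Or.inr ⟨b, by grind, by grind, by grind, ?_, hbw.symm, ?_, ?_⟩⟩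
  · rw [e1]; exact connB
  · intro x hx hwx
    have h1 := hBW x
    have h2 := hwx.symm
    have h3 := hwx.ne
    grind
  · intro x hx hwx
    have h1 := hAW x hx
    have h2 := hwx.symm
    grind

theorem Partial.minors {A B : Finset V} {c c' a0 b0 a b n s : V}
    (h : Partial G S A B {c'} u v c a0 b0 a b n s) (h' : Contr G S u v) : Minors G S := by
  obtain ⟨mem, hA, hB, hW, ne, connA, connB, ha0, hb0, ha, hb, hca, hcb, hc, hAW, hBW, hm, hs, hns, hl⟩
    := h
  have ⟨tc, nt, hu, hv, huv⟩ := h'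
  have hcS : c' ∈ S := (mem c').2 (by simp)
  have hWc := hW c' (by simp)
  have hcN : ∀ x ∈ S, G.Adj c' x → x = a ∨ x = b ∨ x = u ∨ x = v := by
    intro x hx hcx
    have h1 := (mem x).1 hx
    have h2 := hAW x
    have h3 := hBW x
    have h4 := hcx.symm
    have h5 := hc c' hcS
    have h6 := hA c'
    have h7 := hB c'
    have h8 := hcx.ne
    clear hl hm hs
    grind
  have hca' : G.Adj c' a := by
    by_contra hno
    exact h'.false_of_triangle (t := b) hcS fun x hx hcx => by have := hcN x hx hcx; grind
  have hcb' : G.Adj c' b := by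
    by_contra hno
    exact h'.false_of_triangle (t := a) hcS fun x hx hcx => by have := hcN x hx hcx; grind
  have hst : Strip G S A B u v c c' a0 b0 a b := by
    clear hl hm hs
    exact ⟨tc, nt, huv, by grind, by grind, by grind, by grind, connA, connB, ha0, hb0, ha, hb, hca, hcb,
      hca', hcb', hc, hcN⟩
  have hm0 := hm.hfm
  refine hst.minors hm hs hns ?_
  rcases hl with ⟨e, he, h1, h2, h3, h4, h5, h6⟩ | ⟨e, he, h1, h0, h2, h3, h4, h5⟩
  · left
    refine ⟨e, ⟨he, h1, by grind, h2, h3, ?_⟩, h6⟩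
    intro x hx hax
    have k1 := (mem x).1 hx
    have k2 := hc a (by grind)
    have k3 := hax.symm
    have k4 := hA a ha
    have k5 := h4 x
    have k6 := h5 x
    clear hs h4 h5 h6 hm
    grind
  · right
    refine ⟨e, ⟨he, h1, h0, h2, h3, ?_⟩⟩
    intro x hx hax
    have k1 := (mem x).1 hx
    have k2 := hc b (by grind)
    have k3 := hax.symm
    have k4 := hB b hb
    have k5 := h4 x
    have k6 := h5 x
    have k7 := hA b
    clear hs h4 h5 hm
    grind

end
end WidthThree

namespace WidthThree
open Finset
open scoped Classical
variable {V : Type*} {G : SimpleGraph V} {S : Finset V} {u v : V}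

theorem Partial.minors_of_sweep (h : Contr G S u v) {c a0 b0 n : V} {X W : Finset V}
    (hsw : Sw (con G v u) X W) : ∀ {A B : Finset V} {a b s : V}, X = {u, a, b} →
    Front (con G v u) (S.erase v) X W → Partial G S A B W u v c a0 b0 a b n s → 1 ≤ #W →
    Minors G S := by
  induction hsw with
  | nil X => intro _ _ _ _ _ _ _ _ h; simp at h
  | step X W x w hx hw hxw huniq hsw ih =>
    intro A B a b s hX hf hp hW1
    by_cases hc : #W = 1
    · obtain ⟨c', rfl⟩ := card_eq_one.1 hc
      exact hp.minors h
    have hxu := h.ne_of_slide hf hx hw huniq hsw (by omega)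
    have hcard : 1 ≤ #(W.erase w) := by rw [card_erase_of_mem hw]; omega
    have hWu : ∀ y ∈ W, y ≠ u := fun y hy => (hp.hW y hy).1
    have hxw' := (Contr.adj_of_ne hxu (hWu w hw)).1 hxw
    have huniq' : ∀ y ∈ W, G.Adj x y → y = w := fun y hy hxy => huniq y hy (Contr.adj_left hxy)
    have hf' := hf.step hx hw huniq
    have ha := hp.hA a hp.ha
    have hb := hp.hB b hp.hb
    have hb' := hp.hb
    have hx' : x = a ∨ x = b := by
      rw [hX] at hx
      simp only [mem_insert, mem_singleton] at hx
      tauto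
    have hab : a ≠ b := fun e => ha.1 (e ▸ hb')
    rcases hx' with rfl | rfl
    · refine ih ?_ hf' (hp.step_left hw hxw' huniq') hcard
      clear ih hf hp huniq huniq' hf'
      subst hX
      ext t
      grind
    · refine ih ?_ hf' (hp.step_right hw hxw' huniq') hcard
      clear ih hf hp huniq huniq' hf'
      subst hX
      ext t
      grind

theorem Contr.minors (h : Contr G S u v) (h7 : 7 ≤ #S)
    (hs : Sweepable (con G v u) (S.erase v)) : Minors G S := by
  obtain ⟨X0, hX0, h3, hsw⟩ := hs
  have hW0 : 3 ≤ #(S.erase v \ X0) := by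
    rw [card_sdiff_of_subset hX0, card_erase_of_mem h.hv]
    omega
  have hf0 : Front (con G v u) (S.erase v) X0 (S.erase v \ X0) :=
    ⟨hX0, sdiff_subset, by grind, h3, by grind⟩
  have hmem0 : ∀ r ∈ S.erase v, r ∈ X0 ∨ r ∈ S.erase v \ X0 := by grind
  generalize S.erase v \ X0 = W0 at *
  cases hsw with
  | nil => simp at hW0
  | step _ _ c w0 hcX hw0 hcw huniq0 hsw =>
  have hf := hf0.step hcX hw0 huniq0
  have hmem : ∀ r ∈ S.erase v, r = c ∨ r ∈ insert w0 (X0.erase c) ∨ r ∈ W0.erase w0 := by grind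
  have hW : 2 ≤ #(W0.erase w0) := by rw [card_erase_of_mem hw0]; omega
  have hcX' : c ∉ insert w0 (X0.erase c) := by
    have := hf0.hdis c hcX
    grind
  have hcW : c ∉ W0.erase w0 := by
    have := hf0.hdis c hcX
    grind
  have hcSv : c ∈ S.erase v := hX0 hcX
  clear huniq0 hcw hmem0 hf0 hcX hX0 h3
  generalize insert w0 (X0.erase c) = X at *
  generalize W0.erase w0 = W at *
  clear hW0 hw0
  have hcS := mem_of_mem_erase hcSv
  have huS : u ∈ S.erase v := mem_erase.2 ⟨h.huv.ne, h.hu⟩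
  have hcW' := hf.hUW c hcSv hcX' hcW
  have hXS : ∀ x ∈ X, x ∈ S := fun x hx => mem_of_mem_erase (hf.hX hx)
  by_cases huc : u = c
  · subst huc
    exact (h.false_of_passed hsw hf hW hcX' hcW).elim
  have hNc : ∀ r ∈ S, G.Adj c r → r ∈ X ∨ (r = v ∧ u ∈ X) := by
    intro r hr hcr
    by_cases hrv : r = v
    · subst hrv
      have h1 := (Contr.adj_v (Ne.symm huc) hcr.symm).symm
      have h2 := hmem u huS
      grind
    · have h1 := Contr.adj_left (u := u) (v := v) hcr
      have h2 := hmem r (mem_erase.2 ⟨hrv, hr⟩)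
      have h3 := hcr.ne
      grind
  cases hsw with
  | nil => simp at hW
  | step _ _ x w hx hw hxw huniq hsw =>
  have hwX : w ∉ X := fun hwX => hf.hdis w hwX hw
  have hxW := hf.hdis x hx
  have hNx : ∀ r ∈ S, G.Adj x r → r = c ∨ r ∈ X ∨ r = w ∨ (r = v ∧ (u ∈ W → u = w)) := by
    intro r hr hxr
    by_cases hrv : r = v
    · subst hrv
      refine Or.inr (Or.inr (Or.inr ⟨rfl, fun hu => ?_⟩))
      exact huniq u hu (Contr.adj_v (by grind) hxr.symm).symm
    · have h2 := hmem r (mem_erase.2 ⟨hrv, hr⟩)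
      have h3 : r ∈ W → r = w := fun hrW => huniq r hrW (Contr.adj_left hxr)
      grind
  by_cases huW : u ∈ W
  · have huX : u ∉ X := fun huX => hf.hdis u huX huW
    obtain ⟨y, z, hyz, hyx, hzx, hXe⟩ := exists_pair_of_erase hf.h3 hx
    have hXm : ∀ t, t ∈ X ↔ t = x ∨ t = y ∨ t = z := by rw [hXe]; simp
    refine (h.false_of_pair (s := c) (t := x) (x := w) (y := y) (z := z) hcS (hXS x hx)
      (hXS y ((hXm y).2 (by simp))) (hXS z ((hXm z).2 (by simp))) ?_ ?_).elim
    · intro r hr hcr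
      have h1 := hNc r hr hcr
      rw [hXm] at h1
      grind
    · intro r hr hxr
      have h1 := hNx r hr hxr
      have h2 := hxr.ne
      rw [hXm] at h1
      grind
  have huX : u ∈ X := by
    have := hmem u huS
    grind
  have hxu := h.ne_of_slide hf hx hw huniq hsw hW
  have hwu : w ≠ u := fun e => huW (e ▸ hw)
  obtain ⟨b0, hb0x, hb0u, hXm⟩ : ∃ b0, b0 ≠ x ∧ b0 ≠ u ∧ ∀ t, t ∈ X ↔ t = u ∨ t = x ∨ t = b0 := by
    obtain ⟨y, z, hyz, hyx, hzx, hXe⟩ := exists_pair_of_erase hf.h3 hx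
    have hXm : ∀ t, t ∈ X ↔ t = x ∨ t = y ∨ t = z := by rw [hXe]; simp
    rcases (hXm u).1 huX with h1 | h1 | h1
    · exact absurd h1.symm hxu
    · exact ⟨z, hzx, by grind, fun t => by rw [hXm]; grind⟩
    · exact ⟨y, hyx, by grind, fun t => by rw [hXm]; grind⟩
  have hb0X : b0 ∈ X := (hXm b0).2 (by simp)
  have hb0W := hf.hdis b0 hb0X
  have hNc' : ∀ r ∈ S, G.Adj c r → r = x ∨ r = b0 ∨ r = u ∨ r = v := by
    intro r hr hcr
    have := hNc r hr hcr
    rw [hXm] at this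
    tauto
  have hcx : G.Adj c x := by
    by_contra hno
    exact h.false_of_triangle (t := b0) hcS fun r hr hcr => by
      have := hNc' r hr hcr
      grind
  have hcb : G.Adj c b0 := by
    by_contra hno
    exact h.false_of_triangle (t := x) hcS fun r hr hcr => by
      have := hNc' r hr hcr
      grind
  have hxw' := (Contr.adj_of_ne hxu hwu).1 hxw
  have hxw'' := hxw'.ne
  have hvX : v ∉ X := fun hv => by have := hf.hX hv; simp at this
  have hvW : v ∉ W := fun hv => by have := hf.hW hv; simp at this
  have hcv : c ≠ v := (mem_erase.1 hcSv).1
  have hcases : ∀ t, t ∈ S ↔ t = u ∨ t = v ∨ t = c ∨ t = x ∨ t = b0 ∨ t ∈ W := by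
    intro t
    constructor
    · intro ht
      by_cases htv : t = v
      · exact Or.inr (Or.inl htv)
      · have := hmem t (mem_erase.2 ⟨htv, ht⟩)
        rw [hXm] at this
        tauto
    · have h1 := hXS t
      rw [hXm] at h1
      have h2 := h.hu
      have h3 := h.hv
      have h4 : t ∈ W → t ∈ S := fun ht => mem_of_mem_erase (hf.hW ht)
      rintro (rfl | rfl | rfl | rfl | rfl | ht)
      · exact h2
      · exact h3
      · exact hcS
      · exact hXS _ hx
      · exact hXS _ hb0X
      · exact h4 ht
  have hv := h.hv
  have hN : ∀ r ∈ S, G.Adj x r → r = c ∨ r = u ∨ r = v ∨ r = b0 ∨ r = w := by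
    intro r hr hxr
    have h1 := hNx r hr hxr
    have h2 := hxr.ne
    rw [hXm] at h1
    tauto
  have huv := h.huv.ne
  have hP : Partial G S {x, w} {b0} (W.erase w) u v c x b0 w b0 w x := by
    have hxv : x ≠ v := fun e => hvX (e ▸ hx)
    have hbv : b0 ≠ v := fun e => hvX (e ▸ hb0X)
    have hxc : x ≠ c := fun e => hcX' (e ▸ hx)
    have hbc : b0 ≠ c := fun e => hcX' (e ▸ hb0X)
    have hxW' : ∀ y ∈ W, G.Adj x y → y = w := fun y hy hxy => huniq y hy (Contr.adj_left hxy)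
    clear huniq hmem hNx hNc hXS hcW'
    refine ⟨by grind, by grind, by grind, by grind, by grind, ?_, conn_singleton _, by simp, by simp,
      by simp, by simp, hcx, hcb, hNc', by grind, by grind, ?_, ?_, by simp, Or.inl ⟨x, by simp, hxw'',
      ?_, hxw'.symm, ?_, ?_, by simp⟩⟩
    · exact (conn_singleton w).insert (by simp) hxw'
    · have e : ({x, w} : Finset V).erase x = {w} := by grind
      exact ⟨by simp, hxw''.symm, hxw''.symm, by rw [e]; exact conn_singleton w, hxw', hN⟩
    · intro y hy hwy
      have := hwy.ne
      grind
    · have e : ({x, w} : Finset V).erase w = {x} := by grind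
      rw [e]; exact conn_singleton x
    · intro y hy hwy
      have := hwy.ne
      grind
    · simp
  refine Partial.minors_of_sweep h hsw (a := w) (b := b0) ?_ (hf.step hx hw huniq) hP ?_
  · ext t
    have := hXm t
    clear hP hsw hmem hNx hNc hcases hN hNc' huniq
    grind
  · rw [card_erase_of_mem hw]; omega

end WidthThree

namespace WidthThree
open Finset
open scoped Classical
variable {V : Type*} {G : SimpleGraph V} {S : Finset V}

theorem TC.sweepable_of_card_four (h : TC G S) (h4 : #S = 4) : Sweepable G S := by
  obtain ⟨w, hw⟩ := card_pos.1 (by omega : 0 < #S)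
  obtain ⟨x, hx, -, hwx⟩ := h.exists_nbr hw (T := ∅) (by simp)
  have e : S \ S.erase w = {w} := by grind
  refine ⟨S.erase w, erase_subset _ _, by rw [card_erase_of_mem hw, h4], ?_⟩
  rw [e]
  refine Sw.step _ _ x w (mem_erase.2 ⟨hwx.ne.symm, hx⟩) (by simp) hwx.symm (by simp) ?_
  simpa using Sw.nil _

theorem exists_insert_of_card {T : Finset V} {n : ℕ} (h : #T = n + 1) :
    ∃ a T', a ∉ T' ∧ #T' = n ∧ ∀ t, t ∈ T ↔ t = a ∨ t ∈ T' := by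
  obtain ⟨a, T', h1, rfl, h2⟩ := card_eq_succ.1 h
  exact ⟨a, T', h1, h2, by simp⟩

theorem exists_three_of_card {T : Finset V} (h : #T = 3) :
    ∃ a b c, a ≠ b ∧ a ≠ c ∧ b ≠ c ∧ ∀ t, t ∈ T ↔ t = a ∨ t = b ∨ t = c := by
  obtain ⟨a, b, c, h1, h2, h3, rfl⟩ := card_eq_three.1 h
  exact ⟨a, b, c, h1, h2, h3, by simp⟩

theorem TC.of_card_five (h : TC G S) (h5 : #S = 5) : Sweepable G S ∨ Minors G S := by
  by_cases hK : ∀ x ∈ S, ∀ y ∈ S, x ≠ y → G.Adj x y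
  · right
    obtain ⟨a, T, haT, hT, hm⟩ := exists_insert_of_card h5
    obtain ⟨b, T', hbT', hT', hm'⟩ := exists_insert_of_card hT
    obtain ⟨c, d, e, h1, h2, h3, hm''⟩ := exists_three_of_card hT'
    have hadj : ∀ x ∈ S, ∀ y ∈ S, x ≠ y → Touch G {x} {y} := fun x hx y hy hxy =>
      ⟨x, by simp, y, by simp, hK x hx y hy hxy⟩
    have hS : ∀ t, t ∈ S ↔ t = a ∨ t = b ∨ t = c ∨ t = d ∨ t = e := by grind
    have hne : a ≠ b ∧ a ≠ c ∧ a ≠ d ∧ a ≠ e ∧ b ≠ c ∧ b ≠ d ∧ b ≠ e := by grind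
    have ha := (hS a).2 (by simp)
    have hb := (hS b).2 (by simp)
    have hc := (hS c).2 (by simp)
    have hd := (hS d).2 (by simp)
    have he := (hS e).2 (by simp)
    obtain ⟨k1, k2, k3, k4, k5, k6, k7⟩ := hne
    refine minors_K5 (A0 := {a}) (A1 := {b}) (A2 := {c}) (A3 := {d}) (A4 := {e}) ?_ ?_
      (hadj a ha b hb k1) (hadj a ha c hc k2) (hadj a ha d hd k3) (hadj a ha e he k4)
      (hadj b hb c hc k5) (hadj b hb d hd k6) (hadj b hb e he k7) (hadj c hc d hd h1)
      (hadj c hc e he h2) (hadj d hd e he h3)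
    · simp [conn_singleton, ha, hb, hc, hd, he]
    · simp [h1, h2, h3, k1, k2, k3, k4, k5, k6, k7]
  · left
    push Not at hK
    obtain ⟨x, hx, y, hy, hxy, hno⟩ := hK
    have hc : #((S.erase x).erase y) = 3 := by
      rw [card_erase_of_mem (by grind), card_erase_of_mem hx, h5]
    obtain ⟨r, s, t, h1, h2, h3, hm⟩ := exists_three_of_card hc
    have hr := (hm r).2 (by simp)
    have hs := (hm s).2 (by simp)
    have ht := (hm t).2 (by simp)
    simp only [mem_erase] at hm hr hs ht
    have hS : ∀ z, z ∈ S ↔ z = x ∨ z = y ∨ z = r ∨ z = s ∨ z = t := by grind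
    have hne : x ≠ r ∧ x ≠ s ∧ x ≠ t ∧ y ≠ r ∧ y ≠ s ∧ y ≠ t := by grind
    have hxr : G.Adj x r := by
      obtain ⟨z, hz, hzT, hxz⟩ := h.exists_nbr hx (T := {s, t}) card_le_two
      have := hxz.ne
      grind
    have hyr : G.Adj y r := by
      obtain ⟨z, hz, hzT, hxz⟩ := h.exists_nbr hy (T := {s, t}) card_le_two
      have := hxz.ne
      have := hxz.symm
      grind
    have e1 : S \ {x, s, t} = {y, r} := by grind
    have e2 : ({y, r} : Finset V).erase r = {y} := by grind
    refine ⟨{x, s, t}, by grind, by rw [card_eq_three]; grind, ?_⟩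
    rw [e1]
    refine Sw.step _ _ x r (by simp) (by simp) hxr (by grind) ?_
    rw [e2]
    refine Sw.step _ _ r y (by simp) (by simp) hyr.symm (by simp) ?_
    simpa using Sw.nil _

theorem TC.minors_of_card_six (h : TC G S) (hnt : NT G S) (h6 : #S = 6) : Minors G S := by
  by_cases hdeg : ∀ c ∈ S, ∀ y ∈ S, ∀ z ∈ S, y ≠ z → y ≠ c → z ≠ c → G.Adj c y ∨ G.Adj c z
  · have key : ∀ T ⊆ S, 2 ≤ #T →
        ∃ a ∈ T, ∃ b ∈ T, a ≠ b ∧ ∀ r ∈ T, r ≠ a → r ≠ b → G.Adj a r ∧ G.Adj b r := by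
      intro T hT hT2
      by_cases hK : ∀ x ∈ T, ∀ y ∈ T, x ≠ y → G.Adj x y
      · obtain ⟨a, ha, b, hb, hab⟩ := one_lt_card.1 (by omega : 1 < #T)
        exact ⟨a, ha, b, hb, hab, fun r hr h1 h2 => ⟨hK a ha r hr h1.symm, hK b hb r hr h2.symm⟩⟩
      · push Not at hK
        obtain ⟨a, ha, b, hb, hab, hno⟩ := hK
        refine ⟨a, ha, b, hb, hab, fun r hr h1 h2 => ⟨?_, ?_⟩⟩
        · exact (hdeg a (hT ha) r (hT hr) b (hT hb) h2 h1 hab.symm).resolve_right hno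
        · exact (hdeg b (hT hb) r (hT hr) a (hT ha) h1 h2 hab).resolve_right (fun h => hno h.symm)
    obtain ⟨a, ha, b, hb, hab, hab'⟩ := key S subset_rfl (by omega)
    have hc4 : #((S.erase a).erase b) = 4 := by
      rw [card_erase_of_mem (by grind), card_erase_of_mem ha, h6]
    obtain ⟨c, hc, d, hd, hcd, hcd'⟩ := key ((S.erase a).erase b) (by grind) (by omega)
    have hc2 : #((((S.erase a).erase b).erase c).erase d) = 2 := by
      rw [card_erase_of_mem (by grind), card_erase_of_mem hc, hc4]
    obtain ⟨e, f, hef, hm⟩ := card_eq_two.1 hc2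
    have hm' : ∀ t, t ∈ (((S.erase a).erase b).erase c).erase d ↔ t = e ∨ t = f := by
      rw [hm]; simp
    have he := (hm' e).2 (by simp)
    have hf := (hm' f).2 (by simp)
    simp only [mem_erase] at hc hd he hf hcd'
    clear hm hm' key hdeg
    refine minors_O (A0 := {c}) (A1 := {e}) (A2 := {d}) (A3 := {f}) (P := {a}) (Q := {b}) ?_ ?_
      ⟨c, by simp, e, by simp, ?_⟩ ⟨e, by simp, d, by simp, ?_⟩ ⟨d, by simp, f, by simp, ?_⟩
      ⟨c, by simp, f, by simp, ?_⟩ ⟨c, by simp, a, by simp, ?_⟩ ⟨e, by simp, a, by simp, ?_⟩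
      ⟨d, by simp, a, by simp, ?_⟩ ⟨f, by simp, a, by simp, ?_⟩ ⟨c, by simp, b, by simp, ?_⟩
      ⟨e, by simp, b, by simp, ?_⟩ ⟨d, by simp, b, by simp, ?_⟩ ⟨f, by simp, b, by simp, ?_⟩
    · simp [conn_singleton, ha, hb, hc, hd, he, hf]
    · simp only [List.pairwise_cons, List.forall_mem_cons, Finset.disjoint_singleton,
        List.Pairwise.nil, List.not_mem_nil, IsEmpty.forall_iff, implies_true, and_true]
      grind
    · exact (hcd' e (by grind) (by grind) (by grind)).1
    · exact (hcd' e (by grind) (by grind) (by grind)).2.symm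
    · exact (hcd' f (by grind) (by grind) (by grind)).2
    · exact (hcd' f (by grind) (by grind) (by grind)).1
    · exact (hab' c (by grind) (by grind) (by grind)).1.symm
    · exact (hab' e (by grind) (by grind) (by grind)).1.symm
    · exact (hab' d (by grind) (by grind) (by grind)).1.symm
    · exact (hab' f (by grind) (by grind) (by grind)).1.symm
    · exact (hab' c (by grind) (by grind) (by grind)).2.symm
    · exact (hab' e (by grind) (by grind) (by grind)).2.symm
    · exact (hab' d (by grind) (by grind) (by grind)).2.symm
    · exact (hab' f (by grind) (by grind) (by grind)).2.symm
  · push Not at hdeg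
    obtain ⟨c, hc, y, hy, z, hz, hyz, hyc, hzc, hcy, hcz⟩ := hdeg
    have h3 : #(((S.erase c).erase y).erase z) = 3 := by
      rw [card_erase_of_mem (by grind), card_erase_of_mem (by grind), card_erase_of_mem hc, h6]
    obtain ⟨x1, x2, x3, h12, h13, h23, hm⟩ := exists_three_of_card h3
    have h1 := (hm x1).2 (by simp)
    have h2 := (hm x2).2 (by simp)
    have h3 := (hm x3).2 (by simp)
    simp only [mem_erase] at h1 h2 h3 hm
    have hNc : ∀ r ∈ S, G.Adj c r → r = x1 ∨ r = x2 ∨ r = x3 := by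
      intro r hr hcr
      have := hcr.ne
      have := hm r
      grind
    have hcase : ∀ r ∈ S, r = c ∨ r = y ∨ r = z ∨ r = x1 ∨ r = x2 ∨ r = x3 := by grind
    have hc1 : G.Adj c x1 := by
      obtain ⟨r, hr, hrT, hcr⟩ := h.exists_nbr hc (T := {x2, x3}) card_le_two
      have := hNc r hr hcr
      grind
    have hc2 : G.Adj c x2 := by
      obtain ⟨r, hr, hrT, hcr⟩ := h.exists_nbr hc (T := {x1, x3}) card_le_two
      have := hNc r hr hcr
      grind
    have hc3 : G.Adj c x3 := by
      obtain ⟨r, hr, hrT, hcr⟩ := h.exists_nbr hc (T := {x1, x2}) card_le_two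
      have := hNc r hr hcr
      grind
    have n12 : ¬ G.Adj x1 x2 := fun hno => by
      obtain ⟨r, hr, k1, k2, k3, k4⟩ := hnt c hc x1 h1.2.2.2 x2 h2.2.2.2 hc1 hc2 hno x3
      have := hNc r hr k4
      grind
    have n13 : ¬ G.Adj x1 x3 := fun hno => by
      obtain ⟨r, hr, k1, k2, k3, k4⟩ := hnt c hc x1 h1.2.2.2 x3 h3.2.2.2 hc1 hc3 hno x2
      have := hNc r hr k4
      grind
    have n23 : ¬ G.Adj x2 x3 := fun hno => by
      obtain ⟨r, hr, k1, k2, k3, k4⟩ := hnt c hc x2 h2.2.2.2 x3 h3.2.2.2 hc2 hc3 hno x1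
      have := hNc r hr k4
      grind
    have n21 := fun hno : G.Adj x2 x1 => n12 hno.symm
    have n31 := fun hno : G.Adj x3 x1 => n13 hno.symm
    have n32 := fun hno : G.Adj x3 x2 => n23 hno.symm
    have hy' : ∀ x ∈ S, (x = x1 ∨ x = x2 ∨ x = x3) → G.Adj y x := by
      intro x hx hx'
      obtain ⟨r, hr, hrT, hxr⟩ := h.exists_nbr hx (T := {c, z}) card_le_two
      have := hcase r hr
      have := hxr.symm
      have := hxr.ne
      clear hm hcase hNc
      grind
    have hz' : ∀ x ∈ S, (x = x1 ∨ x = x2 ∨ x = x3) → G.Adj z x := by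
      intro x hx hx'
      obtain ⟨r, hr, hrT, hxr⟩ := h.exists_nbr hx (T := {c, y}) card_le_two
      have := hcase r hr
      have := hxr.symm
      have := hxr.ne
      clear hm hcase hNc
      grind
    refine minors_K33 (A0 := {c}) (A1 := {y}) (A2 := {z}) (B0 := {x1}) (B1 := {x2}) (B2 := {x3})
      ?_ ?_ ⟨c, by simp, x1, by simp, hc1⟩ ⟨c, by simp, x2, by simp, hc2⟩ ⟨c, by simp, x3, by simp, hc3⟩
      ⟨y, by simp, x1, by simp, hy' x1 (by grind) (by simp)⟩
      ⟨y, by simp, x2, by simp, hy' x2 (by grind) (by simp)⟩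
      ⟨y, by simp, x3, by simp, hy' x3 (by grind) (by simp)⟩
      ⟨z, by simp, x1, by simp, hz' x1 (by grind) (by simp)⟩
      ⟨z, by simp, x2, by simp, hz' x2 (by grind) (by simp)⟩
      ⟨z, by simp, x3, by simp, hz' x3 (by grind) (by simp)⟩
    · simp [conn_singleton, hc, hy, hz, h1, h2, h3]
    · simp only [List.pairwise_cons, List.forall_mem_cons, Finset.disjoint_singleton,
        List.Pairwise.nil, List.not_mem_nil, IsEmpty.forall_iff, implies_true, and_true]
      clear hm hcase hNc hy' hz'
      grind

/-- A 3-connected graph without any of the five minors can be swept by a front of three vertices. -/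
theorem TC.sweepable_or_minors (n : ℕ) : ∀ (G : SimpleGraph V) (S : Finset V), #S = n → TC G S →
    Sweepable G S ∨ Minors G S := by
  induction n using Nat.strong_induction_on with
  | _ n ih =>
    intro G S hn h
    by_cases h4 : #S = 4
    · exact Or.inl (h.sweepable_of_card_four h4)
    by_cases h5 : #S = 5
    · exact h.of_card_five h5
    have h6 : 6 ≤ #S := by have := h.1; omega
    by_cases hnt : NT G S
    · by_cases h6' : #S = 6
      · exact Or.inr (h.minors_of_card_six hnt h6')
      obtain ⟨c, hc, p, hp, hcp, htc⟩ := h.exists_contractible (by omega)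
      rcases ih (#(S.erase c)) (by rw [card_erase_of_mem hc]; omega) _ _ rfl htc with hs | hm
      · exact Or.inr (Contr.minors ⟨h, hnt, hp, hc, hcp.symm⟩ (by omega) hs)
      · exact Or.inr (hm.of_con hc hcp)
    · unfold NT at hnt
      push Not at hnt
      obtain ⟨c, hc, y1, hy1, y2, hy2, hcy1, hcy2, h12, p, hp⟩ := hnt
      obtain ⟨q, hq, hqT, hcq⟩ := h.exists_nbr hc (T := {y1, y2}) card_le_two
      have hqp : q = p := by
        have := hp q hq
        grind
      subst hqp
      have hcN : ∀ x ∈ S, G.Adj c x ↔ x ∈ ({q, y1, y2} : Finset V) := by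
        intro x hx
        have := hp x hx
        simp only [mem_insert, mem_singleton]
        constructor
        · tauto
        · rintro (rfl | rfl | rfl) <;> assumption
      have htc := h.con_of_triangle (by omega) hc hq hy1 hy2 hcN h12
      rcases ih (#(S.erase c)) (by rw [card_erase_of_mem hc]; omega) _ _ rfl htc with hs | hm
      · exact h.sweep_of_triangle hc hq hy1 hy2 (by grind) (by grind) hcN h12 hs
      · exact Or.inr (hm.of_con hc hcq)

end WidthThree

namespace WidthThree
open Finset
open scoped Classical

variable {G : Multigraph}

/-- The simple graph underlying a multigraph. -/
def underlying (G : Multigraph) : SimpleGraph G.V where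
  Adj a b := a ≠ b ∧ G.Adj a b
  symm := ⟨fun a b h => ⟨h.1.symm, by
    obtain ⟨e, he, h | h⟩ := h.2
    · exact ⟨e, he, Or.inr h⟩
    · exact ⟨e, he, Or.inl h⟩⟩⟩
  loopless := ⟨fun _ h => h.1 rfl⟩

theorem Conn.connectedWithin {B : Finset G.V} (h : Conn (underlying G) B) :
    G.ConnectedWithin (B : Set G.V) := by
  refine ⟨by simpa using h.1, fun a ha b hb => ?_⟩
  by_contra hab
  obtain ⟨x, hx, hxZ, y, hy, hyZ, hxy⟩ := h.touch_compl
    (Z := B.filter fun x => Relation.ReflTransGen (G.stepWithin (B : Set G.V)) a x) (a := a) (b := b)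
    ha (mem_filter.2 ⟨ha, Relation.ReflTransGen.refl⟩) hb (by simp [hab])
  exact hyZ (mem_filter.2 ⟨hy, (mem_filter.1 hxZ).2.tail ⟨hx, hy, hxy.2⟩⟩)

theorem tc_of_threeConnected (h : G.ThreeConnected) : TC (underlying G) univ := by
  refine ⟨h.1, ?_⟩
  rintro M - ⟨m, hm⟩ ⟨x, -, hxM, hxN⟩
  by_contra hlt
  have hc := h.2 (nbr (underlying G) univ M) (by rw [Set.ncard_coe_finset]; omega)
  have hr := hc.2 m (by simp [mem_nbr, hm]) x (by simpa using hxN)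
  refine hxM ?_
  clear hxM hxN
  induction hr with
  | refl => exact hm
  | tail _ hst ih =>
    by_contra hno
    refine hst.2.1 ?_
    simp only [mem_coe, mem_nbr]
    exact ⟨mem_univ _, hno, _, ih, fun e => hno (e ▸ ih), hst.2.2⟩

theorem mem_crossEdges_of_touch {A B : Finset G.V} (h : Touch (underlying G) A B) :
    ∃ e, e ∈ G.crossEdges A B := by
  obtain ⟨a, ha, b, hb, -, e, -, h⟩ := h
  refine ⟨e, ?_⟩
  simp only [Multigraph.crossEdges, Set.mem_ofPred_eq, mem_coe]
  rcases h with ⟨rfl, rfl⟩ | ⟨rfl, rfl⟩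
  · exact Or.inl ⟨ha, hb⟩
  · exact Or.inr ⟨hb, ha⟩

theorem hasMinor_of_isMinor {R : Multigraph} (hR : Function.Injective R.ends) {n : ℕ}
    {E : List (Fin n × Fin n)} (φ : R.V → Fin n) (hφ : Function.Injective φ)
    (hE : ∀ f, (φ (R.src f), φ (R.tgt f)) ∈ E ∨ (φ (R.tgt f), φ (R.src f)) ∈ E)
    (h : IsMinor (underlying G) univ E) : G.HasMinor R := by
  obtain ⟨B, h1, -, h3, h4⟩ := h
  refine ⟨fun v => B (φ v), fun v => (h1 _).connectedWithin, ?_, ?_⟩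
  · intro v w hvw
    rw [disjoint_coe]
    rcases lt_or_gt_of_ne (hφ.ne hvw) with h | h
    · exact h3 _ _ h
    · exact (h3 _ _ h).symm
  · intro v w hvw
    by_cases hne : {f : R.E | R.ends f = s(v, w)}.Nonempty
    · obtain ⟨f, hf⟩ := hne
      have hle : {f : R.E | R.ends f = s(v, w)}.ncard ≤ 1 := by
        rw [Set.ncard_le_one]
        intro a ha b hb
        exact hR (ha.trans hb.symm)
      have ht : Touch (underlying G) (B (φ v)) (B (φ w)) := by
        have hf' : s(R.src f, R.tgt f) = s(v, w) := hf
        rcases Sym2.eq_iff.1 hf' with ⟨rfl, rfl⟩ | ⟨rfl, rfl⟩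
        · exact (hE f).elim (h4 _) fun h => (h4 _ h).symm
        · exact (hE f).elim (fun h => (h4 _ h).symm) (h4 _)
      refine hle.trans ?_
      rw [Nat.one_le_iff_ne_zero, ← Nat.pos_iff_ne_zero, Set.ncard_pos]
      exact mem_crossEdges_of_touch ht
    · rw [Set.not_nonempty_iff_eq_empty.1 hne]
      simp

/-- The edge set `F` can be built up edge by edge through separations of order at most 3. -/
inductive Reach (G : Multigraph) : Set G.E → Prop
  | nil : Reach G ∅
  | step (F : Set G.E) (e : G.E) (h : Reach G F) (he : e ∉ F) (hs : G.sepOrder (insert e F) ≤ 3) :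
      Reach G (insert e F)

theorem Reach.chain {F : Set G.E} (h : Reach G F) (D : Finset G.E)
    (hD : ∀ F', F ⊆ F' → F' ⊆ F ∪ D → G.sepOrder F' ≤ 3) : Reach G (F ∪ D) := by
  induction D using Finset.induction_on with
  | empty => simpa using h
  | insert e D he ih =>
    have hF := ih fun F' h1 h2 => hD F' h1 (h2.trans (Set.union_subset_union_right _ (by simp)))
    have e1 : F ∪ ((Insert.insert e D : Finset G.E) : Set G.E) = Insert.insert e (F ∪ D) := by
      simp [Set.union_insert]
    by_cases heF : e ∈ F ∪ (D : Set G.E)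
    · rwa [e1, Set.insert_eq_of_mem heF]
    · rw [e1]
      refine Reach.step _ e hF heF (hD _ ?_ e1.ge)
      exact Set.subset_union_left.trans (Set.subset_insert _ _)

theorem Reach.of_between {F F1 : Set G.E} (h : Reach G F) (hF : F ⊆ F1)
    (hD : ∀ F', F ⊆ F' → F' ⊆ F1 → G.sepOrder F' ≤ 3) : Reach G F1 := by
  have e : F ∪ ((F1.toFinite.toFinset : Finset G.E) : Set G.E) = F1 := by simpa using hF
  rw [← e]
  exact h.chain _ (by rwa [e])

theorem Reach.exists_list {F : Set G.E} (h : Reach G F) :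
    ∃ l : List G.E, l.Nodup ∧ (∀ e, e ∈ l ↔ e ∈ F) ∧ ∀ ℓ, G.sepOrder {e | e ∈ l.take ℓ} ≤ 3 := by
  induction h with
  | nil => exact ⟨[], by simp, by simp, by simp [Multigraph.sepOrder, Multigraph.edgeVerts]⟩
  | step F e h he hs ih =>
    obtain ⟨l, h1, h2, h3⟩ := ih
    refine ⟨l ++ [e], ?_, ?_, ?_⟩
    · rw [← List.concat_eq_append]
      exact h1.concat (by rwa [h2])
    · intro x
      simp [h2, or_comm]
    · intro ℓ
      by_cases hℓ : ℓ ≤ l.length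
      · rw [List.take_append_of_le_length hℓ]
        exact h3 ℓ
      · rw [List.take_of_length_le (by simp; omega)]
        convert hs using 2
        ext x
        simp [h2, or_comm]

theorem Reach.widthLE (h : Reach G Set.univ) : G.WidthLE 3 := by
  obtain ⟨l, h1, h2, h3⟩ := h.exists_list
  have hall : ∀ e, e ∈ l := fun e => (h2 e).2 trivial
  have hlen : Fintype.card G.E = l.length := by
    have := Fintype.card_congr (List.Nodup.getEquivOfForallMemList l h1 hall)
    simpa using this.symm
  refine ⟨(finCongr hlen).trans (List.Nodup.getEquivOfForallMemList l h1 hall), fun ℓ => ?_⟩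
  convert h3 ℓ using 2
  ext e
  simp only [Set.mem_ofPred_eq, List.mem_take_iff_getElem]
  constructor
  · rintro ⟨i, rfl, hi⟩
    exact ⟨i, by have := i.2; omega, by simp⟩
  · rintro ⟨i, hi, rfl⟩
    exact ⟨⟨i, by omega⟩, by simp, by simp; omega⟩

theorem sepOrder_le_of_front {X W : Finset G.V} {F : Set G.E} (h3 : #X = 3)
    (h1 : ∀ e ∈ F, ∀ v, G.inc v e → v ∉ W) (h2 : ∀ v, v ∉ X → v ∉ W → ∀ e, G.inc v e → e ∈ F) :
    G.sepOrder F ≤ 3 := by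
  have hsub : G.edgeVerts F ∩ G.edgeVerts Fᶜ ⊆ (X : Set G.V) := by
    rintro v ⟨⟨e, he, hve⟩, e', he', hve'⟩
    by_contra hvX
    exact he' (h2 v hvX (h1 e he v hve) e' hve')
  have := Set.ncard_le_ncard hsub
  rwa [Set.ncard_coe_finset, h3] at this

/-- The edges without an end in `W`. -/
def avoid (G : Multigraph) (W : Finset G.V) : Set G.E := {e | ∀ v, G.inc v e → v ∉ W}

theorem inc_adj {a b : G.V} {e : G.E} (ha : G.inc a e) (hb : G.inc b e) (hab : a ≠ b) :
    (underlying G).Adj a b := by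
  refine ⟨hab, e, trivial, ?_⟩
  rcases ha with rfl | rfl <;> rcases hb with rfl | rfl <;> simp_all

theorem exists_inc_of_adj {a b : G.V} (h : (underlying G).Adj a b) : ∃ e, G.inc a e ∧ G.inc b e := by
  obtain ⟨-, e, -, ⟨rfl, rfl⟩ | ⟨rfl, rfl⟩⟩ := h
  · exact ⟨e, Or.inl rfl, Or.inr rfl⟩
  · exact ⟨e, Or.inr rfl, Or.inl rfl⟩

theorem edge_eq_of_inc (hs : G.Simple) {a b : G.V} {e f : G.E} (hab : a ≠ b) (hae : G.inc a e)
    (hbe : G.inc b e) (haf : G.inc a f) (hbf : G.inc b f) : e = f := by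
  apply hs.2
  simp only [Multigraph.ends, Sym2.eq_iff]
  unfold Multigraph.inc at *
  grind

theorem Sw.reach (hs : G.Simple) {X W : Finset G.V} (hsw : Sw (underlying G) X W) :
    Front (underlying G) univ X W → Reach G (avoid G W) → Reach G Set.univ := by
  induction hsw with
  | nil X =>
    intro _ h
    convert h
    ext e
    simp [avoid]
  | step X W x w hx hw hxw huniq _ ih =>
    intro hf hr
    have hf' := hf.step hx hw huniq
    refine ih hf' ?_
    clear ih
    obtain ⟨f, hxf, hwf⟩ := exists_inc_of_adj hxw
    have hmono : avoid G W ⊆ avoid G (W.erase w) := fun e he v hv hvW =>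
      he v hv (mem_of_mem_erase hvW)
    have hfa : f ∈ avoid G (W.erase w) := by
      intro v hv hvW
      have hvW' := mem_of_mem_erase hvW
      have hvw := ne_of_mem_erase hvW
      by_cases hvx : v = x
      · exact hf.hdis x hx (hvx ▸ hvW')
      · exact hvw (huniq v hvW' (inc_adj hxf hv (Ne.symm hvx)))
    have key : ∀ F', insert f (avoid G W) ⊆ F' → F' ⊆ avoid G (W.erase w) → G.sepOrder F' ≤ 3 := by
      intro F' h1 h2
      refine sepOrder_le_of_front hf'.h3 (W := W.erase w) (fun e he => h2 he) ?_
      intro v hvX hvW e hve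
      by_cases hef : e = f
      · exact h1 (Or.inl hef)
      refine h1 (Or.inr ?_)
      intro y hy hyW
      have hvW' : v ∉ W := by grind
      have hvy : v ≠ y := fun e => hvW' (e ▸ hyW)
      have hadj := inc_adj hve hy hvy
      by_cases hvx : v = x
      · subst hvx
        have hyw := huniq y hyW hadj
        subst hyw
        exact hef (edge_eq_of_inc hs hvy hve hy hxf hwf)
      · exact hf.hUW v (mem_univ _) (by grind) hvW' y hyW hadj
    have hff : f ∉ avoid G W := fun h => h w hwf hw
    have hins : insert f (avoid G W) ⊆ avoid G (W.erase w) := Set.insert_subset hfa hmono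
    exact (Reach.step _ f hr hff (key _ subset_rfl hins)).of_between hins key

theorem Sweepable.widthLE (hs : G.Simple) (h : Sweepable (underlying G) univ) : G.WidthLE 3 := by
  obtain ⟨X, hX, h3, hsw⟩ := h
  refine Reach.widthLE (hsw.reach hs ⟨hX, sdiff_subset, by grind, h3, by grind⟩ ?_)
  refine Reach.nil.of_between (Set.empty_subset _) fun F' _ h2 => ?_
  exact sepOrder_le_of_front h3 (W := univ \ X) (fun e he => h2 he) (by grind)

end WidthThree

namespace WidthThree
open Finset

/-- Whether every set of `k` edges of the listed graph, together with the already distributed edges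
with end masks `a` and `b`, is in a separation of order at least 4. -/
def allWide (n k : ℕ) : List (ℕ × ℕ) → ℕ → ℕ → ℕ → Bool
  | [], a, b, c => c != k || decide (4 ≤ #{v ∈ range n | a.testBit v && b.testBit v})
  | e :: E, a, b, c => allWide n k E (a ||| (2 ^ e.1 ||| 2 ^ e.2)) b (c + 1) &&
      allWide n k E a (b ||| (2 ^ e.1 ||| 2 ^ e.2)) c

theorem four_le_of_allWide {n k : ℕ} (P : ℕ × ℕ → Bool) (E : List (ℕ × ℕ)) :
    ∀ a b c, allWide n k E a b c → c + E.countP P = k →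
      4 ≤ #{v ∈ range n | (a.testBit v ∨ ∃ e ∈ E, P e ∧ (v = e.1 ∨ v = e.2)) ∧
        (b.testBit v ∨ ∃ e ∈ E, ¬ P e ∧ (v = e.1 ∨ v = e.2))} := by
  classical
  induction E with
  | nil =>
    intro a b c h hc
    simp only [List.countP_nil, add_zero] at hc
    subst hc
    simpa [allWide] using h
  | cons e E ih =>
    intro a b c h hc
    simp only [allWide, Bool.and_eq_true] at h
    by_cases hP : P e
    · refine (ih _ _ _ h.1 (by rw [List.countP_cons_of_pos hP] at hc; omega)).trans (card_le_card ?_)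
      intro v
      simp only [mem_filter, mem_range, List.exists_mem_cons_iff, hP, Nat.testBit_or, Bool.or_eq_true,
        Nat.testBit_two_pow, decide_eq_true_eq]
      grind
    · refine (ih _ _ _ h.2 (by rw [List.countP_cons_of_neg hP] at hc; omega)).trans (card_le_card ?_)
      intro v
      simp only [mem_filter, mem_range, List.exists_mem_cons_iff, hP, Nat.testBit_or, Bool.or_eq_true,
        Nat.testBit_two_pow, decide_eq_true_eq]
      grind

open scoped Classical

/-- The graph with edge list `E` admits no separation of order at most 3 with `k` edges on one
side. -/
def Wide {n : ℕ} (k : ℕ) (E : List (Fin n × Fin n)) : Prop :=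
  ∀ P : Fin n × Fin n → Prop, E.countP (fun e => decide (P e)) = k →
    4 ≤ #{v : Fin n | (∃ e ∈ E, P e ∧ (v = e.1 ∨ v = e.2)) ∧ ∃ e ∈ E, ¬ P e ∧ (v = e.1 ∨ v = e.2)}

theorem wide_of_allWide {n k : ℕ} {E : List (Fin n × Fin n)}
    (h : allWide n k (E.map fun e => (e.1.val, e.2.val)) 0 0 0) : Wide k E := by
  intro P hP
  let Q : ℕ × ℕ → Bool := fun q => decide (∃ e : Fin n × Fin n, q = (e.1.val, e.2.val) ∧ P e)
  have hQ : ∀ e : Fin n × Fin n, Q (e.1.val, e.2.val) = decide (P e) := by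
    intro e
    simp only [Q, Prod.mk.injEq, decide_eq_decide, ← Fin.ext_iff]
    constructor
    · rintro ⟨e', ⟨h1, h2⟩, h3⟩
      rwa [Prod.ext h1 h2]
    · exact fun h => ⟨e, ⟨rfl, rfl⟩, h⟩
  have h4 := four_le_of_allWide Q _ 0 0 0 h (by
    rw [List.countP_map, zero_add, ← hP]
    exact List.countP_congr fun e _ => by simp [hQ])
  refine h4.trans ?_
  rw [← card_map Fin.valEmbedding]
  refine card_le_card fun v => ?_
  simp only [mem_filter, mem_range, List.mem_map, mem_map, mem_univ, true_and, Nat.zero_testBit,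
    Bool.false_eq_true, false_or, Fin.valEmbedding_apply]
  rintro ⟨hv, ⟨_, ⟨e, he, rfl⟩, h1, h2⟩, _, ⟨e', he', rfl⟩, h1', h2'⟩
  rw [hQ] at h1 h1'
  exact ⟨⟨v, hv⟩, ⟨⟨e, he, by simpa using h1, by simpa [Fin.ext_iff] using h2⟩, e', he',
    by simpa using h1', by simpa [Fin.ext_iff] using h2'⟩, rfl⟩

theorem wide_eK33 : Wide 4 eK33 := wide_of_allWide (by decide +kernel)
theorem wide_eK5 : Wide 5 eK5 := wide_of_allWide (by decide +kernel)
theorem wide_eC : Wide 6 eC := wide_of_allWide (by decide +kernel)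
theorem wide_eH : Wide 6 eH := wide_of_allWide (by decide +kernel)
theorem wide_eO : Wide 6 eO := wide_of_allWide (by decide +kernel)

end WidthThree

namespace WidthThree
open Finset
open scoped Classical

variable {G : Multigraph}

theorem exists_boundary {U : Set G.V} (hU : G.ConnectedWithin U) {F : Set G.E} {x y : G.V}
    (hx : x ∈ U) (hy : y ∈ U) (hxF : x ∈ G.edgeVerts F) (hyF : y ∈ G.edgeVerts Fᶜ) :
    ∃ z ∈ U, z ∈ G.edgeVerts F ∩ G.edgeVerts Fᶜ := by
  by_contra! hno
  have key : y ∈ G.edgeVerts F := by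
    have hr := hU.2 x hx y hy
    clear hyF
    induction hr with
    | refl => exact hxF
    | @tail b c hr hst ih =>
      obtain ⟨hb, hc, e, -, he⟩ := hst
      have hbe : G.inc b e := by unfold Multigraph.inc; grind
      have hce : G.inc c e := by unfold Multigraph.inc; grind
      by_cases heF : e ∈ F
      · exact ⟨e, heF, hce⟩
      · exact (hno b hb ⟨ih hb, e, heF, hbe⟩).elim
  exact hno y hy ⟨key, hyF⟩

theorem exists_count_eq {a : ℕ → ℕ} {k N : ℕ} (h0 : a 0 = 0) (hN : k ≤ a N)
    (hstep : ∀ ℓ, a (ℓ + 1) ≤ a ℓ + 1) : ∃ ℓ, a ℓ = k := by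
  induction N with
  | zero => exact ⟨0, by omega⟩
  | succ N ih =>
    by_cases h : k ≤ a N
    · exact ih h
    · exact ⟨N + 1, by have := hstep N; omega⟩

theorem countP_le_one {α : Type*} {l : List α} (hl : l.Nodup) {p : α → Bool}
    (h : ∀ a ∈ l, ∀ b ∈ l, p a → p b → a = b) : l.countP p ≤ 1 := by
  rw [List.countP_eq_length_filter, ← List.toFinset_card_of_nodup (hl.filter p), card_le_one]
  intro a ha b hb
  simp only [List.mem_toFinset, List.mem_filter] at ha hb
  exact h a ha.1 b hb.1 ha.2 hb.2

theorem countP_le_add {α : Type*} (l : List α) {p q r : α → Bool}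
    (h : ∀ a, p a → q a ∨ r a) : l.countP p ≤ l.countP q + l.countP r := by
  induction l with
  | nil => simp
  | cons a l ih =>
    have := h a
    simp only [List.countP_cons]
    split_ifs <;> grind

/-- A graph of width at most 3 has no minor all of whose balanced separations have order at
least 4. -/
theorem not_widthLE_of_wide {n k : ℕ} {E : List (Fin n × Fin n)} (hE : Wide k E)
    (hlt : ∀ e ∈ E, e.1 < e.2) (hnd : E.Nodup) (hk : k ≤ E.length) {X : Fin n → Set G.V}
    (hX : ∀ i, G.ConnectedWithin (X i)) (hd : Pairwise fun i j => Disjoint (X i) (X j))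
    (hc : ∀ e ∈ E, (G.crossEdges (X e.1) (X e.2)).Nonempty) : ¬ G.WidthLE 3 := by
  rintro ⟨f, hf⟩
  have hmem : ∀ {i j x}, x ∈ X i → x ∈ X j → i = j := by
    intro i j x hi hj
    by_contra hij
    exact Set.disjoint_left.1 (hd hij) hi hj
  have hne : E ≠ [] := by
    rintro rfl
    have := hE (fun _ => True) (by simpa [eq_comm] using hk)
    simp at this
  obtain ⟨e₀, he₀⟩ := List.exists_mem_of_ne_nil E hne
  have : Nonempty G.E := ⟨(hc e₀ he₀).some⟩
  have : Nonempty G.V := ⟨(hX e₀.1).1.some⟩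
  choose! g hg using hc
  have hginj : ∀ e ∈ E, ∀ e' ∈ E, g e = g e' → e = e' := by
    intro e he e' he' hee
    have h1 := hg e he
    have h2 := hg e' he'
    rw [hee] at h1
    have l1 := hlt e he
    have l2 := hlt e' he'
    rcases h1 with ⟨a, b⟩ | ⟨a, b⟩ <;> rcases h2 with ⟨c, d⟩ | ⟨c, d⟩
    · exact Prod.ext (hmem a c) (hmem b d)
    · have := hmem a c
      have := hmem b d
      omega
    · have := hmem a c
      have := hmem b d
      omega
    · exact Prod.ext (hmem b d) (hmem a c)
  have hends : ∀ e ∈ E, ∀ v, (v = e.1 ∨ v = e.2) → ∃ x ∈ X v, G.inc x (g e) := by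
    rintro e he v (rfl | rfl)
    · rcases hg e he with ⟨a, b⟩ | ⟨a, b⟩
      · exact ⟨_, a, Or.inl rfl⟩
      · exact ⟨_, b, Or.inr rfl⟩
    · rcases hg e he with ⟨a, b⟩ | ⟨a, b⟩
      · exact ⟨_, b, Or.inr rfl⟩
      · exact ⟨_, a, Or.inl rfl⟩
  obtain ⟨ℓ, hℓ⟩ : ∃ ℓ : ℕ, E.countP (fun e => decide ((f.symm (g e) : ℕ) < ℓ)) = k := by
    refine exists_count_eq (N := Fintype.card G.E) (by simp) ?_ ?_
    · rwa [List.countP_eq_length.2 (by simp)]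
    · intro ℓ
      refine (countP_le_add E (q := fun e => decide ((f.symm (g e) : ℕ) < ℓ))
        (r := fun e => decide ((f.symm (g e) : ℕ) = ℓ)) ?_).trans (Nat.add_le_add_left ?_ _)
      · intro e
        simp only [decide_eq_true_eq]
        omega
      · refine countP_le_one hnd fun e he e' he' h1 h2 => hginj e he e' he' ?_
        simp only [decide_eq_true_eq] at h1 h2
        exact f.symm.injective (Fin.ext (h1.trans h2.symm))
  have h4 := hE (fun e => (f.symm (g e) : ℕ) < ℓ) (by convert hℓ)
  have h3 := hf ℓ
  set F : Set G.E := {e | ∃ i : Fin (Fintype.card G.E), f i = e ∧ (i : ℕ) < ℓ} with hF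
  have hFm : ∀ e, e ∈ F ↔ (f.symm e : ℕ) < ℓ := by
    intro e
    constructor
    · rintro ⟨i, rfl, hi⟩
      simpa using hi
    · exact fun h => ⟨f.symm e, by simp, h⟩
  have hb : ∀ v : Fin n, ((∃ e ∈ E, (f.symm (g e) : ℕ) < ℓ ∧ (v = e.1 ∨ v = e.2)) ∧
      ∃ e ∈ E, ¬ (f.symm (g e) : ℕ) < ℓ ∧ (v = e.1 ∨ v = e.2)) →
      ∃ z ∈ X v, z ∈ G.edgeVerts F ∩ G.edgeVerts Fᶜ := by
    rintro v ⟨⟨e, he, h1, h2⟩, e', he', h1', h2'⟩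
    obtain ⟨x, hx, hxe⟩ := hends e he v h2
    obtain ⟨y, hy, hye⟩ := hends e' he' v h2'
    exact exists_boundary (hX v) hx hy ⟨_, (hFm _).2 h1, hxe⟩ ⟨_, fun h => h1' ((hFm _).1 h), hye⟩
  choose! z hz using hb
  have hle : #{v : Fin n | (∃ e ∈ E, (f.symm (g e) : ℕ) < ℓ ∧ (v = e.1 ∨ v = e.2)) ∧
      ∃ e ∈ E, ¬ (f.symm (g e) : ℕ) < ℓ ∧ (v = e.1 ∨ v = e.2)} ≤ G.sepOrder F := by
    unfold Multigraph.sepOrder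
    rw [← Set.ncard_coe_finset]
    refine Set.ncard_le_ncard_of_injOn z ?_ ?_
    · intro v hv
      exact (hz v (by simpa using hv)).2
    · intro v hv w hw hvw
      have h1 := (hz v (by simpa using hv)).1
      have h2 := (hz w (by simpa using hw)).1
      rw [hvw] at h1
      exact hmem h1 h2
  have := h4.trans (le_of_eq_of_le (by congr) hle)
  omega

theorem not_hasMinor_of_widthLE {R : Multigraph} {n k : ℕ} {E : List (Fin n × Fin n)}
    (hE : Wide k E) (hlt : ∀ e ∈ E, e.1 < e.2) (hnd : E.Nodup) (hk : k ≤ E.length) (ψ : Fin n → R.V)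
    (hψ : Function.Injective ψ) (hR : ∀ e ∈ E, ∃ f, R.ends f = s(ψ e.1, ψ e.2)) (hw : G.WidthLE 3) :
    ¬ G.HasMinor R := by
  rintro ⟨X, h1, h2, h3⟩
  refine not_widthLE_of_wide hE hlt hnd hk (X := fun i => X (ψ i)) (fun i => h1 _)
    (fun i j hij => h2 (hψ.ne hij)) ?_ hw
  intro e he
  obtain ⟨f, hf⟩ := hR e he
  rw [← Set.ncard_pos]
  refine lt_of_lt_of_le ?_ (h3 _ _ (hψ.ne (hlt e he).ne))
  rw [Set.ncard_pos]
  exact ⟨f, hf⟩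

/-- The multigraph `R` is the simple graph with edge list `E`, up to renaming vertices. -/
structure Lists (R : Multigraph) {n : ℕ} (E : List (Fin n × Fin n)) (φ : R.V ≃ Fin n) : Prop where
  lt : ∀ e ∈ E, e.1 < e.2
  nodup : E.Nodup
  inj : Function.Injective R.ends
  ends_mem : ∀ f, (φ (R.src f), φ (R.tgt f)) ∈ E ∨ (φ (R.tgt f), φ (R.src f)) ∈ E
  exists_ends : ∀ e ∈ E, ∃ f, R.ends f = s(φ.symm e.1, φ.symm e.2)

theorem Lists.not_hasMinor {R : Multigraph} {n k : ℕ} {E : List (Fin n × Fin n)} {φ : R.V ≃ Fin n}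
    (h : Lists R E φ) (hE : Wide k E) (hk : k ≤ E.length) (hw : G.WidthLE 3) : ¬ G.HasMinor R :=
  not_hasMinor_of_widthLE hE h.lt h.nodup hk φ.symm φ.symm.injective h.exists_ends hw

theorem Lists.hasMinor {R : Multigraph} {n : ℕ} {E : List (Fin n × Fin n)} {φ : R.V ≃ Fin n}
    (h : Lists R E φ) (hm : IsMinor (underlying G) univ E) : G.HasMinor R :=
  hasMinor_of_isMinor h.inj φ φ.injective h.ends_mem hm

end WidthThree

namespace WidthThree
open Finset

theorem lists_K5 : Lists K5m eK5 (Equiv.refl (Fin 5)) where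
  lt := by decide
  nodup := by decide
  inj := show Function.Injective fun e : {p : Fin 5 × Fin 5 // p.1 < p.2} => s(e.1.1, e.1.2) by
    unfold Function.Injective; decide
  ends_mem := show ∀ f : {p : Fin 5 × Fin 5 // p.1 < p.2}, (f.1.1, f.1.2) ∈ eK5 ∨
    (f.1.2, f.1.1) ∈ eK5 by decide
  exists_ends := show ∀ e ∈ eK5, ∃ f : {p : Fin 5 × Fin 5 // p.1 < p.2},
    s(f.1.1, f.1.2) = s(e.1, e.2) by decide

theorem lists_H : Lists Hm eH (Equiv.refl (Fin 7)) where
  lt := by decide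
  nodup := by decide
  inj := show Function.Injective fun e : {p : Fin 7 × Fin 7 // p ∈ hEdgeList} => s(e.1.1, e.1.2) by
    unfold Function.Injective; decide +kernel
  ends_mem := show ∀ f : {p : Fin 7 × Fin 7 // p ∈ hEdgeList}, (f.1.1, f.1.2) ∈ eH ∨
    (f.1.2, f.1.1) ∈ eH by decide +kernel
  exists_ends := show ∀ e ∈ eH, ∃ f : {p : Fin 7 × Fin 7 // p ∈ hEdgeList},
    s(f.1.1, f.1.2) = s(e.1, e.2) by decide +kernel

theorem lists_K33 : Lists K33m eK33 (finSumFinEquiv : Fin 3 ⊕ Fin 3 ≃ Fin 6) where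
  lt := by decide
  nodup := by decide
  inj := show Function.Injective fun e : Fin 3 × Fin 3 =>
    (s(Sum.inl e.1, Sum.inr e.2) : Sym2 (Fin 3 ⊕ Fin 3)) by
    unfold Function.Injective; decide +kernel
  ends_mem := show ∀ f : Fin 3 × Fin 3,
    ((finSumFinEquiv (Sum.inl f.1 : Fin 3 ⊕ Fin 3) : Fin 6), finSumFinEquiv (Sum.inr f.2 : Fin 3 ⊕ Fin 3)) ∈ eK33 ∨
    (finSumFinEquiv (Sum.inr f.2 : Fin 3 ⊕ Fin 3), finSumFinEquiv (Sum.inl f.1 : Fin 3 ⊕ Fin 3)) ∈ eK33 by decide +kernel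
  exists_ends := show ∀ e ∈ eK33, ∃ f : Fin 3 × Fin 3,
    (s(Sum.inl f.1, Sum.inr f.2) : Sym2 (Fin 3 ⊕ Fin 3)) =
      s((finSumFinEquiv : Fin 3 ⊕ Fin 3 ≃ Fin 6).symm e.1, finSumFinEquiv.symm e.2) by decide +kernel

/-- Numbering of the vertices of the cube by parity class, antipodes differing by `4`. -/
def cubeEquiv : Fin 2 × Fin 2 × Fin 2 ≃ Fin 8 where
  toFun p := ![![![0, 7], ![6, 1]], ![![5, 2], ![3, 4]]] p.1 p.2.1 p.2.2
  invFun := ![(0,0,0), (0,1,1), (1,0,1), (1,1,0), (1,1,1), (1,0,0), (0,1,0), (0,0,1)]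
  left_inv := by unfold Function.LeftInverse; decide
  right_inv := by unfold Function.RightInverse Function.LeftInverse; decide

/-- Numbering of the vertices of the octahedron, with poles `4` and `5`. -/
def octaEquiv : Fin 3 × Fin 2 ≃ Fin 6 where
  toFun p := ![![0, 2], ![1, 3], ![4, 5]] p.1 p.2
  invFun := ![(0,0), (1,0), (0,1), (1,1), (2,0), (2,1)]
  left_inv := by unfold Function.LeftInverse; decide
  right_inv := by unfold Function.RightInverse Function.LeftInverse; decide

/-- The first end of an edge of the cube. -/
def cubeSrc (e : Fin 3 × Fin 2 × Fin 2) : Fin 2 × Fin 2 × Fin 2 :=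
  if e.1 = 0 then (0, e.2.1, e.2.2) else if e.1 = 1 then (e.2.1, 0, e.2.2)
    else (e.2.1, e.2.2, 0)

/-- The second end of an edge of the cube. -/
def cubeTgt (e : Fin 3 × Fin 2 × Fin 2) : Fin 2 × Fin 2 × Fin 2 :=
  if e.1 = 0 then (1, e.2.1, e.2.2) else if e.1 = 1 then (e.2.1, 1, e.2.2)
    else (e.2.1, e.2.2, 1)

theorem cubeM_src (e : cubeM.E) : cubeM.src e = cubeSrc e := by
  unfold cubeM cubeSrc
  congr

theorem cubeM_tgt (e : cubeM.E) : cubeM.tgt e = cubeTgt e := by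
  unfold cubeM cubeTgt
  congr

theorem cubeM_ends : cubeM.ends = fun e => s(cubeSrc e, cubeTgt e) := by
  funext e
  rw [← cubeM_src, ← cubeM_tgt]
  rfl

theorem lists_C : Lists cubeM eC cubeEquiv where
  lt := by decide
  nodup := by decide
  inj := by
    rw [cubeM_ends]
    exact show Function.Injective fun e : Fin 3 × Fin 2 × Fin 2 => s(cubeSrc e, cubeTgt e) by
      unfold Function.Injective; decide +kernel
  ends_mem := by
    intro f
    rw [cubeM_src, cubeM_tgt]
    revert f
    exact show ∀ f : Fin 3 × Fin 2 × Fin 2, (cubeEquiv (cubeSrc f), cubeEquiv (cubeTgt f)) ∈ eC ∨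
      (cubeEquiv (cubeTgt f), cubeEquiv (cubeSrc f)) ∈ eC by decide +kernel
  exists_ends := by
    rw [cubeM_ends]
    exact show ∀ e ∈ eC, ∃ f : Fin 3 × Fin 2 × Fin 2,
      s(cubeSrc f, cubeTgt f) = s(cubeEquiv.symm e.1, cubeEquiv.symm e.2) by decide +kernel

theorem lists_O : Lists octaM eO octaEquiv where
  lt := by decide
  nodup := by decide
  inj := show Function.Injective
      fun e : {p : (Fin 3 × Fin 2) × (Fin 3 × Fin 2) // p.1.1 < p.2.1} => s(e.1.1, e.1.2) by
    unfold Function.Injective; decide +kernel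
  ends_mem := show ∀ f : {p : (Fin 3 × Fin 2) × (Fin 3 × Fin 2) // p.1.1 < p.2.1},
    (octaEquiv f.1.1, octaEquiv f.1.2) ∈ eO ∨ (octaEquiv f.1.2, octaEquiv f.1.1) ∈ eO by
      decide +kernel
  exists_ends := show ∀ e ∈ eO, ∃ f : {p : (Fin 3 × Fin 2) × (Fin 3 × Fin 2) // p.1.1 < p.2.1},
    s(f.1.1, f.1.2) = s(octaEquiv.symm e.1, octaEquiv.symm e.2) by decide +kernel

end WidthThree

/-! ### The statement -/

open Multigraph

/-- A simple 3-connected graph has width at most 3 iff it has no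
minor in `F₀ = {K₃,₃, K₅, C, H, O}`. -/
theorem stmt0 (G : Multigraph) (hs : G.Simple) (h3 : G.ThreeConnected) :
    G.WidthLE 3 ↔
      (¬ G.HasMinor K33m ∧ ¬ G.HasMinor K5m ∧ ¬ G.HasMinor cubeM ∧
        ¬ G.HasMinor Hm ∧ ¬ G.HasMinor octaM) := by
  constructor
  · exact fun hw => ⟨WidthThree.lists_K33.not_hasMinor WidthThree.wide_eK33 (by decide) hw,
      WidthThree.lists_K5.not_hasMinor WidthThree.wide_eK5 (by decide) hw,
      WidthThree.lists_C.not_hasMinor WidthThree.wide_eC (by decide) hw,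
      WidthThree.lists_H.not_hasMinor WidthThree.wide_eH (by decide) hw,
      WidthThree.lists_O.not_hasMinor WidthThree.wide_eO (by decide) hw⟩
  · rintro ⟨h33, h5, hC, hH, hO⟩
    rcases WidthThree.TC.sweepable_or_minors _ (WidthThree.underlying G) Finset.univ rfl
      (WidthThree.tc_of_threeConnected h3) with h | h | h | h | h | h
    · exact h.widthLE hs
    · exact (h33 (WidthThree.lists_K33.hasMinor h)).elim
    · exact (h5 (WidthThree.lists_K5.hasMinor h)).elim
    · exact (hC (WidthThree.lists_C.hasMinor h)).elim
    · exact (hH (WidthThree.lists_H.hasMinor h)).elim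
    · exact (hO (WidthThree.lists_O.hasMinor h)).elim
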